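/- Let F/K be a finite Galois extension of number fields with Galois group G and let d be the degree of K over ℚ. Define Ψ(F/K) = [O_F^×] − [X_{S∞}] − [Cl_F] ∈ G₀(ℤ[G]), where S∞ is the set of archimedean places of F, X_{S∞} = ker(ℤ[S∞] → ℤ) is the augmentation kernel, and Cl_F is the ideal class group of F. Then: (i) the equality [Ãr_F] = d·[ℤ[G]] − [ℤ] holds in G₀(ℤ[G]) if and only if Ψ(F/K) = 0; and (ii) Ψ(F/K) always lies in the torsion subgroup G₀(ℤ[G])_tors. -/

import Mathlib

/-- A bundled finitely generated module over a ring `R`. -/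
structure FGMod (R : Type) [Ring R] : Type 1 where
  carrier : Type
  [isAddCommGroup : AddCommGroup carrier]
  [isModule : Module R carrier]
  [isFinite : Module.Finite R carrier]

attribute [instance] FGMod.isAddCommGroup FGMod.isModule FGMod.isFinite

/-- The subgroup of relations defining the Grothendieck group `G₀(R)`:
one relation `[M] = [L] + [N]` for each short exact sequence `0 → L → M → N → 0`
of finitely generated `R`-modules. -/
def G0Rel (R : Type) [Ring R] : AddSubgroup (FreeAbelianGroup (FGMod R)) :=
  AddSubgroup.closure
    { x | ∃ (L M N : FGMod R) (f : L.carrier →ₗ[R] M.carrier)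
            (g : M.carrier →ₗ[R] N.carrier),
        Function.Injective f ∧ Function.Surjective g ∧ Function.Exact f g ∧
        x = FreeAbelianGroup.of M - FreeAbelianGroup.of L - FreeAbelianGroup.of N }

/-- The Grothendieck group `G₀(R)` of the category of finitely generated `R`-modules. -/
def G0 (R : Type) [Ring R] : Type 1 :=
  FreeAbelianGroup (FGMod R) ⧸ G0Rel R

instance (R : Type) [Ring R] : AddCommGroup (G0 R) :=
  QuotientAddGroup.Quotient.addCommGroup _

/-- The class `[M] ∈ G₀(R)` of a finitely generated `R`-module `M` (junk value `0` if `M` is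
not finitely generated). -/
noncomputable def G0.cls (R : Type) [Ring R] (M : Type) [AddCommGroup M] [Module R M] :
    G0 R := by
  classical
  exact
    if h : Module.Finite R M then
      QuotientAddGroup.mk (FreeAbelianGroup.of (@FGMod.mk R _ M _ _ h))
    else 0

open NumberField
open scoped nonZeroDivisors TensorProduct

noncomputable section

variable (F : Type) [Field F] [NumberField F]

/-- The étale ℝ-algebra F_ℝ = F ⊗_ℚ ℝ. -/
abbrev FReal := ℝ ⊗[ℚ] F

/-- The canonical (finite-dimensional real vector space) topology on F_ℝ. -/
instance : TopologicalSpace (FReal F) :=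
  TopologicalSpace.induced (Module.finBasis ℝ (FReal F)).equivFun inferInstance

/-- The group of fractional ideals of F. -/
abbrev IdealGroup := (FractionalIdeal (𝓞 F)⁰ F)ˣ

/-- The group of fractional ideals carries the discrete topology. -/
instance : TopologicalSpace (IdealGroup F) := ⊥

/-- The ideal norm, as a group homomorphism to ℝˣ. -/
def idealNormHom : IdealGroup F →* ℝˣ :=
  (Units.map (Rat.castHom ℝ).toMonoidHom).comp
    (Units.map (FractionalIdeal.absNorm (R := 𝓞 F) (K := F)).toMonoidHom)

/-- The absolute value of the algebra norm on F_ℝˣ, as a group homomorphism to ℝˣ. -/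
def absNormFR : (FReal F)ˣ →* ℝˣ :=
  (Units.map (absHom (α := ℝ)).toMonoidHom).comp (Units.map (Algebra.norm ℝ (S := FReal F)))

/-- The fibre product Id_F ×_{ℝ>0} F_ℝˣ, i.e. the subgroup of pairs (I, b) with
N(I) = |Nm(b)|, formalized as the kernel of the quotient of the two norm maps. -/
def picDom : Subgroup (IdealGroup F × (FReal F)ˣ) :=
  MonoidHom.ker (((idealNormHom F).comp (MonoidHom.fst _ _)) /
    ((absNormFR F).comp (MonoidHom.snd _ _)))

/-- The map F^× → Id_F ×_{ℝ>0} F_ℝˣ, α ↦ (αO_F, α ⊗ 1). -/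
def principalHom : Fˣ →* IdealGroup F × (FReal F)ˣ :=
  (toPrincipalIdeal (𝓞 F) F).prod
    (Units.map (Algebra.TensorProduct.includeRight : F →ₐ[ℚ] FReal F).toMonoidHom)

/-- The subgroup of the fibre product coming from principal oriented Arakelov divisors. -/
def principalSub : Subgroup (picDom F) :=
  Subgroup.comap (picDom F).subtype (MonoidHom.range (principalHom F))

/-- The oriented Arakelov class group of F: the cokernel of F^× → Id_F ×_{ℝ>0} F_ℝˣ. -/
def PicTilde := picDom F ⧸ principalSub F

instance : CommGroup (PicTilde F) := QuotientGroup.Quotient.commGroup _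
instance : TopologicalSpace (PicTilde F) := instTopologicalSpaceQuotient

/-- The class of an oriented Arakelov divisor in the oriented Arakelov class group. -/
def PicTilde.mk : picDom F → PicTilde F := QuotientGroup.mk

/-- The maximal compact subgroup comp(F_ℝˣ) of F_ℝˣ: the subgroup generated by all
compact subgroups. -/
def maxCompact : Subgroup (FReal F)ˣ :=
  sSup { H : Subgroup (FReal F)ˣ | IsCompact (H : Set (FReal F)ˣ) }

/-- The image of {1} × comp(F_ℝˣ) in the oriented Arakelov class group. -/
def compImage : Subgroup (PicTilde F) :=
  Subgroup.map (QuotientGroup.mk' (principalSub F))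
    (Subgroup.comap (picDom F).subtype ((⊥ : Subgroup (IdealGroup F)).prod (maxCompact F)))

/-- The Arakelov class group of F: the quotient of the oriented Arakelov class group by
the image of {1} × comp(F_ℝˣ). -/
def PicZero := PicTilde F ⧸ compImage F

instance : CommGroup (PicZero F) := QuotientGroup.Quotient.commGroup _
instance : TopologicalSpace (PicZero F) := instTopologicalSpaceQuotient

/-- The class of an oriented Arakelov divisor in the Arakelov class group. -/
def PicZero.mk : picDom F → PicZero F := fun x => QuotientGroup.mk (PicTilde.mk F x)

/-- ℝ/ℤ. -/
abbrev RmodZ := AddCircle (1 : ℝ)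

/-- The Pontryagin dual Ãr_F of the oriented Arakelov class group: the group of
continuous homomorphisms to ℝ/ℤ. -/
def ArTilde := ContinuousAddMonoidHom (Additive (PicTilde F)) RmodZ

instance : AddCommGroup (ArTilde F) := by unfold ArTilde; infer_instance
instance : FunLike (ArTilde F) (Additive (PicTilde F)) RmodZ := by unfold ArTilde; infer_instance

/-- The Pontryagin dual Ar_F of the Arakelov class group. -/
def ArF := ContinuousAddMonoidHom (Additive (PicZero F)) RmodZ

instance : AddCommGroup (ArF F) := by unfold ArF; infer_instance
instance : FunLike (ArF F) (Additive (PicZero F)) RmodZ := by unfold ArF; infer_instance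

/-- ℚ/ℤ as a ℤ-module. -/
abbrev QmodZ := ℚ ⧸ (Submodule.span ℤ {(1 : ℚ)})

variable {F} in
/-- The automorphism of F_ℝ = ℝ ⊗_ℚ F induced by an automorphism of F over a subfield K. -/
def galFReal (K : Type) [Field K] [CharZero K] [Algebra K F] (g : F ≃ₐ[K] F) : FReal F ≃ₐ[ℚ] FReal F :=
  Algebra.TensorProduct.congr AlgEquiv.refl (g.restrictScalars ℚ)

end


namespace OArakelov

section Grothendieck

variable {R : Type} [Ring R]

/-- The quotient map defining `G₀(R)`. -/
def G0mk (R : Type) [Ring R] : FreeAbelianGroup (FGMod R) →+ G0 R :=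
  QuotientAddGroup.mk' (G0Rel R)

theorem cls_eq_mk (M : FGMod R) :
    G0.cls R M.carrier = G0mk R (FreeAbelianGroup.of M) :=
  dif_pos M.isFinite

/-- Homomorphisms out of `G₀(R)` are additive invariants of finitely generated modules. -/
def G0lift {A : Type*} [AddCommGroup A] (d : FGMod R → A)
    (h : ∀ (L M N : FGMod R) (f : L.carrier →ₗ[R] M.carrier) (g : M.carrier →ₗ[R] N.carrier),
      Function.Injective f → Function.Surjective g → Function.Exact f g → d M = d L + d N) :
    G0 R →+ A :=
  QuotientAddGroup.lift (G0Rel R) (FreeAbelianGroup.lift d) <| by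
    rw [G0Rel, AddSubgroup.closure_le]
    rintro x ⟨L, M, N, f, g, hf, hg, hfg, rfl⟩
    simp [h L M N f g hf hg hfg]

theorem G0lift_cls {A : Type*} [AddCommGroup A] (d : FGMod R → A) (h) (M : FGMod R) :
    G0lift d h (G0.cls R M.carrier) = d M := by
  rw [cls_eq_mk]
  exact (QuotientAddGroup.lift_mk _ _ _).trans (FreeAbelianGroup.lift_apply_of _ _)

theorem G0_hom_ext {A : Type*} [AddCommGroup A] {φ ψ : G0 R →+ A}
    (h : ∀ M : FGMod R, φ (G0.cls R M.carrier) = ψ (G0.cls R M.carrier)) : φ = ψ := by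
  have : φ.comp (G0mk R) = ψ.comp (G0mk R) := by
    ext M
    exact (congrArg φ (cls_eq_mk M)).symm.trans ((h M).trans (congrArg ψ (cls_eq_mk M)))
  ext x
  obtain ⟨y, rfl⟩ := QuotientAddGroup.mk'_surjective _ x
  exact DFunLike.congr_fun this y

section

variable {L M N : Type} [AddCommGroup L] [AddCommGroup M] [AddCommGroup N]
  [Module R L] [Module R M] [Module R N]

theorem cls_of_exact [hL : Module.Finite R L] [hM : Module.Finite R M] [hN : Module.Finite R N]
    (f : L →ₗ[R] M) (g : M →ₗ[R] N) (hf : Function.Injective f) (hg : Function.Surjective g)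
    (hfg : Function.Exact f g) : G0.cls R M = G0.cls R L + G0.cls R N := by
  have h : G0mk R (FreeAbelianGroup.of (FGMod.mk M : FGMod R) -
      FreeAbelianGroup.of (FGMod.mk L) - FreeAbelianGroup.of (FGMod.mk N)) = 0 :=
    (QuotientAddGroup.eq_zero_iff _).2
      (AddSubgroup.subset_closure ⟨_, _, _, f, g, hf, hg, hfg, rfl⟩)
  have h1 := cls_eq_mk (FGMod.mk M : FGMod R)
  have h2 := cls_eq_mk (FGMod.mk L : FGMod R)
  have h3 := cls_eq_mk (FGMod.mk N : FGMod R)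
  dsimp only at h1 h2 h3
  rw [map_sub, map_sub, sub_sub, sub_eq_zero] at h
  rw [h1, h2, h3, h]

theorem cls_of_subsingleton [Subsingleton M] : G0.cls R M = 0 := by
  have := cls_of_exact (R := R) (L := M) (M := M) (N := M) LinearMap.id LinearMap.id
    Function.injective_id Function.surjective_id (fun y => by simp [Subsingleton.elim y 0])
  simpa using this

theorem cls_congr (e : M ≃ₗ[R] N) : G0.cls R M = G0.cls R N := by
  by_cases h : Module.Finite R M
  · have : Module.Finite R N := Module.Finite.equiv e
    have := cls_of_exact (R := R) (L := PUnit) (M := M) (N := N) 0 e.toLinearMap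
      (fun x y _ => Subsingleton.elim _ _) e.surjective
      (fun y => by simp [eq_comm (a := (0 : M))])
    simpa [cls_of_subsingleton] using this
  · have h' : ¬ Module.Finite R N := fun h' => h (Module.Finite.equiv e.symm)
    simp [G0.cls, h, h']

variable [IsNoetherianRing R]

theorem cls_eq_add [Module.Finite R M] (f : L →ₗ[R] M) (g : M →ₗ[R] N)
    (hf : Function.Injective f) (hg : Function.Surjective g) (hfg : Function.Exact f g) :
    G0.cls R M = G0.cls R L + G0.cls R N := by
  have : Module.Finite R L := Module.Finite.of_injective f hf
  have : Module.Finite R N := Module.Finite.of_surjective g hg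
  exact cls_of_exact f g hf hg hfg

theorem cls_eq_submodule_add_quotient [Module.Finite R M] (p : Submodule R M) :
    G0.cls R M = G0.cls R p + G0.cls R (M ⧸ p) :=
  cls_eq_add p.subtype p.mkQ p.subtype_injective p.mkQ_surjective
    (LinearMap.exact_subtype_mkQ p)

theorem cls_eq_ker_add_range [Module.Finite R M] (f : M →ₗ[R] N) :
    G0.cls R M = G0.cls R (LinearMap.ker f) + G0.cls R (LinearMap.range f) := by
  rw [cls_eq_submodule_add_quotient (LinearMap.ker f), cls_congr f.quotKerEquivRange]

theorem cls_prod [Module.Finite R M] [Module.Finite R N] :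
    G0.cls R (M × N) = G0.cls R M + G0.cls R N :=
  cls_eq_add (LinearMap.inl R M N) (LinearMap.snd R M N) LinearMap.inl_injective
    LinearMap.snd_surjective Function.Exact.inl_snd

theorem cls_fin_fun [Module.Finite R M] (n : ℕ) : G0.cls R (Fin n → M) = n • G0.cls R M := by
  induction n with
  | zero => simp [cls_of_subsingleton]
  | succ n ih =>
    rw [← cls_congr (Fin.consLinearEquiv R fun _ : Fin (n + 1) => M), cls_prod, ih, succ_nsmul']

theorem cls_fun {ι : Type} [Fintype ι] [Module.Finite R M] :
    G0.cls R (ι → M) = Fintype.card ι • G0.cls R M := by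
  rw [← cls_fin_fun]
  exact cls_congr (LinearEquiv.funCongrLeft R M (Fintype.equivFin ι).symm)

/-- An additive relation valid on simple modules is valid on modules of finite cardinality. -/
theorem torsion_cls_of_simple
    (H : ∀ (S : Type) [AddCommGroup S] [Module R S] [IsSimpleModule R S] [Finite S],
      ∃ n : ℕ, 0 < n ∧ n • G0.cls R S = 0) (T : Type) [AddCommGroup T] [Module R T] [Finite T] :
    ∃ n : ℕ, 0 < n ∧ n • G0.cls R T = 0 := by
  induction hc : Nat.card T using Nat.strong_induction_on generalizing T with
  | _ c ih =>
    subst hc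
    rcases subsingleton_or_nontrivial T with h | h
    · exact ⟨1, one_pos, by simp [cls_of_subsingleton]⟩
    by_cases hs : IsSimpleModule R T
    · exact H T
    have : ∃ p : Submodule R T, p ≠ ⊥ ∧ p ≠ ⊤ := by
      by_contra! hp
      exact hs ((isSimpleModule_iff R T).2 ⟨fun p => or_iff_not_imp_left.2 (hp p)⟩)
    obtain ⟨p, hp, hp'⟩ := this
    have hcard := p.card_eq_card_quotient_mul_card
    have : Finite (T ⧸ p) := Finite.of_surjective _ p.mkQ_surjective
    have h1 : 1 < Nat.card p := by
      rw [Finite.one_lt_card_iff_nontrivial]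
      exact Submodule.nontrivial_iff_ne_bot.2 hp
    have h2 : 1 < Nat.card (T ⧸ p) := by
      rw [Finite.one_lt_card_iff_nontrivial]
      exact Submodule.Quotient.nontrivial_iff.2 hp'
    obtain ⟨a, ha, ha'⟩ := ih (Nat.card p) (by nlinarith) p rfl
    obtain ⟨b, hb, hb'⟩ := ih (Nat.card (T ⧸ p)) (by nlinarith) (T ⧸ p) rfl
    refine ⟨a * b, Nat.mul_pos ha hb, ?_⟩
    rw [cls_eq_submodule_add_quotient p, nsmul_add, mul_comm, mul_nsmul', ha', mul_comm,
      mul_nsmul', hb']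
    simp

end

end Grothendieck

end OArakelov

namespace OArakelov

noncomputable section GroupRing

open scoped MonoidAlgebra

variable {G : Type} [Group G]

/-- The action of a group element on a module over the integral group ring. -/
local notation:73 g:74 "⋆" m:73 => (MonoidAlgebra.single g (1 : ℤ)) • m

/-- The module over the integral group ring attached to an action by additive maps. -/
abbrev moduleOfAction {M : Type} [AddCommGroup M] (ρ : G →* AddMonoid.End M) : Module ℤ[G] M :=
  Module.compHom M (MonoidAlgebra.lift ℤ (AddMonoid.End M) G ρ).toRingHom

theorem moduleOfAction_single {M : Type} [AddCommGroup M] (ρ : G →* AddMonoid.End M) (g : G)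
    (m : M) : letI := moduleOfAction ρ; g ⋆ m = ρ g m := by
  change (MonoidAlgebra.lift ℤ (AddMonoid.End M) G ρ (MonoidAlgebra.single g 1)) m = _
  rw [MonoidAlgebra.lift_single, one_smul]

section

variable {M N : Type} [AddCommGroup M] [AddCommGroup N] [Module ℤ[G] M] [Module ℤ[G] N]

theorem one_act (m : M) : (1 : G) ⋆ m = m := one_smul ℤ[G] m

theorem mul_act (g h : G) (m : M) : (g * h) ⋆ m = g ⋆ h ⋆ m := by
  rw [smul_smul, MonoidAlgebra.single_mul_single, one_mul]

@[simp] theorem act_inv_act (g : G) (m : M) : g ⋆ g⁻¹ ⋆ m = m := by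
  rw [← mul_act, mul_inv_cancel, one_act]

@[simp] theorem inv_act_act (g : G) (m : M) : g⁻¹ ⋆ g ⋆ m = m := by
  rw [← mul_act, inv_mul_cancel, one_act]

theorem act_zsmul (g : G) (n : ℤ) (m : M) : g ⋆ (n • m) = n • g ⋆ m := smul_comm _ _ _

/-- The action of a group element as an additive endomorphism. -/
def actHom (M : Type) [AddCommGroup M] [Module ℤ[G] M] (g : G) : M →+ M :=
  DistribSMul.toAddMonoidHom M (MonoidAlgebra.single g (1 : ℤ) : ℤ[G])

@[simp] theorem actHom_apply (g : G) (m : M) : actHom M g m = g ⋆ m := rfl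

/-- An equivariant additive map is linear over the group ring. -/
def linOfEquivariant (f : M →+ N) (h : ∀ (g : G) (m : M), f (g ⋆ m) = g ⋆ f m) :
    M →ₗ[ℤ[G]] N where
  toFun := f
  map_add' := f.map_add
  map_smul' r m := by
    induction r using MonoidAlgebra.induction_linear with
    | zero => simp
    | add x y hx hy => simp only [add_smul, map_add, hx, hy, RingHom.id_apply] at *
    | single g n =>
      have : (MonoidAlgebra.single g n : ℤ[G]) = n • MonoidAlgebra.single g 1 := by simp
      rw [RingHom.id_apply, this, smul_assoc, smul_assoc, map_zsmul, h]

@[simp] theorem linOfEquivariant_apply (f : M →+ N) (h) (m : M) :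
    linOfEquivariant (G := G) f h m = f m := rfl

/-- An equivariant additive equivalence is linear over the group ring. -/
def equivOfEquivariant (f : M ≃+ N) (h : ∀ (g : G) (m : M), f (g ⋆ m) = g ⋆ f m) :
    M ≃ₗ[ℤ[G]] N :=
  { linOfEquivariant f.toAddMonoidHom h, f with }

@[simp] theorem equivOfEquivariant_apply (f : M ≃+ N) (h) (m : M) :
    equivOfEquivariant (G := G) f h m = f m := rfl

/-- A subgroup stable under the group is a submodule over the group ring. -/
def submoduleOfStable (S : AddSubgroup M) (h : ∀ (g : G), ∀ m ∈ S, g ⋆ m ∈ S) :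
    Submodule ℤ[G] M :=
  { S with
    smul_mem' := fun r m hm => by
      induction r using MonoidAlgebra.induction_linear with
      | zero => simp
      | add x y hx hy => rw [add_smul]; exact S.add_mem hx hy
      | single g n =>
        have : (MonoidAlgebra.single g n : ℤ[G]) = n • MonoidAlgebra.single g 1 := by simp
        rw [this, smul_assoc]
        exact S.zsmul_mem (h g m hm) n }

@[simp] theorem mem_submoduleOfStable (S : AddSubgroup M) (h) (m : M) :
    m ∈ submoduleOfStable (G := G) S h ↔ m ∈ S := Iff.rfl

variable [Finite G]

instance : Module.Finite ℤ ℤ[G] :=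
  Module.Finite.equiv (MonoidAlgebra.coeffLinearEquiv ℤ (S := ℤ) (M := G)).symm

instance : IsNoetherianRing ℤ[G] := isNoetherian_of_tower ℤ inferInstance

theorem finite_int [Module.Finite ℤ[G] M] : Module.Finite ℤ M := Module.Finite.trans ℤ[G] M

omit [Finite G] in
theorem finite_groupRing [Module.Finite ℤ M] : Module.Finite ℤ[G] M :=
  Module.Finite.of_restrictScalars_finite ℤ ℤ[G] M

instance (priority := 50) [Finite M] : Module.Finite ℤ[G] M := finite_groupRing

end

/-- An abelian group with trivial action. -/
def Triv (_ : Type) (A : Type) : Type := A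

instance (A : Type) [h : AddCommGroup A] : AddCommGroup (Triv G A) := h
instance (A : Type) [AddCommGroup A] : Module ℤ[G] (Triv G A) :=
  moduleOfAction (M := Triv G A) 1

@[simp] theorem triv_act (A : Type) [AddCommGroup A] (g : G) (a : Triv G A) : g ⋆ a = a :=
  moduleOfAction_single (M := Triv G A) 1 g a

/-- Additive homomorphisms between two modules, with the conjugation action. -/
def GHom (_ : Type) (M A : Type) [AddCommGroup M] [AddCommGroup A] : Type := M →+ A

section

variable {M N A B : Type} [AddCommGroup M] [AddCommGroup N] [AddCommGroup A] [AddCommGroup B]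

instance : AddCommGroup (GHom G M A) := inferInstanceAs (AddCommGroup (M →+ A))
instance : FunLike (GHom G M A) M A := inferInstanceAs (FunLike (M →+ A) M A)
instance : AddMonoidHomClass (GHom G M A) M A := inferInstanceAs (AddMonoidHomClass (M →+ A) M A)

omit [Group G] in
@[ext] theorem GHom.ext {f g : GHom G M A} (h : ∀ m, f m = g m) : f = g := DFunLike.ext _ _ h
omit [Group G] in
@[simp] theorem GHom.add_apply (f g : GHom G M A) (m : M) : (f + g) m = f m + g m := rfl
omit [Group G] in
@[simp] theorem GHom.zero_apply (m : M) : (0 : GHom G M A) m = 0 := rfl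

variable [Module ℤ[G] M] [Module ℤ[G] N] [Module ℤ[G] A] [Module ℤ[G] B]

instance : Module ℤ[G] (GHom G M A) :=
  moduleOfAction (M := GHom G M A)
    { toFun g :=
        { toFun f := ((actHom A g).comp (f : M →+ A)).comp (actHom M g⁻¹)
          map_zero' := DFunLike.ext _ _ fun m => map_zero (actHom A g)
          map_add' f h := by
            refine DFunLike.ext _ _ fun m => ?_
            exact map_add (actHom A g) _ _ }
      map_one' := by
        refine AddMonoidHom.ext fun f => GHom.ext fun m => ?_
        change (1 : G) ⋆ f ((1 : G)⁻¹ ⋆ m) = f m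
        rw [inv_one, one_act, one_act]
      map_mul' g h := by
        refine AddMonoidHom.ext fun f => GHom.ext fun m => ?_
        change (g * h) ⋆ f ((g * h)⁻¹ ⋆ m) = g ⋆ h ⋆ f (h⁻¹ ⋆ g⁻¹ ⋆ m)
        rw [mul_inv_rev, mul_act, mul_act] }

@[simp] theorem GHom.act_apply (g : G) (f : GHom G M A) (m : M) :
    (g ⋆ f) m = g ⋆ f (g⁻¹ ⋆ m) := by
  rw [moduleOfAction_single]; rfl

/-- Precomposition. -/
def GHom.precomp (φ : M →ₗ[ℤ[G]] N) :
    GHom G N A →ₗ[ℤ[G]] GHom G M A :=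
  linOfEquivariant
    { toFun f := (f : N →+ A).comp φ.toAddMonoidHom
      map_zero' := rfl
      map_add' _ _ := rfl } fun g f => GHom.ext fun m => by
        change (g ⋆ f) (φ m) = (g ⋆ (show GHom G M A from (f : N →+ A).comp φ.toAddMonoidHom)) m
        rw [GHom.act_apply, GHom.act_apply, ← φ.map_smul]
        rfl

@[simp] theorem GHom.precomp_apply (φ : M →ₗ[ℤ[G]] N) (f : GHom G N A) (m : M) :
    GHom.precomp φ f m = f (φ m) := rfl

variable (G M) in
/-- Homomorphisms to a module with trivial action are additive homomorphisms. -/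
def GHom.untriv (A : Type) [AddCommGroup A] : GHom G M (Triv G A) ≃+ (M →+ A) := AddEquiv.refl _

@[simp] theorem GHom.untriv_act (A : Type) [AddCommGroup A] (g : G) (f : GHom G M (Triv G A))
    (m : M) : GHom.untriv G M A (g ⋆ f) m = GHom.untriv G M A f (g⁻¹ ⋆ m) :=
  (GHom.act_apply g f m).trans (triv_act A g _)

@[simp] theorem GHom.untriv_precomp (A : Type) [AddCommGroup A] (φ : M →ₗ[ℤ[G]] N)
    (f : GHom G N (Triv G A)) (m : M) :
    GHom.untriv G M A (GHom.precomp φ f) m = GHom.untriv G N A f (φ m) := rfl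

omit [Group G] [Module ℤ[G] M] in
theorem GHom.untriv_ext {A : Type} [AddCommGroup A] {f h : GHom G M (Triv G A)}
    (H : ∀ m, GHom.untriv G M A f m = GHom.untriv G M A h m) : f = h := GHom.ext H

theorem GHom.finite [Module.Finite ℤ M] [Module.Finite ℤ A] : Module.Finite ℤ[G] (GHom G M A) := by
  obtain ⟨n, s, hs⟩ := Module.Finite.exists_fin (R := ℤ) (M := M)
  have : Module.Finite ℤ (GHom G M A) := by
    refine Module.Finite.of_injective (N := Fin n → A)
      (AddMonoidHom.toIntLinearMap
        { toFun := fun f i => f (s i), map_zero' := rfl, map_add' := fun _ _ => rfl }) ?_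
    intro f g hfg
    have : (f : M →+ A).toIntLinearMap = (g : M →+ A).toIntLinearMap :=
      LinearMap.ext_on hs (by rintro _ ⟨i, rfl⟩; exact congrFun hfg i)
    ext m
    exact LinearMap.congr_fun this m
  exact finite_groupRing

end

end GroupRing

end OArakelov

namespace OArakelov

noncomputable section Duality

open scoped MonoidAlgebra

variable {G : Type} [Group G] [Finite G]

local notation:73 g:74 "⋆" m:73 => (MonoidAlgebra.single g (1 : ℤ)) • m

instance : Module.Finite ℤ (Triv G ℤ) := inferInstanceAs (Module.Finite ℤ ℤ)
instance : Module.IsTorsionFree ℤ (Triv G ℤ) := inferInstanceAs (Module.IsTorsionFree ℤ ℤ)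

variable (G) in
/-- The integral dual of a module over the group ring. -/
abbrev IntDual (M : Type) [AddCommGroup M] : Type := GHom G M (Triv G ℤ)

section

variable {L M N P K : Type} [AddCommGroup L] [AddCommGroup M] [AddCommGroup N]
  [AddCommGroup P] [AddCommGroup K]

omit [Finite G] in
instance : Module.IsTorsionFree ℤ (IntDual G M) :=
  Function.Injective.moduleIsTorsionFree (N := M → ℤ) (fun f m => f m)
    (fun _ _ h => GHom.ext fun m => congrFun h m) (fun n f => by
      funext m
      exact map_zsmul
        (({ toFun := fun f => f m, map_zero' := rfl, map_add' := fun _ _ => rfl } :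
          IntDual G M →+ ℤ)) n f)

variable [Module ℤ[G] L] [Module ℤ[G] M] [Module ℤ[G] N] [Module ℤ[G] P] [Module ℤ[G] K]

instance [Module.Finite ℤ[G] M] : Module.Finite ℤ[G] (IntDual G M) := by
  have := finite_int (G := G) (M := M)
  exact GHom.finite

theorem cls_gHom_of_exact (A : Type) [AddCommGroup A] [Module ℤ[G] A] [Module.Finite ℤ A]
    [Module.Finite ℤ[G] M] [Module.IsTorsionFree ℤ N] (i : L →ₗ[ℤ[G]] M)
    (q : M →ₗ[ℤ[G]] N) (hi : Function.Injective i) (hq : Function.Surjective q)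
    (hiq : Function.Exact i q) :
    G0.cls ℤ[G] (GHom G M A) = G0.cls ℤ[G] (GHom G N A) + G0.cls ℤ[G] (GHom G L A) := by
  have : Module.Finite ℤ[G] N := Module.Finite.of_surjective q hq
  have := finite_int (G := G) (M := M)
  have : Module.Finite ℤ[G] (GHom G M A) := GHom.finite
  have := finite_int (G := G) (M := N)
  refine cls_eq_add (GHom.precomp q) (GHom.precomp i) ?_ ?_ ?_
  · intro f g hfg
    ext n
    obtain ⟨m, rfl⟩ := hq n
    exact DFunLike.congr_fun hfg m
  · intro f
    obtain ⟨s, hs⟩ := Module.projective_lifting_property (q.restrictScalars ℤ)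
      (LinearMap.id : N →ₗ[ℤ] N) hq
    have hr : ∀ m : M, ∃ l : L, i l = m - s (q m) := fun m => by
      refine (hiq _).1 ?_
      have := LinearMap.congr_fun hs (q m)
      simp only [LinearMap.coe_comp, Function.comp_apply, LinearMap.restrictScalars_apply,
        LinearMap.id_apply] at this
      rw [map_sub, this, sub_self]
    choose r hr using hr
    refine ⟨(f : L →+ A).comp
      { toFun := r, map_zero' := hi (by simp [hr]), map_add' := fun x y => hi ?_ }, ?_⟩
    · simp only [hr, map_add]; abel
    · ext l
      have hl : r (i l) = l := hi (by rw [hr, hiq.apply_apply_eq_zero]; simp)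
      exact congrArg f hl
  · intro f
    constructor
    · intro hf
      have hf' : ∀ l, f (i l) = 0 := fun l => DFunLike.congr_fun hf l
      have hker : ∀ m, q m = 0 → f m = 0 := fun m hm => by
        obtain ⟨l, rfl⟩ := (hiq m).1 hm
        exact hf' l
      choose s hs using hq
      refine ⟨({ toFun := fun n => f (s n), map_zero' := hker _ (hs 0), map_add' := fun x y => ?_ } :
        N →+ A), ?_⟩
      · change f _ = f _ + f _
        rw [← map_add, ← sub_eq_zero, ← map_sub]
        exact hker _ (by simp [hs])
      · ext m
        change f (s (q m)) = f m
        rw [← sub_eq_zero, ← map_sub]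
        exact hker _ (by simp [hs])
    · rintro ⟨g, rfl⟩
      ext l
      simp [hiq.apply_apply_eq_zero]

theorem cls_intDual_of_exact [Module.Finite ℤ[G] M] [Module.IsTorsionFree ℤ N] (i : L →ₗ[ℤ[G]] M)
    (q : M →ₗ[ℤ[G]] N) (hi : Function.Injective i) (hq : Function.Surjective q)
    (hiq : Function.Exact i q) :
    G0.cls ℤ[G] (IntDual G M) = G0.cls ℤ[G] (IntDual G N) + G0.cls ℤ[G] (IntDual G L) :=
  cls_gHom_of_exact (Triv G ℤ) i q hi hq hiq

end

section

variable {M P P' K K' : Type} [AddCommGroup M] [AddCommGroup P] [AddCommGroup K]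
  [AddCommGroup P'] [AddCommGroup K']
  [Module ℤ[G] M] [Module ℤ[G] P] [Module ℤ[G] K] [Module ℤ[G] P'] [Module ℤ[G] K']

theorem cls_intDual_schanuel [Module.Finite ℤ[G] P] [Module.Finite ℤ[G] P']
    [Module.IsTorsionFree ℤ P] [Module.IsTorsionFree ℤ P']
    (i : K →ₗ[ℤ[G]] P) (q : P →ₗ[ℤ[G]] M) (i' : K' →ₗ[ℤ[G]] P') (q' : P' →ₗ[ℤ[G]] M)
    (hi : Function.Injective i) (hq : Function.Surjective q) (hiq : Function.Exact i q)
    (hi' : Function.Injective i') (hq' : Function.Surjective q') (hiq' : Function.Exact i' q') :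
    G0.cls ℤ[G] (IntDual G P) - G0.cls ℤ[G] (IntDual G K) =
      G0.cls ℤ[G] (IntDual G P') - G0.cls ℤ[G] (IntDual G K') := by
  let Q : Submodule ℤ[G] (P × P') :=
    LinearMap.ker (q ∘ₗ LinearMap.fst _ _ _ - q' ∘ₗ LinearMap.snd _ _ _)
  have hQ : ∀ x : P × P', x ∈ Q ↔ q x.1 = q' x.2 := fun x => by simp [Q, sub_eq_zero]
  have h1 := cls_intDual_of_exact (L := K') (M := Q) (N := P)
    ((LinearMap.inr ℤ[G] P P' ∘ₗ i').codRestrict Q fun x => by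
      simp [hQ, hiq'.apply_apply_eq_zero])
    (LinearMap.fst _ _ _ ∘ₗ Q.subtype)
    (fun x y h => hi' (congrArg (fun z : Q => (z : P × P').2) h))
    (fun p => by
      obtain ⟨p', hp'⟩ := hq' (q p)
      exact ⟨⟨(p, p'), (hQ _).2 hp'.symm⟩, rfl⟩)
    (by
      rintro ⟨⟨x, y⟩, hx⟩
      constructor
      · intro h
        simp only [LinearMap.coe_comp, Function.comp_apply, Submodule.subtype_apply,
          LinearMap.fst_apply] at h
        subst h
        obtain ⟨k, hk⟩ := (hiq' y).1 (by rw [hQ] at hx; simpa using hx.symm)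
        exact ⟨k, Subtype.ext (Prod.ext rfl hk)⟩
      · rintro ⟨k, hk⟩
        exact (congrArg (fun z : Q => (z : P × P').1) hk).symm)
  have h2 := cls_intDual_of_exact (L := K) (M := Q) (N := P')
    ((LinearMap.inl ℤ[G] P P' ∘ₗ i).codRestrict Q fun x => by
      simp [hQ, hiq.apply_apply_eq_zero])
    (LinearMap.snd _ _ _ ∘ₗ Q.subtype)
    (fun x y h => hi (congrArg (fun z : Q => (z : P × P').1) h))
    (fun p' => by
      obtain ⟨p, hp⟩ := hq (q' p')
      exact ⟨⟨(p, p'), (hQ _).2 hp⟩, rfl⟩)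
    (by
      rintro ⟨⟨x, y⟩, hx⟩
      constructor
      · intro h
        simp only [LinearMap.coe_comp, Function.comp_apply, Submodule.subtype_apply,
          LinearMap.snd_apply] at h
        subst h
        obtain ⟨k, hk⟩ := (hiq x).1 (by rw [hQ] at hx; simpa using hx)
        exact ⟨k, Subtype.ext (Prod.ext hk rfl)⟩
      · rintro ⟨k, hk⟩
        exact (congrArg (fun z : Q => (z : P × P').2) hk).symm)
  rw [sub_eq_sub_iff_add_eq_add, ← h1, h2]

end

instance (n : ℕ) : Module.IsTorsionFree ℤ (Fin n → ℤ[G]) := inferInstance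

variable (G) in
omit [Finite G] in
theorem exists_free_surjection (M : Type) [AddCommGroup M] [Module ℤ[G] M] [Module.Finite ℤ[G] M] :
    ∃ (n : ℕ) (q : (Fin n → ℤ[G]) →ₗ[ℤ[G]] M), Function.Surjective q :=
  Module.Finite.exists_fin' ℤ[G] M

/-- The value on a module of the duality of the Grothendieck group, computed from a chosen
presentation. -/
def dualCls (M : FGMod ℤ[G]) : G0 ℤ[G] :=
  G0.cls ℤ[G] (IntDual G (Fin (exists_free_surjection G M.carrier).choose → ℤ[G])) -
    G0.cls ℤ[G] (IntDual G (LinearMap.ker (exists_free_surjection G M.carrier).choose_spec.choose))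

theorem dualCls_eq (M : FGMod ℤ[G]) {P K : Type} [AddCommGroup P] [AddCommGroup K]
    [Module ℤ[G] P] [Module ℤ[G] K] [Module.Finite ℤ[G] P] [Module.IsTorsionFree ℤ P]
    (i : K →ₗ[ℤ[G]] P) (q : P →ₗ[ℤ[G]] M.carrier)
    (hi : Function.Injective i) (hq : Function.Surjective q) (hiq : Function.Exact i q) :
    dualCls M = G0.cls ℤ[G] (IntDual G P) - G0.cls ℤ[G] (IntDual G K) :=
  cls_intDual_schanuel (LinearMap.ker _).subtype _ i q (Submodule.subtype_injective _)
    (exists_free_surjection G M.carrier).choose_spec.choose_spec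
    (LinearMap.exact_subtype_ker_map _) hi hq hiq

variable (G) in
/-- The duality of the Grothendieck group of the integral group ring induced by the derived
functor of `M ↦ Hom(M, ℤ)`. -/
def dualHom : G0 ℤ[G] →+ G0 ℤ[G] :=
  G0lift dualCls fun L M N f g hf hg hfg => by
    obtain ⟨n, q, hq⟩ := exists_free_surjection G M.carrier
    have hM := dualCls_eq M (LinearMap.ker q).subtype q (Submodule.subtype_injective _) hq
      (LinearMap.exact_subtype_ker_map _)
    have hN := dualCls_eq N (LinearMap.ker (g ∘ₗ q)).subtype (g ∘ₗ q)
      (Submodule.subtype_injective _) (hg.comp hq) (LinearMap.exact_subtype_ker_map _)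
    have hr : ∀ x : LinearMap.ker (g ∘ₗ q), q x ∈ LinearMap.range f := fun x =>
      (hfg _).1 x.2
    let e := LinearEquiv.ofInjective f hf
    let r : LinearMap.ker (g ∘ₗ q) →ₗ[ℤ[G]] L.carrier :=
      e.symm.toLinearMap ∘ₗ (q ∘ₗ (LinearMap.ker (g ∘ₗ q)).subtype).codRestrict
        (LinearMap.range f) hr
    have hfr : ∀ x, f (r x) = q x := fun x =>
      congrArg Subtype.val (e.apply_symm_apply ⟨q x, hr x⟩)
    have hL := dualCls_eq L
      (Submodule.inclusion (LinearMap.ker_le_ker_comp q g)) r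
      (Submodule.inclusion_injective _)
      (fun l => by
        obtain ⟨x, hx⟩ := hq (f l)
        refine ⟨⟨x, ?_⟩, hf ?_⟩
        · simp [hx, hfg.apply_apply_eq_zero]
        · rw [hfr, hx])
      (fun x => by
        rw [← map_eq_zero_iff f hf, hfr]
        constructor
        · intro h
          exact ⟨⟨x, h⟩, rfl⟩
        · rintro ⟨y, rfl⟩
          exact y.2)
    rw [hM, hN, hL]
    abel

section

variable {M P K : Type} [AddCommGroup M] [AddCommGroup P] [AddCommGroup K]
  [Module ℤ[G] M] [Module ℤ[G] P] [Module ℤ[G] K]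

theorem dualHom_of_presentation [Module.Finite ℤ[G] P] [Module.IsTorsionFree ℤ P]
    (i : K →ₗ[ℤ[G]] P) (q : P →ₗ[ℤ[G]] M)
    (hi : Function.Injective i) (hq : Function.Surjective q) (hiq : Function.Exact i q) :
    dualHom G (G0.cls ℤ[G] M) = G0.cls ℤ[G] (IntDual G P) - G0.cls ℤ[G] (IntDual G K) := by
  have : Module.Finite ℤ[G] M := Module.Finite.of_surjective q hq
  rw [← dualCls_eq (FGMod.mk M) i q hi hq hiq]
  exact G0lift_cls _ _ (FGMod.mk M)

theorem dualHom_of_torsionFree [Module.Finite ℤ[G] P] [Module.IsTorsionFree ℤ P] :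
    dualHom G (G0.cls ℤ[G] P) = G0.cls ℤ[G] (IntDual G P) := by
  have h := dualHom_of_presentation (0 : PUnit →ₗ[ℤ[G]] P) LinearMap.id
    (fun _ _ _ => Subsingleton.elim _ _) Function.surjective_id (fun y => by simp [eq_comm])
  have : Subsingleton (IntDual G PUnit.{1}) :=
    ⟨fun f g => GHom.ext fun m => by rw [Subsingleton.elim m 0, map_zero, map_zero]⟩
  rw [h, cls_of_subsingleton (M := IntDual G PUnit), sub_zero]

/-- Evaluation into the integral bidual. -/
def evalBidual : P →ₗ[ℤ[G]] IntDual G (IntDual G P) :=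
  linOfEquivariant
    { toFun p := show GHom G (IntDual G P) (Triv G ℤ) from
        { toFun := fun f => f p, map_zero' := rfl, map_add' := fun _ _ => rfl }
      map_zero' := GHom.ext fun f => map_zero f
      map_add' x y := GHom.ext fun f => map_add f x y } fun g p => GHom.ext fun f => by
        rw [GHom.act_apply]
        change f (g ⋆ p) = g ⋆ (g⁻¹ ⋆ f) p
        rw [GHom.act_apply, inv_inv, triv_act, triv_act]

theorem cls_bidual [Module.Finite ℤ[G] P] [Module.IsTorsionFree ℤ P] :
    G0.cls ℤ[G] (IntDual G (IntDual G P)) = G0.cls ℤ[G] P := by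
  have := finite_int (G := G) (M := P)
  symm
  refine cls_congr (LinearEquiv.ofBijective evalBidual ?_)
  have h := Module.bijective_dual_eval ℤ P
  constructor
  · intro x y hxy
    apply h.1
    refine LinearMap.ext fun f => ?_
    exact DFunLike.congr_fun hxy (f.toAddMonoidHom : P →+ ℤ)
  · intro Φ
    obtain ⟨p, hp⟩ := h.2 (AddMonoidHom.toIntLinearMap
      { toFun := fun f => Φ (f.toAddMonoidHom : P →+ ℤ)
        map_zero' := map_zero Φ
        map_add' := fun f g => map_add Φ (f.toAddMonoidHom : P →+ ℤ) (g.toAddMonoidHom : P →+ ℤ) })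
    refine ⟨p, GHom.ext fun f => ?_⟩
    exact LinearMap.congr_fun hp (f : P →+ ℤ).toIntLinearMap

end

theorem dualHom_dualHom (x : G0 ℤ[G]) : dualHom G (dualHom G x) = x := by
  suffices h : (dualHom G).comp (dualHom G) = AddMonoidHom.id _ from DFunLike.congr_fun h x
  refine G0_hom_ext fun M => ?_
  obtain ⟨n, q, hq⟩ := exists_free_surjection G M.carrier
  have h := dualHom_of_presentation (LinearMap.ker q).subtype q (Submodule.subtype_injective _) hq
      (LinearMap.exact_subtype_ker_map _)
  rw [AddMonoidHom.comp_apply, h, map_sub, dualHom_of_torsionFree, dualHom_of_torsionFree,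
    cls_bidual, cls_bidual, cls_eq_add (LinearMap.ker q).subtype q (Submodule.subtype_injective _) hq
      (LinearMap.exact_subtype_ker_map _), add_sub_cancel_left, AddMonoidHom.id_apply]

end Duality

end OArakelov

namespace OArakelov

noncomputable section FiniteDuality

open scoped MonoidAlgebra

variable {G : Type} [Group G]

local notation:73 g:74 "⋆" m:73 => (MonoidAlgebra.single g (1 : ℤ)) • m

section

variable {P T : Type} [AddCommGroup P] [AddCommGroup T] [Module ℤ[G] P] [Module ℤ[G] T]

/-- The character of `P` with values in `ℝ/ℤ` obtained by extending to `P` an integral form on a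
submodule containing `mP`. -/
def extendForm {K : Submodule ℤ[G] P} (m : ℕ) (hm : ∀ x : P, m • x ∈ K) (f : K →+ ℤ) :
    P →+ RmodZ where
  toFun x := (((f ⟨m • x, hm x⟩ : ℤ) : ℝ) / m : ℝ)
  map_zero' := by
    have : (⟨m • (0 : P), hm 0⟩ : K) = 0 := Subtype.ext (smul_zero m)
    rw [this, map_zero]
    simp
  map_add' x y := by
    have : (⟨m • (x + y), hm _⟩ : K) = ⟨m • x, hm x⟩ + ⟨m • y, hm y⟩ :=
      Subtype.ext (smul_add m x y)
    rw [this, map_add, ← AddCircle.coe_add, ← add_div, ← Int.cast_add]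

theorem extendForm_apply {K : Submodule ℤ[G] P} (m : ℕ) (hm : ∀ x : P, m • x ∈ K)
    (f : K →+ ℤ) (x : P) :
    extendForm m hm f x = (((f ⟨m • x, hm x⟩ : ℤ) : ℝ) / m : ℝ) := rfl

theorem extendForm_of_mem {K : Submodule ℤ[G] P} {m : ℕ} (hm0 : m ≠ 0) (hm : ∀ x : P, m • x ∈ K)
    (f : K →+ ℤ) (x : P) (hx : x ∈ K) : extendForm m hm f x = 0 := by
  have : (⟨m • x, hm x⟩ : K) = m • ⟨x, hx⟩ := rfl
  rw [extendForm_apply, this, map_nsmul, AddCircle.coe_eq_zero_iff]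
  refine ⟨f ⟨x, hx⟩, ?_⟩
  have h : (m : ℝ) ≠ 0 := by exact_mod_cast hm0
  simp [h]

variable [Finite G]

theorem dualHom_of_finite_of_surjective [Finite T] [Module.Finite ℤ[G] P]
    [Module.IsTorsionFree ℤ P] (q : P →ₗ[ℤ[G]] T) (hq : Function.Surjective q) :
    dualHom G (G0.cls ℤ[G] T) = - G0.cls ℤ[G] (GHom G T (Triv G RmodZ)) := by
  have hD := dualHom_of_presentation (LinearMap.ker q).subtype q (Submodule.subtype_injective _) hq
      (LinearMap.exact_subtype_ker_map _)
  have hPfin := finite_int (G := G) (M := P)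
  set K := LinearMap.ker q
  have hm0 : Nat.card T ≠ 0 := Nat.card_pos.ne'
  have hm : ∀ x : P, Nat.card T • x ∈ K := fun x => by
    rw [LinearMap.mem_ker, map_nsmul, card_nsmul_eq_zero']
  generalize Nat.card T = m at hm hm0
  have hmR : (m : ℝ) ≠ 0 := by exact_mod_cast hm0
  have hmZ : (m : ℤ) ≠ 0 := by exact_mod_cast hm0
  choose s hs using hq
  have key : ∀ (f : K →+ ℤ) (x y : P), q x = q y → extendForm m hm f x = extendForm m hm f y :=
    fun f x y h => by
      rw [← sub_eq_zero, ← map_sub]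
      exact extendForm_of_mem hm0 hm f _ (by simp [K, h])
  let R : IntDual G K →ₗ[ℤ[G]] GHom G T (Triv G RmodZ) := linOfEquivariant
    { toFun := fun f => (GHom.untriv G T RmodZ).symm
        { toFun := fun t => extendForm m hm (GHom.untriv G K ℤ f) (s t)
          map_zero' := extendForm_of_mem hm0 hm _ _ (by simp [K, hs])
          map_add' := fun x y => by
            rw [← map_add]
            exact key _ _ _ (by simp [hs]) }
      map_zero' := GHom.untriv_ext fun t => by
        rw [AddEquiv.apply_symm_apply, map_zero]
        simp [extendForm_apply]
      map_add' := fun f h => GHom.untriv_ext fun t => by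
        simp [extendForm_apply, add_div] }
    fun g f => GHom.untriv_ext fun t => by
      rw [GHom.untriv_act]
      change extendForm m hm (GHom.untriv G K ℤ (g ⋆ f)) (s t) =
        extendForm m hm (GHom.untriv G K ℤ f) (s (g⁻¹ ⋆ t))
      rw [key _ (s (g⁻¹ ⋆ t)) (g⁻¹ ⋆ s t) (by simp [hs]), extendForm_apply, extendForm_apply, GHom.untriv_act]
      have : g⁻¹ ⋆ (⟨m • s t, hm _⟩ : K) = ⟨m • g⁻¹ ⋆ s t, hm _⟩ :=
        Subtype.ext (smul_comm _ _ _)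
      rw [this]
  have hR : ∀ f x, GHom.untriv G T RmodZ (R f) (q x) = extendForm m hm (GHom.untriv G K ℤ f) x :=
    fun f x => key _ _ _ (hs _)
  have hex := cls_eq_add (GHom.precomp (A := Triv G ℤ) K.subtype) R ?_ ?_ ?_
  · rw [hD, hex]; abel
  · intro f h hfh
    refine GHom.untriv_ext fun x => ?_
    have h1 : GHom.untriv G P ℤ f (m • x) = GHom.untriv G P ℤ h (m • x) :=
      DFunLike.congr_fun hfh (⟨m • x, hm x⟩ : K)
    rw [map_nsmul, map_nsmul] at h1
    exact nsmul_right_injective hm0 h1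
  · intro χ
    obtain ⟨h, hh⟩ := Module.projective_lifting_property
      ((QuotientAddGroup.mk' (AddSubgroup.zmultiples (1 : ℝ))).toIntLinearMap)
      ((GHom.untriv G T RmodZ χ).comp q.toAddMonoidHom).toIntLinearMap
      (QuotientAddGroup.mk'_surjective _)
    have hh' : ∀ x, ((h x : ℝ) : RmodZ) = GHom.untriv G T RmodZ χ (q x) :=
      fun x => LinearMap.congr_fun hh x
    have hint : ∀ x : K, ∃ k : ℤ, (k : ℝ) = h x := fun x => by
      have := hh' x
      rw [show q x = 0 from x.2, map_zero] at this
      obtain ⟨k, hk⟩ := (AddCircle.coe_eq_zero_iff 1).1 this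
      exact ⟨k, by simpa using hk⟩
    choose k hk using hint
    refine ⟨(GHom.untriv G K ℤ).symm
      { toFun := k, map_zero' := ?_, map_add' := fun x y => ?_ }, ?_⟩
    · have := hk 0
      simpa using this
    · have := hk (x + y)
      rw [Submodule.coe_add, map_add, ← hk, ← hk] at this
      exact_mod_cast this
    · refine GHom.untriv_ext fun t => ?_
      rw [← hs t, hR, ← hh', extendForm_apply, AddEquiv.apply_symm_apply, AddMonoidHom.coe_mk,
        ZeroHom.coe_mk, hk]
      simp [hmR]
  · intro f
    constructor
    · intro hf
      have h1 : ∀ x : P, ∃ k : ℤ, m * k = GHom.untriv G K ℤ f ⟨m • x, hm x⟩ := fun x => by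
        have := hR f x
        rw [hf, map_zero, AddMonoidHom.zero_apply, extendForm_apply] at this
        obtain ⟨k, hk⟩ := (AddCircle.coe_eq_zero_iff 1).1 this.symm
        refine ⟨k, ?_⟩
        rw [eq_div_iff hmR] at hk
        have : ((m * k : ℤ) : ℝ) = (GHom.untriv G K ℤ f ⟨m • x, hm x⟩ : ℤ) := by
          rw [← hk]; push_cast; simp [mul_comm]
        exact_mod_cast this
      choose k hk using h1
      refine ⟨(GHom.untriv G P ℤ).symm
        { toFun := k, map_zero' := ?_, map_add' := fun x y => ?_ }, ?_⟩
      · refine mul_left_cancel₀ hmZ ?_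
        rw [hk, mul_zero]
        have : (⟨m • (0 : P), hm 0⟩ : K) = 0 := Subtype.ext (smul_zero m)
        rw [this, map_zero]
      · refine mul_left_cancel₀ hmZ ?_
        rw [mul_add, hk, hk, hk]
        have : (⟨m • (x + y), hm _⟩ : K) = ⟨m • x, hm x⟩ + ⟨m • y, hm y⟩ :=
          Subtype.ext (smul_add m x y)
        rw [this, map_add]
      · refine GHom.untriv_ext fun x => ?_
        refine mul_left_cancel₀ hmZ ?_
        rw [GHom.untriv_precomp, AddEquiv.apply_symm_apply, AddMonoidHom.coe_mk, ZeroHom.coe_mk, hk]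
        have : (⟨m • (x : P), hm x⟩ : K) = m • x := rfl
        simp [this]
    · rintro ⟨h, rfl⟩
      refine GHom.untriv_ext fun t => ?_
      rw [← hs t, hR, extendForm_apply, GHom.untriv_precomp, Submodule.subtype_apply, map_nsmul,
        map_zero, AddMonoidHom.zero_apply, AddCircle.coe_eq_zero_iff]
      exact ⟨GHom.untriv G P ℤ h (s t), by simp [hmR]⟩

theorem dualHom_of_finite [Finite T] :
    dualHom G (G0.cls ℤ[G] T) = - G0.cls ℤ[G] (GHom G T (Triv G RmodZ)) := by
  obtain ⟨n, q, hq⟩ := exists_free_surjection G T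
  exact dualHom_of_finite_of_surjective q hq

end

end FiniteDuality

end OArakelov

namespace OArakelov

noncomputable section Permutation

open scoped MonoidAlgebra

variable {G : Type} [Group G]

local notation:73 g:74 "⋆" m:73 => (MonoidAlgebra.single g (1 : ℤ)) • m

/-- Functions on a set with a group action, with values in a module over the group ring. -/
def Fn (_ : Type) (S A : Type) : Type := S → A

section

variable {S A B C : Type} [AddCommGroup A] [AddCommGroup B] [AddCommGroup C] [MulAction G S]

instance : AddCommGroup (Fn G S A) := inferInstanceAs (AddCommGroup (S → A))
instance : CoeFun (Fn G S A) (fun _ => S → A) := ⟨fun f => f⟩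
instance [Finite S] [Module.Finite ℤ A] : Module.Finite ℤ (Fn G S A) :=
  inferInstanceAs (Module.Finite ℤ (S → A))
instance [Module.IsTorsionFree ℤ A] : Module.IsTorsionFree ℤ (Fn G S A) :=
  inferInstanceAs (Module.IsTorsionFree ℤ (S → A))
instance [Finite S] [Finite A] : Finite (Fn G S A) := inferInstanceAs (Finite (S → A))

omit [Group G] [MulAction G S] [AddCommGroup A] in
@[ext] theorem Fn.ext {f h : Fn G S A} (H : ∀ s, f s = h s) : f = h := funext H
omit [Group G] [MulAction G S] in
@[simp] theorem Fn.add_apply (f h : Fn G S A) (s : S) : (f + h) s = f s + h s := rfl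
omit [Group G] [MulAction G S] in
@[simp] theorem Fn.zero_apply (s : S) : (0 : Fn G S A) s = 0 := rfl

variable [Module ℤ[G] A] [Module ℤ[G] B] [Module ℤ[G] C]

instance : Module ℤ[G] (Fn G S A) :=
  moduleOfAction (M := Fn G S A)
    { toFun g :=
        { toFun f := fun s => g ⋆ f (g⁻¹ • s)
          map_zero' := Fn.ext fun s => smul_zero _
          map_add' f h := Fn.ext fun s => smul_add _ _ _ }
      map_one' := AddMonoidHom.ext fun f => Fn.ext fun s => by
        change (1 : G) ⋆ f ((1 : G)⁻¹ • s) = f s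
        rw [inv_one, one_act, one_smul]
      map_mul' g h := AddMonoidHom.ext fun f => Fn.ext fun s => by
        change (g * h) ⋆ f ((g * h)⁻¹ • s) = g ⋆ h ⋆ f (h⁻¹ • g⁻¹ • s)
        rw [mul_inv_rev, mul_act, mul_smul] }

@[simp] theorem Fn.act_apply (g : G) (f : Fn G S A) (s : S) :
    (g ⋆ f) s = g ⋆ f (g⁻¹ • s) := by
  rw [moduleOfAction_single]; rfl

/-- Composition on the values. -/
def Fn.postcomp (S : Type) [MulAction G S] (φ : A →ₗ[ℤ[G]] B) : Fn G S A →ₗ[ℤ[G]] Fn G S B :=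
  linOfEquivariant
    { toFun f := fun s => φ (f s)
      map_zero' := Fn.ext fun s => map_zero φ
      map_add' f h := Fn.ext fun s => map_add φ _ _ } fun g f => Fn.ext fun s => by
        rw [Fn.act_apply]
        change φ ((g ⋆ f) s) = _
        rw [Fn.act_apply, φ.map_smul]
        rfl

@[simp] theorem Fn.postcomp_apply (φ : A →ₗ[ℤ[G]] B) (f : Fn G S A) (s : S) :
    Fn.postcomp S φ f s = φ (f s) := rfl

/-- The function supported at one point. -/
def Fn.delta (G : Type) {S A : Type} [AddCommGroup A] (s : S) (a : A) : Fn G S A :=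
  letI := Classical.decEq S
  Pi.single s a

omit [Group G] [MulAction G S] [Module ℤ[G] A] in
theorem Fn.delta_same (s : S) (a : A) : Fn.delta G s a s = a := by
  classical
  simp [Fn.delta]

omit [Group G] [MulAction G S] [Module ℤ[G] A] in
theorem Fn.delta_of_ne {s t : S} (h : t ≠ s) (a : A) : Fn.delta G s a t = 0 := by
  classical
  simp [Fn.delta, h]

theorem Fn.act_delta (g : G) (s : S) (a : A) :
    g ⋆ Fn.delta G s a = Fn.delta G (g • s) (g ⋆ a) := by
  ext t
  rw [Fn.act_apply]
  by_cases h : t = g • s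
  · subst h
    rw [inv_smul_smul, Fn.delta_same, Fn.delta_same]
  · rw [Fn.delta_of_ne h, Fn.delta_of_ne, smul_zero]
    rintro rfl
    simp at h

omit [Group G] [MulAction G S] in
theorem Fn.sum_delta [Fintype S] (f : Fn G S A) : ∑ s, Fn.delta G s (f s) = f := by
  classical
  exact Finset.univ_sum_single (f : S → A)

/-- Homomorphisms from a permutation module. -/
def Fn.homEquiv (S A : Type) [AddCommGroup A] [MulAction G S] [Module ℤ[G] A] [Finite S] :
    GHom G (Fn G S (Triv G ℤ)) A ≃ₗ[ℤ[G]] Fn G S A :=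
  letI := Fintype.ofFinite S
  equivOfEquivariant
    { toFun f := fun s => f (Fn.delta G s (1 : ℤ))
      invFun a := show GHom G (Fn G S (Triv G ℤ)) A from
        { toFun := fun n => ∑ s, (show ℤ from n s) • a s
          map_zero' := Finset.sum_eq_zero fun s _ => zero_smul ℤ _
          map_add' := fun x y => by
            rw [← Finset.sum_add_distrib]
            exact Finset.sum_congr rfl fun s _ => add_smul (show ℤ from x s) (show ℤ from y s) _ }
      left_inv f := GHom.ext fun n => by
        change ∑ s, (show ℤ from n s) • f (Fn.delta G s (1 : ℤ)) = f n
        conv_rhs => rw [← Fn.sum_delta n, map_sum]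
        refine Finset.sum_congr rfl fun s _ => ?_
        rw [← map_zsmul]
        congr 1
        classical
        refine (Pi.single_smul (f := fun _ : S => ℤ) s (show ℤ from n s) (1 : ℤ)).symm.trans ?_
        rw [smul_eq_mul, mul_one]
        simp only [Fn.delta]
        congr!
      right_inv a := Fn.ext fun s => by
        change ∑ t, (show ℤ from Fn.delta G s (1 : ℤ) t) • a t = a s
        rw [Finset.sum_eq_single s]
        · rw [Fn.delta_same]; exact one_smul _ _
        · intro t _ h
          rw [Fn.delta_of_ne h]
          exact zero_smul _ _
        · simp
      map_add' f h := rfl } fun g f => Fn.ext fun s => by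
        rw [Fn.act_apply]
        change (g ⋆ f) (Fn.delta G s (1 : ℤ)) = g ⋆ f (Fn.delta G (g⁻¹ • s) (1 : ℤ))
        rw [GHom.act_apply]
        congr 2
        exact (Fn.act_delta (A := Triv G ℤ) g⁻¹ s (1 : ℤ)).trans (congrArg _ (triv_act ℤ _ _))

instance [Finite S] [Module.Finite ℤ A] : Module.Finite ℤ[G] (Fn G S A) := finite_groupRing

theorem dualHom_perm [Finite G] [Finite S] :
    dualHom G (G0.cls ℤ[G] (Fn G S (Triv G ℤ))) = G0.cls ℤ[G] (Fn G S (Triv G ℤ)) := by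
  rw [dualHom_of_torsionFree, cls_congr (Fn.homEquiv S (Triv G ℤ))]

theorem cls_perm_of_free [Finite G] [Finite S] (hfree : ∀ (g : G) (s : S), g • s = s → g = 1)
    (d : ℕ) (hd : Nat.card S = d * Nat.card G) :
    G0.cls ℤ[G] (Fn G S (Triv G ℤ)) = d • G0.cls ℤ[G] ℤ[G] := by
  let Ω := MulAction.orbitRel.Quotient G S
  have : Fintype Ω := Fintype.ofFinite _
  have : Fintype G := Fintype.ofFinite _
  let r : Ω → S := Quotient.out
  have hr : ∀ ω : Ω, Quotient.mk'' (r ω) = ω := fun ω => Quotient.out_eq' ω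
  let e : Ω × G → S := fun x => x.2 • r x.1
  have he : Function.Bijective e := by
    constructor
    · rintro ⟨ω, g⟩ ⟨ω', g'⟩ h
      change g • r ω = g' • r ω' at h
      have : ω = ω' := by
        rw [← hr ω, ← hr ω']
        refine Quotient.sound' ?_
        refine ⟨g⁻¹ * g', ?_⟩
        change (g⁻¹ * g') • r ω' = r ω
        rw [mul_smul, ← h, inv_smul_smul]
      subst this
      have := hfree (g'⁻¹ * g) (r ω) (by rw [mul_smul, h, inv_smul_smul])
      rw [inv_mul_eq_one] at this
      rw [this]
    · intro s
      obtain ⟨g, hg⟩ : (s : S) ∈ MulAction.orbit G (r (Quotient.mk'' s)) := by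
        have := Quotient.exact' (hr (Quotient.mk'' s))
        exact Setoid.symm' _ this
      exact ⟨(_, g), hg⟩
  have hΩ : Fintype.card Ω = d := by
    have := Nat.card_congr (Equiv.ofBijective e he)
    rw [Nat.card_prod, hd, Nat.card_eq_fintype_card] at this
    exact Nat.eq_of_mul_eq_mul_right Nat.card_pos this
  rw [← hΩ, ← cls_fun]
  refine cls_congr (LinearEquiv.ofBijective (linOfEquivariant
    { toFun f := fun ω => MonoidAlgebra.ofCoeff (Finsupp.equivFunOnFinite.symm fun g => f (e (ω, g)))
      map_zero' := by
        ext; simp; rfl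
      map_add' f h := by
        ext; simp; rfl } fun g f => ?_) ⟨?_, ?_⟩)
  · ext ω h
    change (show ℤ from (g ⋆ f) (h • r ω)) =
      (g ⋆ (MonoidAlgebra.ofCoeff (Finsupp.equivFunOnFinite.symm fun g => f (e (ω, g))) : ℤ[G])).coeff h
    rw [Fn.act_apply, smul_eq_mul, MonoidAlgebra.coeff_single_mul_apply, triv_act]
    simp only [e, one_mul]
    exact congrArg f (mul_smul g⁻¹ h (r ω)).symm
  · intro f h hfh
    ext s
    obtain ⟨⟨ω, g⟩, rfl⟩ := he.2 s
    exact DFunLike.congr_fun (congrArg MonoidAlgebra.coeff (congrFun hfh ω)) g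
  · intro x
    choose e' he' using he.2
    have he'' : ∀ y, e' (e y) = y := fun y => he.1 (he' _)
    refine ⟨fun s => (x (e' s).1).coeff (e' s).2, ?_⟩
    ext ω g
    change (x (e' (e (ω, g))).1).coeff (e' (e (ω, g))).2 = _
    rw [he'']

end

end Permutation

end OArakelov

namespace OArakelov

noncomputable section CommutativeOrders

/-- A module annihilated by a maximal ideal is isotypic. -/
theorem cls_of_torsionBySet {R : Type} [CommRing R] [IsNoetherianRing R] (m : Ideal R) [m.IsMaximal]
    (M : Type) [AddCommGroup M] [Module R M] [Module.Finite R M]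
    (hM : Module.IsTorsionBySet R M m) :
    ∃ r : ℕ, G0.cls R M = r • G0.cls R (R ⧸ m) ∧ (Nontrivial M → 0 < r) := by
  let := Ideal.Quotient.field m
  let : Module (R ⧸ m) M := hM.module
  have : IsScalarTower R (R ⧸ m) M := hM.isScalarTower
  have : Module.Finite (R ⧸ m) M := Module.Finite.of_restrictScalars_finite R _ _
  refine ⟨Module.finrank (R ⧸ m) M, ?_, fun _ => Module.finrank_pos⟩
  rw [cls_congr ((Module.finBasis (R ⧸ m) M).equivFun.restrictScalars R), cls_fin_fun]

/-- Restriction of scalars along a finite ring homomorphism. -/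
def resHom {R S : Type} [Ring R] [IsNoetherianRing R] [Ring S] (f : R →+* S)
    (hf : letI := Module.compHom S f; Module.Finite R S) : G0 S →+ G0 R :=
  G0lift (fun M => letI := Module.compHom M.carrier f; G0.cls R M.carrier)
    fun L M N i q hi hq hiq => by
      let := Module.compHom L.carrier f
      let := Module.compHom M.carrier f
      let := Module.compHom N.carrier f
      let := Module.compHom S f
      have : IsScalarTower R S M.carrier := ⟨fun r s m => mul_smul (f r) s m⟩
      have : Module.Finite R M.carrier := Module.Finite.trans S M.carrier
      exact cls_eq_add (R := R)
        { toFun := i, map_add' := map_add i, map_smul' := fun r => i.map_smul (f r) }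
        { toFun := q, map_add' := map_add q, map_smul' := fun r => q.map_smul (f r) } hi hq hiq

theorem resHom_cls {R S : Type} [Ring R] [IsNoetherianRing R] [Ring S] (f : R →+* S) (hf)
    (M : Type) [AddCommGroup M] [Module S M] [Module.Finite S M] :
    resHom f hf (G0.cls S M) = letI := Module.compHom M f; G0.cls R M :=
  G0lift_cls _ _ (FGMod.mk M)

/-- The residue fields of a ring of integers have torsion class. -/
theorem torsion_cls_residue (K : Type) [Field K] [NumberField K] (p : Ideal (𝓞 K)) [p.IsMaximal]
    (hp : p ≠ ⊥) : ∃ n : ℕ, 0 < n ∧ n • G0.cls (𝓞 K) (𝓞 K ⧸ p) = 0 := by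
  have step : ∀ n : ℕ, ∃ r : ℕ, G0.cls (𝓞 K) (𝓞 K) =
      G0.cls (𝓞 K) (p ^ n : Ideal (𝓞 K)) + r • G0.cls (𝓞 K) (𝓞 K ⧸ p) ∧ (n ≠ 0 → 0 < r) := by
    intro n
    induction n with
    | zero =>
      refine ⟨0, ?_, by simp⟩
      rw [pow_zero, Ideal.one_eq_top, zero_smul, add_zero]
      exact (cls_congr Submodule.topEquiv).symm
    | succ n ih =>
      obtain ⟨r, hr, hr'⟩ := ih
      let N : Submodule (𝓞 K) (p ^ n : Ideal (𝓞 K)) :=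
        Submodule.comap (Submodule.subtype _) (p ^ (n + 1) : Ideal (𝓞 K))
      have hN : G0.cls (𝓞 K) N = G0.cls (𝓞 K) (p ^ (n + 1) : Ideal (𝓞 K)) :=
        cls_congr (Submodule.comapSubtypeEquivOfLe (Ideal.pow_le_pow_right n.le_succ))
      obtain ⟨s, hs, hs'⟩ := cls_of_torsionBySet p ((p ^ n : Ideal (𝓞 K)) ⧸ N) (by
        rintro x ⟨a, ha⟩
        obtain ⟨x, rfl⟩ := N.mkQ_surjective x
        change a • N.mkQ x = 0
        rw [← map_smul, Submodule.mkQ_apply, Submodule.Quotient.mk_eq_zero]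
        change a * (x : 𝓞 K) ∈ p ^ (n + 1)
        rw [pow_succ']
        exact Ideal.mul_mem_mul ha x.2)
      refine ⟨r + s, ?_, fun _ => ?_⟩
      · rw [hr, cls_eq_submodule_add_quotient N, hN, hs, add_smul]
        abel
      · rcases Nat.eq_zero_or_pos n with rfl | hn
        · refine Nat.add_pos_right _ (hs' ?_)
          rw [Submodule.Quotient.nontrivial_iff]
          intro h
          have h1 : (⟨1, by simp⟩ : (p ^ 0 : Ideal (𝓞 K))) ∈ N := h ▸ Submodule.mem_top
          have h2 : (1 : 𝓞 K) ∈ p ^ (0 + 1) := h1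
          rw [zero_add, pow_one] at h2
          exact Ideal.IsMaximal.ne_top ‹_› ((Ideal.eq_top_iff_one p).2 h2)
        · exact Nat.add_pos_left (hr' hn.ne') _
  have hfin : Finite (ClassGroup (𝓞 K)) := inferInstance
  let c : ClassGroup (𝓞 K) := ClassGroup.mk0 ⟨p, mem_nonZeroDivisors_of_ne_zero hp⟩
  obtain ⟨h, h0, hc⟩ := isOfFinOrder_iff_pow_eq_one.1 (isOfFinOrder_of_finite c)
  obtain ⟨r, hr, hr'⟩ := step h
  refine ⟨r, hr' h0.ne', ?_⟩
  rw [← map_pow, ClassGroup.mk0_eq_one_iff] at hc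
  obtain ⟨a, ha⟩ := hc.principal
  have ha' : p ^ h = Ideal.span {a} := ha
  have ha0 : a ≠ 0 := by
    rintro rfl
    rw [Ideal.span_singleton_eq_bot.2 rfl] at ha'
    exact hp (pow_eq_zero_iff h0.ne' |>.1 ha')
  have : G0.cls (𝓞 K) (p ^ h : Ideal (𝓞 K)) = G0.cls (𝓞 K) (𝓞 K) := by
    rw [ha']
    exact (cls_congr (LinearEquiv.toSpanNonzeroSingleton (𝓞 K) (𝓞 K) a ha0)).symm
  rw [this] at hr
  simpa using hr

theorem numberField_of_isFractionRing (D K : Type) [CommRing D] [IsDomain D] [CharZero D]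
    [Module.Finite ℤ D] [Field K] [Algebra D K] [IsFractionRing D K] : NumberField K := by
  have inj := IsFractionRing.injective D K
  have hK : CharZero K := charZero_of_injective_algebraMap inj
  refine { to_charZero := hK, to_finiteDimensional := ?_ }
  classical
  obtain ⟨n, s, hs⟩ := Module.Finite.exists_fin (R := ℤ) (M := D)
  refine ⟨⟨Finset.univ.image fun i => algebraMap D K (s i), ?_⟩⟩
  rw [Finset.coe_image, Finset.coe_univ, Set.image_univ, eq_top_iff]
  rintro x -
  have key : ∀ a : D, algebraMap D K a ∈ Submodule.span ℚ (Set.range fun i => algebraMap D K (s i)) := by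
    intro a
    have ha : a ∈ Submodule.span ℤ (Set.range s) := hs ▸ Submodule.mem_top
    induction ha using Submodule.span_induction with
    | mem x hx =>
      obtain ⟨i, rfl⟩ := hx
      exact Submodule.subset_span ⟨i, rfl⟩
    | zero => simp
    | add x y _ _ hx hy => rw [map_add]; exact add_mem hx hy
    | smul z x _ hx => rw [map_zsmul]; exact zsmul_mem hx z
  obtain ⟨a, b, hb, rfl⟩ := IsFractionRing.div_surjective (A := D) x
  obtain ⟨r, hr, c, hc⟩ := (IsIntegral.of_finite ℤ b).isAlgebraic.exists_nonzero_dvd hb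
  have : algebraMap D K a / algebraMap D K b = (r : ℚ)⁻¹ • algebraMap D K (a * c) := by
    have h1 : ((r : ℤ) : K) = algebraMap D K b * algebraMap D K c := by
      rw [← map_mul, ← hc]; simp
    have hr' : (r : K) ≠ 0 := by exact_mod_cast hr
    have hb' : algebraMap D K b ≠ 0 := by
      rw [h1] at hr'
      exact left_ne_zero_of_mul hr'
    rw [Rat.smul_def, map_mul]
    push_cast
    field_simp
    rw [h1, mul_assoc]
  rw [this]
  exact Submodule.smul_mem _ _ (key _)

theorem torsion_cls_quotient_of_numberField (K : Type) [Field K] [NumberField K] {R : Type} [CommRing R]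
    [Module.Finite ℤ R] (ψ : R →+* K) (m : Ideal R) [m.IsMaximal] (hm : RingHom.ker ψ ≤ m)
    [Finite (R ⧸ m)] : ∃ n : ℕ, 0 < n ∧ n • G0.cls R (R ⧸ m) = 0 := by
  have : IsNoetherianRing R := isNoetherian_of_tower ℤ inferInstance
  have hint : ∀ x : R, IsIntegral ℤ (ψ x) := fun x => map_isIntegral_int ψ (IsIntegral.of_finite ℤ x)
  let φ : R →+* 𝓞 K :=
    { toFun := fun x => ⟨ψ x, hint x⟩
      map_one' := RingOfIntegers.ext (map_one ψ)
      map_mul' := fun x y => RingOfIntegers.ext (map_mul ψ x y)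
      map_zero' := RingOfIntegers.ext (map_zero ψ)
      map_add' := fun x y => RingOfIntegers.ext (map_add ψ x y) }
  have hφ : RingHom.ker φ = RingHom.ker ψ := by
    ext x
    rw [RingHom.mem_ker, RingHom.mem_ker]
    exact RingOfIntegers.ext_iff
  let := φ.toAlgebra
  have hfin : Module.Finite R (𝓞 K) := Module.Finite.of_restrictScalars_finite ℤ R (𝓞 K)
  obtain ⟨p, -, hp, hpm⟩ := Ideal.exists_ideal_over_prime_of_isIntegral m (⊥ : Ideal (𝓞 K)) (by
    refine le_trans (le_of_eq ?_) hm
    exact hφ)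
  have hp0 : p ≠ ⊥ := by
    rintro rfl
    have hmk : m = RingHom.ker φ := hpm.symm
    have hinj : Function.Injective (Nat.cast : ℕ → R ⧸ m) := by
      intro a b hab
      have h1 : ((a : R) - (b : R)) ∈ m := by
        rw [← Ideal.Quotient.eq]; simpa using hab
      rw [hmk, RingHom.mem_ker, map_sub, map_natCast, map_natCast, sub_eq_zero] at h1
      exact_mod_cast h1
    exact not_injective_infinite_finite _ hinj
  have : p.IsMaximal := hp.isMaximal hp0
  obtain ⟨n, hn, hn'⟩ := torsion_cls_residue K p hp0
  obtain ⟨r, hr, hr'⟩ := cls_of_torsionBySet m (𝓞 K ⧸ p) (by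
    rintro x ⟨a, ha⟩
    obtain ⟨x, rfl⟩ := Ideal.Quotient.mk_surjective x
    change Ideal.Quotient.mk p (φ a * x) = 0
    rw [Ideal.Quotient.eq_zero_iff_mem]
    have ha' : a ∈ Ideal.comap (algebraMap R (𝓞 K)) p := hpm ▸ ha
    exact p.mul_mem_right _ ha')
  have hr0 : 0 < r := hr' (Ideal.Quotient.nontrivial_iff.2 hp.ne_top)
  refine ⟨n * r, Nat.mul_pos hn hr0, ?_⟩
  have h := congrArg (resHom φ hfin) hn'
  rw [map_nsmul, resHom_cls, map_zero] at h
  rw [mul_nsmul', ← hr]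
  exact h

/-- Finite modules over a commutative order have torsion class. -/
theorem torsion_cls_of_commRing (R : Type) [CommRing R] [Module.Finite ℤ R]
    [Module.IsTorsionFree ℤ R] (T : Type) [AddCommGroup T] [Module R T] [Finite T] :
    ∃ n : ℕ, 0 < n ∧ n • G0.cls R T = 0 := by
  have : IsNoetherianRing R := isNoetherian_of_tower ℤ inferInstance
  refine torsion_cls_of_simple (fun S _ _ _ _ => ?_) T
  obtain ⟨m, hm, ⟨e⟩⟩ := isSimpleModule_iff_quot_maximal.1 ‹IsSimpleModule R S›
  have : Finite (R ⧸ m) := Finite.of_equiv S e.toEquiv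
  obtain ⟨q, hq, hqm⟩ := Ideal.exists_minimalPrimes_le (I := (⊥ : Ideal R)) (J := m) bot_le
  have hqp : q.IsPrime := hq.1.1
  have hchar : CharZero (R ⧸ q) := by
    refine charZero_of_inj_zero fun n hn => ?_
    by_contra hn0
    rw [← map_natCast (Ideal.Quotient.mk q), Ideal.Quotient.eq_zero_iff_mem] at hn
    refine notMem_nonZeroDivisors_of_mem_mem_minimalPrimes hn hq ?_
    rw [mem_nonZeroDivisors_iff_right]
    intro x hx
    rw [mul_comm, ← nsmul_eq_mul, ← natCast_zsmul] at hx
    exact (smul_eq_zero_iff_right (by exact_mod_cast hn0)).1 hx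
  have : NumberField (FractionRing (R ⧸ q)) := numberField_of_isFractionRing (R ⧸ q) _
  rw [cls_congr e]
  refine torsion_cls_quotient_of_numberField (FractionRing (R ⧸ q))
    ((algebraMap (R ⧸ q) _).comp (Ideal.Quotient.mk q)) m ?_
  intro x hx
  rw [RingHom.mem_ker, RingHom.comp_apply,
    map_eq_zero_iff _ (IsFractionRing.injective (R ⧸ q) (FractionRing (R ⧸ q))),
    Ideal.Quotient.eq_zero_iff_mem] at hx
  exact hqm hx

end CommutativeOrders

end OArakelov

namespace OArakelov

noncomputable section LatticeTraces

open scoped MonoidAlgebra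

local notation:73 g:74 "⋆" m:73 => (MonoidAlgebra.single g (1 : ℤ)) • m

variable {G : Type} [Group G]

/-- The trace of a group element on a module which is free of finite rank over the integers. -/
def latTrace (M : Type) [AddCommGroup M] [Module ℤ[G] M] (g : G) : ℤ :=
  LinearMap.trace ℤ M (actHom M g).toIntLinearMap

variable {K M N : Type} [AddCommGroup K] [AddCommGroup M] [AddCommGroup N] [Module ℤ[G] K]
  [Module ℤ[G] M] [Module ℤ[G] N]

theorem latTrace_eq_sum {ι : Type} [Fintype ι] (b : Module.Basis ι ℤ M) (g : G) :
    latTrace M g = ∑ i, b.coord i (g ⋆ b i) := by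
  classical
  rw [latTrace, LinearMap.trace_eq_matrix_trace ℤ b]
  simp [Matrix.trace, LinearMap.toMatrix_apply]

theorem latTrace_one [Module.Free ℤ M] [Module.Finite ℤ M] :
    latTrace M (1 : G) = Module.finrank ℤ M := by
  rw [latTrace, ← LinearMap.trace_one ℤ M]
  congr 1
  ext m
  exact one_act m

theorem latTrace_of_exact [Module.Free ℤ K] [Module.Finite ℤ K] [Module.Free ℤ M]
    [Module.Finite ℤ M] [Module.Free ℤ N] [Module.Finite ℤ N] (i : K →ₗ[ℤ[G]] M)
    (q : M →ₗ[ℤ[G]] N) (hi : Function.Injective i) (hq : Function.Surjective q)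
    (hiq : Function.Exact i q) (g : G) : latTrace M g = latTrace K g + latTrace N g := by
  obtain ⟨s, hs⟩ := Module.projective_lifting_property (q.restrictScalars ℤ)
    (LinearMap.id : N →ₗ[ℤ] N) hq
  have hs' : ∀ n, q (s n) = n := fun n => LinearMap.congr_fun hs n
  have hr : ∀ m : M, ∃ l : K, i l = m - s (q m) := fun m =>
    (hiq _).1 (by rw [map_sub, hs', sub_self])
  choose r hr using hr
  let r' : M →ₗ[ℤ] K := AddMonoidHom.toIntLinearMap
    { toFun := r
      map_zero' := hi (by simp [hr])
      map_add' := fun x y => hi (by simp only [hr, map_add]; abel) }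
  let f : M →ₗ[ℤ] M := (actHom M g).toIntLinearMap
  have h1 : f = (f ∘ₗ i.restrictScalars ℤ) ∘ₗ r' + (f ∘ₗ s) ∘ₗ q.restrictScalars ℤ := by
    ext m
    change f m = f (i (r m)) + f (s (q m))
    rw [← map_add, hr, sub_add_cancel]
  have h2 : r' ∘ₗ f ∘ₗ i.restrictScalars ℤ = (actHom K g).toIntLinearMap := by
    ext k
    apply hi
    change i (r (g ⋆ i k)) = i (g ⋆ k)
    rw [hr, ← map_smul, hiq.apply_apply_eq_zero, map_zero, sub_zero]
  have h3 : q.restrictScalars ℤ ∘ₗ f ∘ₗ s = (actHom N g).toIntLinearMap := by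
    ext n
    change q (g ⋆ s n) = g ⋆ n
    rw [map_smul, hs']
  change LinearMap.trace ℤ M f = _
  rw [h1, map_add, LinearMap.trace_comp_comm' r', LinearMap.trace_comp_comm' (q.restrictScalars ℤ),
    h2, h3]
  rfl

variable [Finite G] [Module.Free ℤ M] [Module.Finite ℤ M] [Module.Free ℤ N] [Module.Finite ℤ N]

theorem latTrace_inv (g : G) : latTrace M g⁻¹ = latTrace M g := by
  classical
  have := Fintype.ofFinite G
  let b := Module.Free.chooseBasis ℤ M
  let A : G → Matrix _ _ ℝ := fun g =>
    (LinearMap.toMatrix b b (actHom M g).toIntLinearMap).map (Int.castRingHom ℝ)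
  have hmul : ∀ g h, A (g * h) = A g * A h := fun g h => by
    simp only [A]
    rw [← Matrix.map_mul, ← LinearMap.toMatrix_comp]
    congr 2
    ext m
    exact mul_act g h m
  have hone : A 1 = 1 := by
    have : (actHom M (1 : G)).toIntLinearMap = LinearMap.id := by
      ext m
      exact one_act m
    simp only [A]
    rw [this, LinearMap.toMatrix_id, Matrix.map_one _ (map_zero _) (map_one _)]
  have htr : ∀ g, (A g).trace = latTrace M g := fun g => by
    simp only [A]
    rw [latTrace, LinearMap.trace_eq_matrix_trace ℤ b]
    simp [Matrix.trace]
  let S := ∑ h, (A h).conjTranspose * A h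
  have hS : IsUnit S := by
    refine Matrix.PosDef.isUnit ?_
    simp only [S]
    rw [← Finset.add_sum_erase _ _ (Finset.mem_univ (1 : G))]
    refine Matrix.PosDef.add_posSemidef ?_
      (Matrix.posSemidef_sum _ fun h _ => Matrix.posSemidef_conjTranspose_mul_self _)
    rw [hone]
    simpa using Matrix.PosDef.one
  have hSg : (A g).conjTranspose * S * A g = S := by
    simp only [S]
    rw [Finset.mul_sum, Finset.sum_mul]
    refine Fintype.sum_equiv (Equiv.mulRight g) _ _ fun h => ?_
    rw [Equiv.coe_mulRight, hmul, Matrix.conjTranspose_mul]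
    simp only [mul_assoc]
  have hinv : (A g⁻¹).conjTranspose * (A g).conjTranspose = 1 := by
    rw [← Matrix.conjTranspose_mul, ← hmul, mul_inv_cancel, hone, Matrix.conjTranspose_one]
  have h1 : S * A g = (A g⁻¹).conjTranspose * S := by
    calc S * A g = (A g⁻¹).conjTranspose * (A g).conjTranspose * (S * A g) := by rw [hinv, one_mul]
      _ = (A g⁻¹).conjTranspose * ((A g).conjTranspose * S * A g) := by simp only [mul_assoc]
      _ = _ := by rw [hSg]
  obtain ⟨u, hu⟩ := hS
  have h2 : (A g).trace = (A g⁻¹).trace := by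
    have : A g = (↑u⁻¹ : Matrix _ _ ℝ) * ((A g⁻¹).conjTranspose * S) := by
      rw [← h1, ← hu, ← mul_assoc, Units.inv_mul, one_mul]
    rw [this, Matrix.trace_mul_comm, ← hu, mul_assoc, Units.mul_inv, mul_one,
      Matrix.trace_conjTranspose, star_trivial]
  rw [htr, htr] at h2
  exact_mod_cast h2.symm

/-- Two nonzero lattices with the same traces have a nonzero equivariant map. -/
theorem exists_ne_zero_of_latTrace_eq [Nontrivial M] (h : ∀ g : G, latTrace M g = latTrace N g) :
    ∃ f : M →ₗ[ℤ[G]] N, f ≠ 0 := by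
  classical
  have := Fintype.ofFinite G
  by_contra! H
  let b := Module.Free.chooseBasis ℤ M
  let c := Module.Free.chooseBasis ℤ N
  have key : ∀ i j, ∑ g : G, b.coord i (g⁻¹ ⋆ b i) * c.coord j (g ⋆ c j) = 0 := by
    intro i j
    let φ : M →+ N := ((b.coord i).smulRight (c j)).toAddMonoidHom
    let f : M →ₗ[ℤ[G]] N := linOfEquivariant
      (∑ g : G, ((actHom N g).comp φ).comp (actHom M g⁻¹)) (by
        intro h m
        simp only [AddMonoidHom.finsetSum_apply, AddMonoidHom.comp_apply, actHom_apply,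
          Finset.smul_sum]
        refine Fintype.sum_equiv (Equiv.mulLeft h⁻¹) _ _ fun g => ?_
        rw [Equiv.coe_mulLeft, ← mul_act h, mul_inv_cancel_left, ← mul_act, mul_inv_rev, inv_inv])
    have h0 : f (b i) = 0 := by rw [H f]; rfl
    have h1 := congrArg (c.coord j) h0
    have h2 : f (b i) = ∑ g : G, (b.coord i (g⁻¹ ⋆ b i)) • (g ⋆ c j) := by
      change (∑ g : G, ((actHom N g).comp φ).comp (actHom M g⁻¹)) (b i) = _
      rw [AddMonoidHom.finsetSum_apply]
      refine Finset.sum_congr rfl fun g _ => ?_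
      exact act_zsmul g _ _
    rw [h2, map_sum, map_zero] at h1
    simpa only [map_zsmul, smul_eq_mul] using h1
  have hsum : ∑ g : G, latTrace M g ^ 2 = 0 := by
    calc ∑ g : G, latTrace M g ^ 2 = ∑ g : G, latTrace M g⁻¹ * latTrace N g := by
          refine Finset.sum_congr rfl fun g _ => ?_
          rw [latTrace_inv, ← h, sq]
      _ = ∑ g : G, ∑ i, ∑ j, b.coord i (g⁻¹ ⋆ b i) * c.coord j (g ⋆ c j) := by
          refine Finset.sum_congr rfl fun g _ => ?_
          rw [latTrace_eq_sum b, latTrace_eq_sum c, Finset.sum_mul_sum]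
      _ = 0 := by
          rw [Finset.sum_comm]
          refine Finset.sum_eq_zero fun i _ => ?_
          rw [Finset.sum_comm]
          exact Finset.sum_eq_zero fun j _ => key i j
  have h1 := (Finset.sum_eq_zero_iff_of_nonneg fun g _ => sq_nonneg (latTrace M g)).1 hsum 1
    (Finset.mem_univ _)
  rw [latTrace_one] at h1
  have h2 : Module.finrank ℤ M ≠ 0 := Module.finrank_pos.ne'
  exact h2 (by exact_mod_cast pow_eq_zero_iff two_ne_zero |>.1 h1)

end LatticeTraces

end OArakelov

namespace OArakelov

noncomputable section LatticeInvariance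

open scoped MonoidAlgebra

local notation:73 g:74 "⋆" m:73 => (MonoidAlgebra.single g (1 : ℤ)) • m

theorem exists_comp_eq_of_ker_le (p : ℕ) [Fact p.Prime] {A B T : Type} [AddCommGroup A]
    [AddCommGroup B] [AddCommGroup T] [Module (ZMod p) B] [Module (ZMod p) T] (f : A →+ T)
    (ψ : A →+ B) (h : ∀ a, ψ a = 0 → f a = 0) : ∃ k : B →+ T, k.comp ψ = f := by
  let W : Submodule (ZMod p) B := AddSubgroup.toZModSubmodule p ψ.range
  have hW : ∀ w : W, ∃ a, ψ a = w := fun w => w.2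
  choose s hs using hW
  have hs' : ∀ a a', ψ a = ψ a' → f a = f a' := fun a a' haa => by
    rw [← sub_eq_zero, ← map_sub]
    exact h _ (by rw [map_sub, haa, sub_self])
  let f' : W →+ T :=
    { toFun := fun w => f (s w)
      map_zero' := h _ (hs 0)
      map_add' := fun x y => by
        rw [← map_add]
        exact hs' _ _ (by rw [map_add, hs, hs, hs]; rfl) }
  obtain ⟨k, hk⟩ := LinearMap.exists_extend (f'.toZModLinearMap p)
  refine ⟨k.toAddMonoidHom, ?_⟩
  ext a
  have := LinearMap.congr_fun hk ⟨ψ a, ⟨a, rfl⟩⟩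
  exact this.trans (hs' _ _ (hs _))

/-- Additive maps into an elementary abelian group factor through any map with small enough
kernel modulo the prime. -/
theorem exists_comp_eq_of_prime (p : ℕ) [Fact p.Prime] {A B T : Type} [AddCommGroup A]
    [AddCommGroup B] [AddCommGroup T] (hT : ∀ t : T, p • t = 0) (f : A →+ T) (ψ : A →+ B)
    (h : ∀ a b, ψ a = p • b → f a = 0) : ∃ k : B →+ T, k.comp ψ = f := by
  let pB : AddSubgroup B := (nsmulAddMonoidHom (α := B) p).range
  let _ : Module (ZMod p) T := AddCommGroup.zmodModule hT
  let _ : Module (ZMod p) (B ⧸ pB) := AddCommGroup.zmodModule fun x => by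
    obtain ⟨b, rfl⟩ := QuotientAddGroup.mk_surjective x
    rw [← QuotientAddGroup.mk_nsmul, QuotientAddGroup.eq_zero_iff]
    exact ⟨b, rfl⟩
  obtain ⟨k, hk⟩ := exists_comp_eq_of_ker_le p f ((QuotientAddGroup.mk' pB).comp ψ) fun a ha => by
    obtain ⟨b, hb⟩ := (QuotientAddGroup.eq_zero_iff _).1 ha
    exact h a b hb.symm
  exact ⟨k.comp (QuotientAddGroup.mk' pB), hk⟩

variable {G : Type} [Group G] [Finite G]

variable (p : ℕ) [Fact p.Prime] (T : Type) [AddCommGroup T] [Module ℤ[G] T] [Finite T]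
  (hT : ∀ t : T, p • t = 0)

include hT in
theorem cls_gHom_submodule_of_prime (ℓ : ℕ) [Fact ℓ.Prime] {M : Type} [AddCommGroup M]
    [Module ℤ[G] M] [Module.Finite ℤ[G] M] [Module.IsTorsionFree ℤ M] (N : Submodule ℤ[G] M)
    (hN : ∀ m : M, ℓ • m ∈ N) : G0.cls ℤ[G] (GHom G M T) = G0.cls ℤ[G] (GHom G N T) := by
  have := finite_int (G := G) (M := M)
  have := finite_int (G := G) (M := N)
  have hinj : ∀ m : M, ℓ • m = 0 → m = 0 := fun m hm =>
    (smul_eq_zero_iff_right (R := ℤ) (by exact_mod_cast (Fact.out : ℓ.Prime).ne_zero)).1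
      ((natCast_zsmul m ℓ).trans hm)
  let ψ : M →ₗ[ℤ[G]] N := LinearMap.codRestrict N (ℓ • LinearMap.id) hN
  have hψ : ∀ m, (ψ m : M) = ℓ • m := fun m => rfl
  let α : GHom G M T →ₗ[ℤ[G]] GHom G N T := GHom.precomp N.subtype
  let β : GHom G N T →ₗ[ℤ[G]] GHom G M T := GHom.precomp ψ
  have hαβ : ∀ f, α (β f) = ℓ • f := fun f => by
    ext n
    change f (ψ n) = ((ℓ • f : GHom G N T) : N → T) n
    have : ψ n = ℓ • n := Subtype.ext rfl
    rw [this, map_nsmul]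
    rfl
  have hβα : ∀ f, β (α f) = ℓ • f := fun f => by
    ext m
    change f (ψ m : M) = ((ℓ • f : GHom G M T) : M → T) m
    rw [hψ, map_nsmul]
    rfl
  have : Module.Finite ℤ[G] (GHom G M T) := GHom.finite
  have : Module.Finite ℤ[G] (GHom G N T) := GHom.finite
  by_cases hℓ : ℓ = p
  · subst hℓ
    have h1 : LinearMap.range β = LinearMap.ker α := by
      ext f
      rw [LinearMap.mem_range, LinearMap.mem_ker]
      constructor
      · rintro ⟨h, rfl⟩
        rw [hαβ]
        ext n
        exact hT _
      · intro hf
        obtain ⟨k, hk⟩ := exists_comp_eq_of_prime ℓ hT (f : M →+ T) ψ.toAddMonoidHom (by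
          intro m b hb
          have : m = b := by
            rw [← sub_eq_zero]
            refine hinj _ ?_
            rw [nsmul_sub, sub_eq_zero]
            exact congrArg Subtype.val hb
          rw [this]
          exact DFunLike.congr_fun hf b)
        exact ⟨k, GHom.ext fun m => DFunLike.congr_fun hk m⟩
    have h2 : LinearMap.range α = LinearMap.ker β := by
      ext f
      rw [LinearMap.mem_range, LinearMap.mem_ker]
      constructor
      · rintro ⟨h, rfl⟩
        rw [hβα]
        ext n
        exact hT _
      · intro hf
        obtain ⟨k, hk⟩ := exists_comp_eq_of_prime ℓ hT (f : N →+ T) N.subtype.toAddMonoidHom (by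
          intro n b hb
          have : n = ψ b := Subtype.ext hb
          rw [this]
          exact DFunLike.congr_fun hf b)
        exact ⟨k, GHom.ext fun m => DFunLike.congr_fun hk m⟩
    rw [cls_eq_ker_add_range α, cls_eq_ker_add_range β, ← h1, ← h2, add_comm]
  · have hcop : Nat.Coprime ℓ p := (Nat.coprime_primes Fact.out Fact.out).2 hℓ
    obtain ⟨a, b, hab⟩ := Nat.isCoprime_iff_coprime.2 hcop
    have hT' : ∀ t : T, a • ℓ • t = t := fun t => by
      have : (a * ℓ + b * p) • t = t := by rw [hab, one_smul]
      rwa [add_smul, mul_smul, mul_smul, natCast_zsmul, natCast_zsmul, hT, smul_zero, add_zero] at this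
    refine cls_congr (LinearEquiv.ofBijective α ⟨?_, ?_⟩)
    · rw [← LinearMap.ker_eq_bot, LinearMap.ker_eq_bot']
      intro f hf
      ext m
      have h1 := hβα f
      rw [hf, map_zero] at h1
      have h2 : ℓ • f m = 0 := (DFunLike.congr_fun h1 m).symm
      rw [← hT' (f m), h2, smul_zero]
      rfl
    · intro f
      refine ⟨a • β f, ?_⟩
      rw [map_zsmul, hαβ]
      ext n
      exact hT' _

include hT in
theorem cls_gHom_submodule (n : ℕ) (hn : n ≠ 0) : ∀ {M : Type} [AddCommGroup M]
    [Module ℤ[G] M] [Module.Finite ℤ[G] M] [Module.IsTorsionFree ℤ M] (N : Submodule ℤ[G] M)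
    (_ : ∀ m : M, n • m ∈ N), G0.cls ℤ[G] (GHom G M T) = G0.cls ℤ[G] (GHom G N T) := by
  induction n using Nat.recOnMul with
  | zero => exact absurd rfl hn
  | one =>
    intro M _ _ _ _ N hN
    have : N = ⊤ := eq_top_iff.2 fun m _ => by simpa using hN m
    subst this
    exact cls_congr (LinearEquiv.ofBijective (GHom.precomp (⊤ : Submodule ℤ[G] M).subtype)
      ⟨fun f h e => GHom.ext fun m => DFunLike.congr_fun e ⟨m, trivial⟩, fun f =>
        ⟨(f : _ →+ T).comp Submodule.topEquiv.symm.toLinearMap.toAddMonoidHom, rfl⟩⟩)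
  | prime ℓ hℓ =>
    intro M _ _ _ _ N hN
    have : Fact ℓ.Prime := ⟨hℓ⟩
    exact cls_gHom_submodule_of_prime p T hT ℓ N hN
  | mul a b ha hb =>
    intro M _ _ _ _ N hN
    rw [mul_ne_zero_iff] at hn
    let N' : Submodule ℤ[G] M := N ⊔ LinearMap.range (a • LinearMap.id : M →ₗ[ℤ[G]] M)
    rw [ha hn.1 N' fun m => Submodule.mem_sup_right ⟨m, rfl⟩,
      hb hn.2 (N.comap N'.subtype) (by
        rintro ⟨m, hm⟩
        obtain ⟨x, hx, _, ⟨y, rfl⟩, rfl⟩ := Submodule.mem_sup.1 hm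
        change b • (x + a • y) ∈ N
        rw [nsmul_add, ← mul_nsmul]
        exact N.add_mem (N.nsmul_mem hx b) (hN y))]
    have e : N.comap N'.subtype ≃ₗ[ℤ[G]] N := Submodule.comapSubtypeEquivOfLe le_sup_left
    exact cls_congr (LinearEquiv.ofBijective (GHom.precomp e.symm.toLinearMap)
      ⟨fun f h he => GHom.ext fun m => by simpa using DFunLike.congr_fun he (e m), fun f =>
        ⟨(f : N →+ T).comp e.toAddEquiv.toAddMonoidHom, GHom.ext fun m =>
          congrArg (fun x => (f : N →+ T) x) (e.apply_symm_apply m)⟩⟩)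

end LatticeInvariance

end OArakelov

namespace OArakelov

noncomputable section LatticeClasses

open scoped MonoidAlgebra

local notation:73 g:74 "⋆" m:73 => (MonoidAlgebra.single g (1 : ℤ)) • m

variable {G : Type} [Group G]

theorem latTrace_submodule {M : Type} [AddCommGroup M] [Module ℤ[G] M] [Module.Free ℤ M]
    [Module.Finite ℤ M] (N : Submodule ℤ[G] M) [Module.Free ℤ N] [Module.Finite ℤ N] (n : ℕ)
    (hn : n ≠ 0) (h : ∀ m : M, n • m ∈ N) (g : G) : latTrace M g = latTrace N g := by
  let ι : N →ₗ[ℤ] M := N.subtype.restrictScalars ℤ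
  let ψ : M →ₗ[ℤ] N := (LinearMap.codRestrict N (n • LinearMap.id) h).restrictScalars ℤ
  let f : M →ₗ[ℤ] M := (actHom M g).toIntLinearMap
  let f' : N →ₗ[ℤ] N := (actHom N g).toIntLinearMap
  have h1 : (f ∘ₗ ι) ∘ₗ ψ = n • f := by
    ext m
    exact map_nsmul (actHom M g) n m
  have h2 : ψ ∘ₗ (f ∘ₗ ι) = n • f' := by
    ext m
    rfl
  have h3 := LinearMap.trace_comp_comm' ψ (f ∘ₗ ι)
  rw [h1, h2, map_nsmul, map_nsmul] at h3
  have h4 : LinearMap.trace ℤ M f = LinearMap.trace ℤ N f' := by simpa [hn] using h3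
  exact h4

theorem latTrace_congr {M N : Type} [AddCommGroup M] [Module ℤ[G] M] [AddCommGroup N]
    [Module ℤ[G] N] (e : M ≃ₗ[ℤ[G]] N) (g : G) : latTrace M g = latTrace N g := by
  let e' : M ≃ₗ[ℤ] N := e.toAddEquiv.toIntLinearEquiv
  rw [latTrace, ← LinearMap.trace_conj' _ e', latTrace]
  congr 1
  ext n
  change e (g ⋆ e.symm n) = g ⋆ n
  rw [map_smul, e.apply_symm_apply]

theorem cls_gHom_congr {M N : Type} [AddCommGroup M] [Module ℤ[G] M] [AddCommGroup N]
    [Module ℤ[G] N] (T : Type) [AddCommGroup T] [Module ℤ[G] T] (e : M ≃ₗ[ℤ[G]] N) :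
    G0.cls ℤ[G] (GHom G M T) = G0.cls ℤ[G] (GHom G N T) :=
  cls_congr <| LinearEquiv.ofLinearMap (GHom.precomp e.symm.toLinearMap)
    (GHom.precomp e.toLinearMap) (by ext f n; simp) (by ext f n; simp)

variable [Finite G]

section

variable {M : Type} [AddCommGroup M] [Module ℤ[G] M]

/-- The saturation of a submodule. -/
def saturation (N : Submodule ℤ[G] M) : Submodule ℤ[G] M :=
  submoduleOfStable
    { carrier := {m | ∃ k : ℕ, k ≠ 0 ∧ k • m ∈ N}
      zero_mem' := ⟨1, one_ne_zero, by simp⟩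
      add_mem' := by
        rintro x y ⟨k, hk, hx⟩ ⟨l, hl, hy⟩
        refine ⟨k * l, mul_ne_zero hk hl, ?_⟩
        rw [nsmul_add, mul_nsmul, mul_nsmul']
        exact N.add_mem (N.nsmul_mem hx l) (N.nsmul_mem hy k)
      neg_mem' := by
        rintro x ⟨k, hk, hx⟩
        exact ⟨k, hk, by rw [smul_neg]; exact N.neg_mem hx⟩ }
    fun g m ⟨k, hk, hm⟩ => ⟨k, hk, by rw [smul_comm]; exact N.smul_mem _ hm⟩

omit [Finite G] in
theorem le_saturation (N : Submodule ℤ[G] M) : N ≤ saturation N :=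
  fun m hm => ⟨1, one_ne_zero, by simpa using hm⟩

omit [Finite G] in
theorem torsionFree_quotient_saturation (N : Submodule ℤ[G] M) :
    Module.IsTorsionFree ℤ (M ⧸ saturation N) := by
  rw [Module.isTorsionFree_iff_smul_eq_zero]
  intro c x hx
  by_contra! H
  obtain ⟨m, rfl⟩ := (saturation N).mkQ_surjective x
  rw [← map_zsmul, Submodule.mkQ_apply, Submodule.Quotient.mk_eq_zero] at hx
  obtain ⟨k, hk, hm⟩ := hx
  apply H.2
  rw [Submodule.mkQ_apply, Submodule.Quotient.mk_eq_zero]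
  refine ⟨k * c.natAbs, mul_ne_zero hk (Int.natAbs_ne_zero.2 H.1), ?_⟩
  rw [mul_comm, mul_nsmul, ← natCast_zsmul m, ← natCast_zsmul]
  rw [← natCast_zsmul] at hm
  rcases Int.natAbs_eq c with hc | hc
  · rwa [← hc]
  · rw [hc, neg_smul, smul_neg, Submodule.neg_mem_iff] at hm
    exact hm

theorem exists_nsmul_saturation_mem [Module.Finite ℤ[G] M] (N : Submodule ℤ[G] M) :
    ∃ n : ℕ, n ≠ 0 ∧ ∀ m ∈ saturation N, n • m ∈ N := by
  have := finite_int (G := G) (M := saturation N)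
  obtain ⟨k, s, hs⟩ := Module.Finite.exists_fin (R := ℤ) (M := saturation N)
  choose e he hm using fun i => (s i).2
  refine ⟨∏ i, e i, Finset.prod_ne_zero_iff.2 fun i _ => he i, fun m hmem => ?_⟩
  have h1 : (⟨m, hmem⟩ : saturation N) ∈ Submodule.span ℤ (Set.range s) := hs ▸ Submodule.mem_top
  suffices H : ∀ x : saturation N, x ∈ Submodule.span ℤ (Set.range s) →
    (∏ i, e i) • (x : M) ∈ N from H _ h1
  intro x hx
  induction hx using Submodule.span_induction with
  | mem x hx =>
    obtain ⟨i, rfl⟩ := hx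
    rw [← Finset.mul_prod_erase _ _ (Finset.mem_univ i), mul_nsmul]
    exact N.nsmul_mem (hm i) _
  | zero => simp
  | add x y _ _ hx hy => rw [Submodule.coe_add, nsmul_add]; exact N.add_mem hx hy
  | smul c x _ hx =>
    have : ((c • x : saturation N) : M) = c • (x : M) := map_zsmul (saturation N).subtype c x
    rw [this, smul_comm]
    exact zsmul_mem hx c

end

variable (p : ℕ) [Fact p.Prime] (T : Type) [AddCommGroup T] [Module ℤ[G] T] [Finite T]
  (hT : ∀ t : T, p • t = 0)

include hT in
theorem cls_gHom_of_latTrace_eq (r : ℕ) : ∀ {M N : Type} [AddCommGroup M] [AddCommGroup N]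
    [Module ℤ[G] M] [Module ℤ[G] N] [Module.Finite ℤ M] [Module.Finite ℤ N] [Module.IsTorsionFree ℤ M]
    [Module.IsTorsionFree ℤ N] (_ : ∀ g : G, latTrace M g = latTrace N g)
    (_ : Module.finrank ℤ M = r), G0.cls ℤ[G] (GHom G M T) = G0.cls ℤ[G] (GHom G N T) := by
  induction r using Nat.strong_induction_on with
  | _ r ih =>
  intro M N _ _ _ _ _ _ _ _ h hr
  have : Module.Finite ℤ[G] M := finite_groupRing
  have : Module.Finite ℤ[G] N := finite_groupRing
  rcases subsingleton_or_nontrivial M with hM | hM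
  · have hN : Module.finrank ℤ N = 0 := by
      have h1 := h 1
      rw [latTrace_one, latTrace_one, Module.finrank_zero_of_subsingleton] at h1
      exact_mod_cast h1.symm
    have : Subsingleton N := (Module.finrank_eq_zero_iff_of_free ℤ N).1 hN
    have h1 : Subsingleton (GHom G M T) := ⟨fun f g => GHom.ext fun m => by
      rw [Subsingleton.elim m 0, map_zero, map_zero]⟩
    have h2 : Subsingleton (GHom G N T) := ⟨fun f g => GHom.ext fun m => by
      rw [Subsingleton.elim m 0, map_zero, map_zero]⟩
    rw [cls_of_subsingleton, cls_of_subsingleton]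
  · obtain ⟨f, hf⟩ := exists_ne_zero_of_latTrace_eq h
    let I := LinearMap.range f
    let K := LinearMap.ker f
    let I' := saturation I
    let J := I.comap I'.subtype
    let e : J ≃ₗ[ℤ[G]] I := Submodule.comapSubtypeEquivOfLe (le_saturation I)
    have := torsionFree_quotient_saturation I
    have := finite_int (G := G) (M := I)
    have := finite_int (G := G) (M := K)
    have := finite_int (G := G) (M := I')
    have := finite_int (G := G) (M := J)
    have := finite_int (G := G) (M := N ⧸ I')
    obtain ⟨n, hn0, hn⟩ := exists_nsmul_saturation_mem I
    have hI : G0.cls ℤ[G] (GHom G I' T) = G0.cls ℤ[G] (GHom G J T) :=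
      cls_gHom_submodule p T hT n hn0 J fun m => hn _ m.2
    have exK : Function.Exact K.subtype f.rangeRestrict := fun m => by
      rw [← Subtype.coe_inj]
      simp [K]
    have exI : Function.Exact I'.subtype I'.mkQ := LinearMap.exact_subtype_mkQ I'
    have tM := fun g => latTrace_of_exact K.subtype f.rangeRestrict K.subtype_injective
      f.surjective_rangeRestrict exK g
    have tN := fun g => latTrace_of_exact I'.subtype I'.mkQ I'.subtype_injective
      I'.mkQ_surjective exI g
    have hJI : ∀ g : G, latTrace J g = latTrace I g := fun g => latTrace_congr (M := J) (N := I) e g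
    have hJI' : G0.cls ℤ[G] (GHom G J T) = G0.cls ℤ[G] (GHom G I T) :=
      cls_gHom_congr (M := J) (N := I) T e
    have hKN : ∀ g : G, latTrace K g = latTrace (N ⧸ I') g := fun g => by
      have h1 := h g
      rw [tM g, tN g, latTrace_submodule J n hn0 (fun m => hn _ m.2) g, hJI g] at h1
      linarith
    have hlt : Module.finrank ℤ K < r := by
      have h1 : (Module.finrank ℤ M : ℤ) = Module.finrank ℤ K + Module.finrank ℤ I := by
        rw [← latTrace_one (G := G), ← latTrace_one (G := G), ← latTrace_one (G := G)]
        exact tM 1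
      have : Nontrivial I := by
        rw [Submodule.nontrivial_iff_ne_bot]
        exact fun h0 => hf (LinearMap.range_eq_bot.1 h0)
      have : 0 < Module.finrank ℤ I := Module.finrank_pos
      omega
    rw [cls_gHom_of_exact T K.subtype f.rangeRestrict K.subtype_injective
      f.surjective_rangeRestrict exK, cls_gHom_of_exact T I'.subtype I'.mkQ I'.subtype_injective
      I'.mkQ_surjective exI, hI, hJI', ih _ hlt hKN rfl, add_comm]

omit [Finite G] in
theorem latTrace_perm (S : Type) [MulAction G S] [Finite S] (g : G) :
    latTrace (Fn G S (Triv G ℤ)) g = Nat.card {s : S // g • s = s} := by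
  classical
  have := Fintype.ofFinite S
  let b : Module.Basis S ℤ (Fn G S (Triv G ℤ)) := Pi.basisFun ℤ S
  let u : Triv G ℤ := (1 : ℤ)
  have hb : ∀ s, b s = Fn.delta G s u := fun s => by
    ext t
    by_cases h : t = s
    · subst h
      rw [Fn.delta_same]
      exact (congrFun (Pi.basisFun_apply ℤ S t) t).trans (Pi.single_eq_same _ _)
    · rw [Fn.delta_of_ne h]
      exact (congrFun (Pi.basisFun_apply ℤ S s) t).trans (Pi.single_eq_of_ne h _)
  rw [latTrace_eq_sum b, Nat.card_eq_fintype_card, Fintype.card_subtype, Finset.card_eq_sum_ones,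
    Nat.cast_sum, Finset.sum_filter]
  refine Finset.sum_congr rfl fun s _ => ?_
  have h1 : b.coord s (g ⋆ b s) = (g ⋆ b s) s := rfl
  rw [h1, hb, Fn.act_delta]
  split_ifs with h
  · rw [h, Fn.delta_same, triv_act]; rfl
  · rw [Fn.delta_of_ne (Ne.symm h)]; rfl

include hT in
/-- Finite `G`-sets with the same permutation character have the same permutation modules with
coefficients in a module killed by a prime, up to extensions. -/
theorem cls_fn_of_card_fixed_eq {X Y : Type} [MulAction G X] [MulAction G Y] [Finite X] [Finite Y]
    (h : ∀ g : G, Nat.card {x : X // g • x = x} = Nat.card {y : Y // g • y = y}) :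
    G0.cls ℤ[G] (Fn G X T) = G0.cls ℤ[G] (Fn G Y T) := by
  rw [← cls_congr (Fn.homEquiv (G := G) X T), ← cls_congr (Fn.homEquiv (G := G) Y T)]
  exact cls_gHom_of_latTrace_eq p T hT _ (fun g => by rw [latTrace_perm, latTrace_perm, h g]) rfl

end LatticeClasses

end OArakelov

namespace OArakelov

noncomputable section Coinduction

open scoped MonoidAlgebra

local notation:73 g:74 "⋆" m:73 => (MonoidAlgebra.single g (1 : ℤ)) • m

variable {B G : Type} [Group B] [Group G] (ι : B →* G)

/-- Restriction along a homomorphism of groups. -/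
def Res (_ : B →* G) (T : Type) : Type := T

section

variable (T : Type) [AddCommGroup T] [Module ℤ[G] T]

instance : AddCommGroup (Res ι T) := inferInstanceAs (AddCommGroup T)
instance [Finite T] : Finite (Res ι T) := inferInstanceAs (Finite T)

/-- The identity, from a module to its restriction. -/
def Res.of : T ≃+ Res ι T := AddEquiv.refl T

instance : Module ℤ[B] (Res ι T) :=
  moduleOfAction (M := Res ι T)
    { toFun b := actHom T (ι b)
      map_one' := AddMonoidHom.ext fun t => by
        change ι 1 ⋆ (Res.of ι T).symm t = (Res.of ι T).symm t
        rw [map_one, one_act]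
      map_mul' b c := AddMonoidHom.ext fun t => by
        change ι (b * c) ⋆ (Res.of ι T).symm t = ι b ⋆ ι c ⋆ (Res.of ι T).symm t
        rw [map_mul, mul_act] }

theorem Res.act_of (b : B) (t : T) : b ⋆ Res.of ι T t = Res.of ι T (ι b ⋆ t) := by
  rw [moduleOfAction_single]; rfl

end

/-- The coinduced module. -/
def Coind (N : Type) [AddCommGroup N] [Module ℤ[B] N] : Type :=
  ({ carrier := {f | ∀ b x, f (ι b * x) = b ⋆ f x}
     zero_mem' := fun b x => (smul_zero _).symm
     add_mem' := fun {f h} hf hh b x => by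
       rw [Pi.add_apply, Pi.add_apply, smul_add, hf, hh]
     neg_mem' := fun {f} hf b x => by
       rw [Pi.neg_apply, Pi.neg_apply, smul_neg, hf] } : AddSubgroup (G → N))

section

variable {L M N : Type} [AddCommGroup L] [AddCommGroup M] [AddCommGroup N] [Module ℤ[B] L]
  [Module ℤ[B] M] [Module ℤ[B] N]

instance : AddCommGroup (Coind ι N) := by unfold Coind; infer_instance
instance : FunLike (Coind ι N) G N where
  coe f := f.1
  coe_injective := Subtype.coe_injective

variable {ι}

@[ext] theorem Coind.ext {f h : Coind ι N} (H : ∀ x, f x = h x) : f = h := DFunLike.ext _ _ H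
@[simp] theorem Coind.add_apply (f h : Coind ι N) (x : G) : (f + h) x = f x + h x := rfl
@[simp] theorem Coind.zero_apply (x : G) : (0 : Coind ι N) x = 0 := rfl
theorem Coind.apply_mul (f : Coind ι N) (b : B) (x : G) : f (ι b * x) = b ⋆ f x := f.2 b x

/-- Constructor for elements of a coinduced module. -/
def Coind.of (f : G → N) (h : ∀ b x, f (ι b * x) = b ⋆ f x) : Coind ι N := ⟨f, h⟩

@[simp] theorem Coind.of_apply (f : G → N) (h : ∀ b x, f (ι b * x) = b ⋆ f x) (x : G) :
    Coind.of f h x = f x := rfl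

instance : Module ℤ[G] (Coind ι N) :=
  moduleOfAction (M := Coind ι N)
    { toFun g :=
        { toFun f := Coind.of (fun x => f (x * g)) fun b x => by
            rw [mul_assoc, Coind.apply_mul]
          map_zero' := rfl
          map_add' f h := rfl }
      map_one' := AddMonoidHom.ext fun f => Coind.ext fun x => congrArg f (mul_one x)
      map_mul' g h := AddMonoidHom.ext fun f => Coind.ext fun x =>
        congrArg f (mul_assoc x g h).symm }

@[simp] theorem Coind.act_apply (g : G) (f : Coind ι N) (x : G) : (g ⋆ f) x = f (x * g) := by
  rw [moduleOfAction_single]; rfl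

instance [Finite B] [Finite G] [Module.Finite ℤ[B] N] : Module.Finite ℤ[G] (Coind ι N) := by
  have := finite_int (G := B) (M := N)
  let f : Coind ι N →+ (G → N) :=
    { toFun f := f
      map_zero' := rfl
      map_add' _ _ := rfl }
  have : Module.Finite ℤ (Coind ι N) :=
    Module.Finite.of_injective f.toIntLinearMap DFunLike.coe_injective
  exact finite_groupRing

/-- Functoriality of coinduction. -/
def Coind.map (ι : B →* G) (φ : M →ₗ[ℤ[B]] N) : Coind ι M →ₗ[ℤ[G]] Coind ι N :=
  linOfEquivariant
    { toFun f := Coind.of (fun x => φ (f x)) fun b x => by rw [Coind.apply_mul, map_smul]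
      map_zero' := Coind.ext fun x => map_zero φ
      map_add' f h := Coind.ext fun x => map_add φ _ _ } fun g f => Coind.ext fun x => by
        rw [Coind.act_apply]
        exact congrArg φ (Coind.act_apply g f x)

@[simp] theorem Coind.map_apply (φ : M →ₗ[ℤ[B]] N) (f : Coind ι M) (x : G) :
    Coind.map ι φ f x = φ (f x) := rfl

theorem Coind.map_surjective (hι : Function.Injective ι) (φ : M →ₗ[ℤ[B]] N)
    (hφ : Function.Surjective φ) : Function.Surjective (Coind.map ι φ) := by
  let r : G → G := fun x => (Quotient.mk (QuotientGroup.rightRel ι.range) x).out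
  have hr : ∀ x, ∃ b, ι b * r x = x := fun x => by
    have h : QuotientGroup.rightRel ι.range (r x) x := Quotient.mk_out x
    obtain ⟨b, hb⟩ := QuotientGroup.rightRel_apply.1 h
    exact ⟨b, by rw [hb, inv_mul_cancel_right]⟩
  choose β hβ using hr
  have hr' : ∀ b x, r (ι b * x) = r x := fun b x => by
    refine congrArg Quotient.out (Quotient.sound ?_)
    refine QuotientGroup.rightRel_apply.2 ⟨b⁻¹, ?_⟩
    rw [mul_inv_rev, map_inv, mul_inv_cancel_left]
  have hβ' : ∀ b x, β (ι b * x) = b * β x := fun b x => by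
    apply hι
    apply mul_right_cancel (b := r x)
    rw [← hr' b x, hβ, hr', map_mul, mul_assoc, hβ]
  intro f
  choose s hs using hφ
  refine ⟨Coind.of (fun x => β x ⋆ s (f (r x))) fun b x => ?_, Coind.ext fun x => ?_⟩
  · rw [hr', hβ', mul_act]
  · rw [Coind.map_apply, Coind.of_apply, map_smul, hs, ← Coind.apply_mul, hβ]

theorem Coind.map_exact (φ : L →ₗ[ℤ[B]] M) (ψ : M →ₗ[ℤ[B]] N) (hφ : Function.Injective φ)
    (h : Function.Exact φ ψ) : Function.Exact (Coind.map ι φ) (Coind.map ι ψ) := by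
  intro f
  constructor
  · intro hf
    have h1 : ∀ x, ∃ l, φ l = f x := fun x =>
      (h _).1 (DFunLike.congr_fun hf x)
    choose l hl using h1
    exact ⟨Coind.of l fun b x => hφ (by rw [map_smul, hl, hl, Coind.apply_mul]),
      Coind.ext fun x => hl x⟩
  · rintro ⟨l, rfl⟩
    exact Coind.ext fun x => h.apply_apply_eq_zero _

end

/-- The homomorphism between Grothendieck groups induced by coinduction. -/
def coindHom [Finite B] [Finite G] (hι : Function.Injective ι) : G0 ℤ[B] →+ G0 ℤ[G] :=
  G0lift (fun M => G0.cls ℤ[G] (Coind ι M.carrier)) fun _ _ _ f g hf hg hfg =>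
    cls_of_exact (Coind.map ι f) (Coind.map ι g)
      (fun _ _ h => Coind.ext fun x => hf (DFunLike.congr_fun h x))
      (Coind.map_surjective hι g hg) (Coind.map_exact f g hf hfg)

theorem coindHom_cls [Finite B] [Finite G] (hι : Function.Injective ι) (N : Type) [AddCommGroup N]
    [Module ℤ[B] N] [Module.Finite ℤ[B] N] :
    coindHom ι hι (G0.cls ℤ[B] N) = G0.cls ℤ[G] (Coind ι N) :=
  G0lift_cls _ _ (FGMod.mk N)

/-- The projection formula. -/
def coindRes (T : Type) [AddCommGroup T] [Module ℤ[G] T] :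
    Fn G (G ⧸ ι.range) T ≃ₗ[ℤ[G]] Coind ι (Res ι T) :=
  equivOfEquivariant
    { toFun F := Coind.of (fun x => Res.of ι T (x ⋆ F ((x⁻¹ : G) : G ⧸ ι.range))) fun b x => by
        have h : ((x⁻¹ * ι b⁻¹ : G) : G ⧸ ι.range) = (x⁻¹ : G) :=
          QuotientGroup.mk_mul_of_mem _ ⟨b⁻¹, rfl⟩
        rw [Res.act_of, ← mul_act, mul_inv_rev, ← map_inv, h]
      invFun f := fun s => Quotient.liftOn' s (fun x => x ⋆ (Res.of ι T).symm (f x⁻¹)) (by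
        intro x y h
        obtain ⟨b, hb⟩ := QuotientGroup.leftRel_apply.1 h
        have hy : y = x * ι b := by rw [hb, mul_inv_cancel_left]
        have h1 : f y⁻¹ = b⁻¹ ⋆ f x⁻¹ := by
          rw [← Coind.apply_mul, hy, mul_inv_rev, map_inv]
        have h2 := Res.act_of ι T b⁻¹ ((Res.of ι T).symm (f x⁻¹))
        rw [AddEquiv.apply_symm_apply] at h2
        change x ⋆ (Res.of ι T).symm (f x⁻¹) = y ⋆ (Res.of ι T).symm (f y⁻¹)
        rw [h1, h2, AddEquiv.symm_apply_apply, ← mul_act, hy, map_inv ι, mul_inv_cancel_right])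
      left_inv F := Fn.ext fun s => by
        induction s using QuotientGroup.induction_on with
        | H x =>
          change x ⋆ x⁻¹ ⋆ F ((x⁻¹⁻¹ : G) : G ⧸ ι.range) = _
          rw [act_inv_act, inv_inv]
      right_inv f := Coind.ext fun x => by
        change Res.of ι T (x ⋆ x⁻¹ ⋆ (Res.of ι T).symm (f x⁻¹⁻¹)) = f x
        rw [act_inv_act, inv_inv, AddEquiv.apply_symm_apply]
      map_add' F H := Coind.ext fun x => by
        change Res.of ι T (x ⋆ (F + H) _) = _
        rw [Fn.add_apply, smul_add, map_add]
        rfl } fun g F => Coind.ext fun x => by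
        rw [Coind.act_apply]
        change Res.of ι T (x ⋆ (g ⋆ F) _) = Res.of ι T ((x * g) ⋆ F _)
        rw [Fn.act_apply, mul_act, mul_inv_rev]
        rfl

theorem torsion_cls_fn_of_commGroup {B : Type} [CommGroup B] [Finite B] [Finite G] (ι : B →* G)
    (hι : Function.Injective ι) (T : Type) [AddCommGroup T] [Module ℤ[G] T] [Finite T] :
    ∃ n : ℕ, 0 < n ∧ n • G0.cls ℤ[G] (Fn G (G ⧸ ι.range) T) = 0 := by
  have : Module.IsTorsionFree ℤ ℤ[B] := inferInstance
  obtain ⟨n, hn, h⟩ := torsion_cls_of_commRing ℤ[B] (Res ι T)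
  refine ⟨n, hn, ?_⟩
  rw [cls_congr (coindRes ι T), ← coindHom_cls ι hι, ← map_nsmul]
  exact (congrArg _ h).trans (map_zero _)

end Coinduction

end OArakelov

namespace OArakelov

noncomputable section ArtinInduction

open scoped MonoidAlgebra

local notation:73 g:74 "⋆" m:73 => (MonoidAlgebra.single g (1 : ℤ)) • m

variable {G : Type} [Group G]

theorem cls_fn_sum [Finite G] (X Y T : Type) [MulAction G X] [MulAction G Y] [Finite X] [Finite Y]
    [AddCommGroup T] [Module ℤ[G] T] [Finite T] :
    G0.cls ℤ[G] (Fn G (X ⊕ Y) T) = G0.cls ℤ[G] (Fn G X T) + G0.cls ℤ[G] (Fn G Y T) := by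
  rw [← cls_prod]
  refine cls_congr (equivOfEquivariant
    { toFun f := ((fun x => f (Sum.inl x) : Fn G X T), (fun y => f (Sum.inr y) : Fn G Y T))
      invFun f := fun s => Sum.elim (fun x => f.1 x) (fun y => f.2 y) s
      left_inv f := Fn.ext fun s => by cases s <;> rfl
      right_inv f := rfl
      map_add' f h := rfl } fun g f => Prod.ext (Fn.ext fun x => ?_) (Fn.ext fun y => ?_))
  · refine (Fn.act_apply g f _).trans ?_
    rw [Prod.smul_fst, Fn.act_apply]
    rfl
  · refine (Fn.act_apply g f _).trans ?_
    rw [Prod.smul_snd, Fn.act_apply]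
    rfl

theorem cls_fn_of_isEmpty [Finite G] (X T : Type) [MulAction G X] [IsEmpty X]
    [AddCommGroup T] [Module ℤ[G] T] : G0.cls ℤ[G] (Fn G X T) = 0 := by
  have : Subsingleton (Fn G X T) := ⟨fun f h => Fn.ext fun x => isEmptyElim x⟩
  exact cls_of_subsingleton

/-- The number of fixed points. -/
def fixCard (G X : Type) [Group G] [MulAction G X] (g : G) : ℤ := Nat.card {x : X // g • x = x}

theorem fixCard_sum (X Y : Type) [MulAction G X] [MulAction G Y] [Finite X] [Finite Y] (g : G) :
    fixCard G (X ⊕ Y) g = fixCard G X g + fixCard G Y g := by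
  rw [fixCard, Nat.card_congr (Equiv.subtypeSum), Nat.card_sum, fixCard, fixCard, Nat.cast_add]
  simp

/-- The pairs consisting of the difference of the characters of two permutation modules and the
corresponding class with coefficients in `T`. -/
def permRel [Finite G] (T : Type) [AddCommGroup T] [Module ℤ[G] T] [Finite T] :
    AddSubgroup ((G → ℤ) × G0 ℤ[G]) where
  carrier := {u | ∃ (X Y : Type) (_ : MulAction G X) (_ : MulAction G Y) (_ : Finite X)
    (_ : Finite Y), (u.1 = fixCard G X - fixCard G Y) ∧
      u.2 = G0.cls ℤ[G] (Fn G X T) - G0.cls ℤ[G] (Fn G Y T)}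
  zero_mem' := ⟨G, G, inferInstance, inferInstance, inferInstance, inferInstance,
    by rw [sub_self]; rfl, by rw [sub_self]; rfl⟩
  add_mem' := by
    rintro ⟨u, y⟩ ⟨v, z⟩ ⟨X, Y, _, _, _, _, h1, h2⟩ ⟨X', Y', _, _, _, _, h3, h4⟩
    refine ⟨X ⊕ X', Y ⊕ Y', inferInstance, inferInstance, inferInstance, inferInstance, ?_, ?_⟩
    · funext g
      change u g + v g = fixCard G _ g - fixCard G _ g
      rw [fixCard_sum, fixCard_sum, show u = _ from h1, show v = _ from h3, Pi.sub_apply,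
        Pi.sub_apply]
      abel
    · change y + z = _
      rw [cls_fn_sum, cls_fn_sum, show y = _ from h2, show z = _ from h4]
      abel
  neg_mem' := by
    rintro ⟨u, y⟩ ⟨X, Y, _, _, _, _, h1, h2⟩
    refine ⟨Y, X, inferInstance, inferInstance, inferInstance, inferInstance, ?_, ?_⟩
    · change -u = _
      rw [show u = _ from h1, neg_sub]
    · change -y = _
      rw [show y = _ from h2, neg_sub]

variable [Finite G] (p : ℕ) [Fact p.Prime] (T : Type) [AddCommGroup T] [Module ℤ[G] T] [Finite T]
  (hT : ∀ t : T, p • t = 0)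

include hT in
theorem eq_zero_of_mem_permRel {y : G0 ℤ[G]} (h : ((0 : G → ℤ), y) ∈ permRel T) : y = 0 := by
  obtain ⟨X, Y, _, _, _, _, h1, h2⟩ := h
  have h3 : fixCard G X = fixCard G Y := (sub_eq_zero.1 h1.symm)
  rw [show y = _ from h2, sub_eq_zero]
  exact cls_fn_of_card_fixed_eq p T hT fun g =>
    Nat.cast_injective (R := ℤ) (congrFun h3 g)

/-- The characters whose class with coefficients in `T` is torsion. -/
def torsionChar : AddSubgroup (G → ℤ) :=
  (permRel T ⊓ (AddCommGroup.torsion (G0 ℤ[G])).comap (AddMonoidHom.snd _ _)).map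
    (AddMonoidHom.fst _ _)

theorem fixCard_mem_torsionChar (c : G) :
    fixCard G (G ⧸ Subgroup.zpowers c) ∈ torsionChar T := by
  let _ : CommGroup (Subgroup.zpowers c) :=
    { (inferInstance : Group (Subgroup.zpowers c)) with mul_comm := mul_comm' }
  obtain ⟨n, hn, h⟩ := torsion_cls_fn_of_commGroup (B := Subgroup.zpowers c)
    (Subgroup.zpowers c).subtype Subtype.val_injective T
  rw [Subgroup.range_subtype] at h
  let _ : MulAction G Empty :=
    { smul _ x := x
      one_smul x := x.elim
      mul_smul _ _ x := x.elim }
  refine ⟨(fixCard G (G ⧸ Subgroup.zpowers c), G0.cls ℤ[G] (Fn G (G ⧸ Subgroup.zpowers c) T)),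
    ⟨⟨G ⧸ Subgroup.zpowers c, Empty, inferInstance, inferInstance, inferInstance, inferInstance, ?_, ?_⟩, ?_⟩, rfl⟩
  · funext g
    simp [fixCard]
  · rw [cls_fn_of_isEmpty Empty, sub_zero]
  · exact isOfFinAddOrder_iff_nsmul_eq_zero.2 ⟨n, hn, h⟩

/-- The number of conjugates of `g` by elements of the group generating a given subgroup. -/
def genCard (C : Subgroup G) (g : G) : ℤ := Nat.card {x : G // Subgroup.zpowers (x⁻¹ * g * x) = C}

omit [Finite G] in
theorem card_mul_fixCard (C : Subgroup G) (g : G) :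
    Nat.card C * fixCard G (G ⧸ C) g = Nat.card {x : G // x⁻¹ * g * x ∈ C} := by
  let t : Set (G ⧸ C) := {s | g • s = s}
  have e : {x : G // x⁻¹ * g * x ∈ C} ≃ (QuotientGroup.mk ⁻¹' t : Set G) :=
    Equiv.subtypeEquivRight fun x => by
      have : (x ∈ (QuotientGroup.mk ⁻¹' t : Set G)) ↔ ((g * x : G) : G ⧸ C) = (x : G ⧸ C) := Iff.rfl
      rw [this, eq_comm, QuotientGroup.eq, mul_assoc]
  rw [Nat.card_congr (e.trans (QuotientGroup.preimageMkEquivSubgroupProdSet C t)), Nat.card_prod,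
    fixCard, Nat.cast_mul]
  rfl

open Classical in
theorem card_eq_sum_genCard [Fintype (Subgroup G)] (C : Subgroup G) (g : G) :
    (Nat.card {x : G // x⁻¹ * g * x ∈ C} : ℤ) = ∑ D with D ≤ C, genCard D g := by
  have := Fintype.ofFinite G
  simp only [genCard, Nat.card_eq_fintype_card, Fintype.card_subtype]
  rw [← Nat.cast_sum, Nat.cast_inj, Finset.card_eq_sum_card_fiberwise
    (f := fun x : G => Subgroup.zpowers (x⁻¹ * g * x)) (t := Finset.univ.filter (· ≤ C))]
  · refine Finset.sum_congr rfl fun D hD => congrArg Finset.card ?_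
    ext x
    simp only [Finset.mem_filter, Finset.mem_univ, true_and] at hD ⊢
    refine ⟨fun h => h.2, fun h => ⟨hD ?_, h⟩⟩
    rw [← h]
    exact Subgroup.mem_zpowers _
  · intro x hx
    simpa using hx

theorem genCard_mem_torsionChar (n : ℕ) : ∀ C : Subgroup G, Nat.card C = n →
    genCard C ∈ torsionChar T := by
  classical
  have := Fintype.ofFinite (Subgroup G)
  induction n using Nat.strong_induction_on with
  | _ n ih =>
  intro C hC
  by_cases hc : ∃ c, Subgroup.zpowers c = C
  · obtain ⟨c, rfl⟩ := hc
    set C := Subgroup.zpowers c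
    have h1 : genCard C = Nat.card C • fixCard G (G ⧸ C) -
        ∑ D ∈ (Finset.univ.filter (· ≤ C)).erase C, genCard D := by
      funext g
      have h2 := card_eq_sum_genCard C g
      rw [← card_mul_fixCard, ← Finset.add_sum_erase _ _ (a := C) (by simp)] at h2
      rw [Pi.sub_apply, Finset.sum_apply, Pi.smul_apply, nsmul_eq_mul, h2, add_sub_cancel_right]
    rw [h1]
    refine sub_mem (nsmul_mem (fixCard_mem_torsionChar T c) _) (sum_mem fun D hD => ?_)
    simp only [Finset.mem_erase, Finset.mem_filter, Finset.mem_univ, true_and] at hD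
    refine ih _ ?_ D rfl
    rw [← hC]
    refine lt_of_le_of_ne (Subgroup.card_le_of_le hD.2) fun h => hD.1 ?_
    exact Subgroup.eq_of_le_of_card_ge hD.2 h.ge
  · convert (torsionChar T).zero_mem
    funext g
    simp only [genCard, Pi.zero_apply, Nat.cast_eq_zero]
    have : IsEmpty {x : G // Subgroup.zpowers (x⁻¹ * g * x) = C} := ⟨fun x => hc ⟨_, x.2⟩⟩
    exact Nat.card_of_isEmpty

theorem const_card_mem_torsionChar : (fun _ : G => (Nat.card G : ℤ)) ∈ torsionChar T := by
  classical
  have := Fintype.ofFinite (Subgroup G)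
  have h : (fun _ : G => (Nat.card G : ℤ)) = ∑ D : Subgroup G, genCard D := by
    funext g
    have h := card_eq_sum_genCard ⊤ g
    simp only [le_top, Finset.filter_true] at h
    rw [Finset.sum_apply, ← h, Nat.card_congr (Equiv.subtypeUnivEquiv fun x => Subgroup.mem_top _)]
  rw [h]
  exact sum_mem fun D _ => genCard_mem_torsionChar T _ D rfl

theorem one_cls_mem_permRel : ((1 : G → ℤ), G0.cls ℤ[G] T) ∈ permRel T := by
  let _ : MulAction G Empty :=
    { smul _ x := x
      one_smul x := x.elim
      mul_smul _ _ x := x.elim }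
  let _ : MulAction G Unit :=
    { smul _ x := x
      one_smul x := rfl
      mul_smul _ _ x := rfl }
  refine ⟨Unit, Empty, inferInstance, inferInstance, inferInstance, inferInstance, ?_, ?_⟩
  · funext g
    simp [fixCard]
  · rw [cls_fn_of_isEmpty Empty, sub_zero]
    let F : T → Fn G Unit T := fun t _ => t
    exact cls_congr <| equivOfEquivariant
      { toFun := F
        invFun f := f ()
        left_inv t := rfl
        right_inv f := rfl
        map_add' _ _ := rfl } fun g t => Fn.ext fun s => (Fn.act_apply g (F t) s).symm

include hT in
theorem torsion_cls_of_prime : ∃ n : ℕ, 0 < n ∧ n • G0.cls ℤ[G] T = 0 := by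
  obtain ⟨⟨u, y⟩, ⟨h1, h2⟩, h3⟩ := const_card_mem_torsionChar (G := G) T
  have h1 : (u, y) ∈ permRel T := h1
  have h4 := sub_mem h1 (nsmul_mem (one_cls_mem_permRel (G := G) T) (Nat.card G))
  have h5 : (u, y) - Nat.card G • ((1 : G → ℤ), G0.cls ℤ[G] T) =
      ((0 : G → ℤ), y - Nat.card G • G0.cls ℤ[G] T) := by
    refine Prod.ext ?_ rfl
    funext g
    simp [show u = _ from h3]
  rw [h5] at h4
  have h6 := sub_eq_zero.1 (eq_zero_of_mem_permRel p T hT h4)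
  obtain ⟨n, hn, hy⟩ := isOfFinAddOrder_iff_nsmul_eq_zero.1 (show IsOfFinAddOrder y from h2)
  refine ⟨n * Nat.card G, Nat.mul_pos hn Nat.card_pos, ?_⟩
  rw [mul_comm, mul_nsmul, ← h6, hy]

end ArtinInduction

section

open scoped MonoidAlgebra

/-- The class of a finite module in the Grothendieck group of an integral group ring is torsion. -/
theorem torsion_cls_of_finite {G : Type} [Group G] [Finite G] (T : Type) [AddCommGroup T]
    [Module ℤ[G] T] [Finite T] : ∃ n : ℕ, 0 < n ∧ n • G0.cls ℤ[G] T = 0 := by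
  refine torsion_cls_of_simple (fun S _ _ _ _ => ?_) T
  have : Nontrivial S := IsSimpleModule.nontrivial ℤ[G] S
  obtain ⟨p, hp, hd⟩ := Nat.exists_prime_and_dvd (Finite.one_lt_card (α := S)).ne'
  have : Fact p.Prime := ⟨hp⟩
  obtain ⟨s, hs⟩ := exists_prime_addOrderOf_dvd_card' p hd
  let f : S →ₗ[ℤ[G]] S := p • LinearMap.id
  refine torsion_cls_of_prime p S fun t => ?_
  have hf : f = 0 := by
    refine (LinearMap.bijective_or_eq_zero f).resolve_left fun hb => hp.ne_one ?_
    have h0 : s = 0 := hb.1 (by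
      change p • s = p • (0 : S)
      rw [smul_zero, ← hs, addOrderOf_nsmul_eq_zero])
    rw [← hs, h0, addOrderOf_zero]
  exact LinearMap.congr_fun hf t

end

end OArakelov

namespace OArakelov

noncomputable section HerbrandUnits

open scoped MonoidAlgebra

local notation:73 g:74 "⋆" m:73 => (MonoidAlgebra.single g (1 : ℤ)) • m

variable (F : Type) [Field F] [NumberField F]

/-- The kernel of the augmentation map on the free abelian group on the archimedean places. -/
abbrev AugKer : Type :=
  LinearMap.ker (Finsupp.linearCombination ℤ (fun _ : InfinitePlace F => (1 : ℤ)))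

theorem finrank_augKer : Module.finrank ℤ (AugKer F) + 1 = Fintype.card (InfinitePlace F) := by
  let φ := Finsupp.linearCombination ℤ (fun _ : InfinitePlace F => (1 : ℤ))
  have hφ : Function.Surjective φ := fun n => by
    obtain ⟨w⟩ := (inferInstance : Nonempty (InfinitePlace F))
    exact ⟨Finsupp.single w n, by simp [φ]⟩
  have h := Submodule.finrank_quotient_add_finrank (LinearMap.ker φ)
  rw [(φ.quotKerEquivOfSurjective hφ).finrank_eq, Module.finrank_self,
    Module.finrank_finsupp_self] at h
  rw [← h, add_comm]

theorem finrank_units : Module.finrank ℤ (Additive (𝓞 F)ˣ) = Units.rank F := by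
  let π : Additive (𝓞 F)ˣ →ₗ[ℤ] Units.dirichletUnitTheorem.logSpace F :=
    (Units.logEmbedding F).toIntLinearMap
  have h := Submodule.finrank_quotient_add_finrank (LinearMap.ker π)
  have h0 : Module.finrank ℤ (LinearMap.ker π) = 0 := by
    rw [Module.finrank_eq_zero_iff]
    intro x
    have hx : Additive.toMul (x : Additive (𝓞 F)ˣ) ∈ Units.torsion F :=
      Units.dirichletUnitTheorem.logEmbedding_eq_zero_iff.1 x.2
    obtain ⟨n, hn, hxn⟩ := isOfFinOrder_iff_pow_eq_one.1 hx
    refine ⟨n, by exact_mod_cast hn.ne', Subtype.ext ?_⟩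
    rw [natCast_zsmul]
    exact hxn
  have h1 : Module.finrank ℤ (LinearMap.range π) = Units.rank F := by
    have h2 : LinearMap.range π = Units.unitLattice F := (Submodule.map_top _).symm
    rw [h2, Module.finrank_eq_card_basis (Units.basisUnitLattice F), Fintype.card_fin]
  rw [π.quotKerEquivRange.finrank_eq, h1, h0, add_zero] at h
  exact h.symm

theorem eq_zero_of_forall_sum_eq_zero {W : Type} [Fintype W] (a : W → W → ℝ)
    (hrow : ∀ w, ∑ v, a w v = 0) (hneg : ∀ w v, v ≠ w → a w v < 0) (x : W → ℤ)
    (hx : ∑ w, x w = 0) (h : ∀ v, ∑ w, (x w : ℝ) * a w v = 0) : x = 0 := by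
  classical
  let P : Finset W := Finset.univ.filter fun w => 0 < x w
  have hP : ∀ w, w ∈ P ↔ 0 < x w := fun w => by simp [P]
  by_contra hne
  have h1 : ∃ w, 0 < x w := by
    by_contra! H
    apply hne
    funext w
    exact (Finset.sum_eq_zero_iff_of_nonpos fun w _ => H w).1 hx w (Finset.mem_univ w)
  have h2 : ∃ w, ¬ 0 < x w := by
    by_contra! H
    obtain ⟨w, hw⟩ := h1
    exact (Finset.sum_pos (fun w _ => H w) ⟨w, Finset.mem_univ w⟩).ne' hx
  obtain ⟨w, hw⟩ := h1
  obtain ⟨w', hw'⟩ := h2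
  have h3 : ∑ u, (x u : ℝ) * ∑ v ∈ P, a u v = 0 := by
    simp_rw [Finset.mul_sum]
    rw [Finset.sum_comm]
    exact Finset.sum_eq_zero fun v _ => h v
  have hcompl : ∀ u, ∑ v ∈ P, a u v = -∑ v ∈ Pᶜ, a u v := fun u => by
    rw [eq_neg_iff_add_eq_zero, Finset.sum_add_sum_compl, hrow]
  refine (Finset.sum_pos' (fun u _ => ?_) ⟨w, Finset.mem_univ w, ?_⟩).ne' h3
  · by_cases hu : 0 < x u
    · refine mul_nonneg (by exact_mod_cast hu.le) ?_
      rw [hcompl, neg_nonneg]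
      refine Finset.sum_nonpos fun v hv => (hneg u v ?_).le
      rintro rfl
      exact (Finset.mem_compl.1 hv) ((hP _).2 hu)
    · refine mul_nonneg_of_nonpos_of_nonpos (by exact_mod_cast not_lt.1 hu) ?_
      refine Finset.sum_nonpos fun v hv => (hneg u v ?_).le
      rintro rfl
      exact hu ((hP _).1 hv)
  · refine mul_pos (by exact_mod_cast hw) ?_
    rw [hcompl, neg_pos]
    refine Finset.sum_neg (fun v hv => hneg w v ?_) ⟨w', ?_⟩
    · rintro rfl
      exact (Finset.mem_compl.1 hv) ((hP _).2 hw)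
    · exact Finset.mem_compl.2 fun h => hw' ((hP _).1 h)

variable {F}

/-- The normalized logarithm of a unit at an archimedean place. -/
def logPlace (v : InfinitePlace F) : Additive (𝓞 F)ˣ →+ ℝ where
  toFun u := v.mult * Real.log (v ((Additive.toMul u : (𝓞 F)ˣ) : F))
  map_zero' := by simp
  map_add' x y := by
    rw [← mul_add, ← Real.log_mul]
    · simp
    · simp
    · simp

variable {K : Type} [Field K] [NumberField K] [Algebra K F] {G : Type} [Group G]
  (iso : G ≃* (F ≃ₐ[K] F))

/-- The action of an automorphism on units. -/
def galUnit (σ : F ≃ₐ[K] F) (u : (𝓞 F)ˣ) : (𝓞 F)ˣ :=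
  Units.map (RingOfIntegers.mapRingEquiv (σ : F ≃+* F)).toRingHom.toMonoidHom u

omit [NumberField F] [NumberField K] in
theorem coe_galUnit (σ : F ≃ₐ[K] F) (u : (𝓞 F)ˣ) :
    ((galUnit σ u : 𝓞 F) : F) = σ ((u : 𝓞 F) : F) := rfl

variable [Module ℤ[G] (Additive (𝓞 F)ˣ)] [Module ℤ[G] (AugKer F)]
  (hmU : ∀ (g : G) (u v : (𝓞 F)ˣ), ((v : 𝓞 F) : F) = iso g ((u : 𝓞 F) : F) →
    g ⋆ Additive.ofMul u = Additive.ofMul v)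
  (hmX : ∀ (g : G) (x : AugKer F), ((g ⋆ x : AugKer F) : InfinitePlace F →₀ ℤ) =
    Finsupp.mapDomain (fun w => iso g • w) (x : InfinitePlace F →₀ ℤ))

include hmU in
omit [NumberField F] [NumberField K] [Module ℤ[G] (AugKer F)] in
theorem logPlace_act (g : G) (u : Additive (𝓞 F)ˣ) (v : InfinitePlace F) :
    logPlace (iso g • v) (g ⋆ u) = logPlace v u := by
  have h := hmU g (Additive.toMul u) (galUnit (iso g) (Additive.toMul u)) (coe_galUnit _ _)
  rw [ofMul_toMul] at h
  rw [h]
  change ((iso g • v).mult : ℝ) * Real.log ((iso g • v) ((galUnit (iso g) _ : 𝓞 F) : F)) = _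
  rw [InfinitePlace.smul_apply, coe_galUnit, AlgEquiv.symm_apply_apply]
  have : (iso g • v).mult = v.mult := by
    have hr := InfinitePlace.isReal_smul_iff (σ := iso g) (w := v)
    rw [InfinitePlace.mult, InfinitePlace.mult]
    by_cases h : v.IsReal
    · rw [if_pos h, if_pos (hr.2 h)]
    · rw [if_neg h, if_neg fun h' => h (hr.1 h')]
  rw [this]
  rfl

include hmU in
omit [NumberField K] [Module ℤ[G] (AugKer F)] in
theorem exists_herbrand_units [Finite G] : ∃ ε : InfinitePlace F → Additive (𝓞 F)ˣ,
    (∀ g w, g ⋆ ε w = ε (iso g • w)) ∧ ∀ w v, v ≠ w → logPlace v (ε w) < 0 := by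
  have := Fintype.ofFinite G
  choose u hu using fun w => Units.dirichletUnitTheorem.exists_unit F w
  refine ⟨fun w => ∑ g : G, g ⋆ Additive.ofMul (u ((iso g)⁻¹ • w)), fun h w => ?_, fun w v hvw => ?_⟩
  · rw [Finset.smul_sum]
    refine Fintype.sum_equiv (Equiv.mulLeft h) _ _ fun g => ?_
    rw [← mul_act, Equiv.coe_mulLeft, map_mul, mul_inv_rev, mul_smul, inv_smul_smul]
  · rw [map_sum]
    refine Finset.sum_neg (fun g _ => ?_) ⟨1, Finset.mem_univ _⟩
    have h := logPlace_act iso hmU g (Additive.ofMul (u ((iso g)⁻¹ • w))) ((iso g)⁻¹ • v)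
    rw [smul_inv_smul] at h
    rw [h]
    refine mul_neg_of_pos_of_neg (by exact_mod_cast InfinitePlace.mult_pos) (hu _ _ ?_)
    exact fun h => hvw (smul_left_cancel _ h)

omit [NumberField K] in
include hmU hmX in
/-- The units and the augmentation kernel have the same class up to a finite module. -/
theorem cls_units_eq [Finite G] : ∃ (T : Type) (_ : AddCommGroup T) (_ : Module ℤ[G] T)
    (_ : Finite T), G0.cls ℤ[G] (Additive (𝓞 F)ˣ) = G0.cls ℤ[G] (AugKer F) + G0.cls ℤ[G] T := by
  obtain ⟨ε, hε, hneg⟩ := exists_herbrand_units iso hmU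
  let φ : AugKer F →ₗ[ℤ[G]] Additive (𝓞 F)ˣ :=
    linOfEquivariant ((Finsupp.linearCombination ℤ ε).toAddMonoidHom.comp
      (Submodule.subtype _).toAddMonoidHom) fun g x => by
        change Finsupp.linearCombination ℤ ε ((g ⋆ x : AugKer F) : InfinitePlace F →₀ ℤ) =
          g ⋆ Finsupp.linearCombination ℤ ε (x : InfinitePlace F →₀ ℤ)
        rw [hmX, Finsupp.linearCombination_mapDomain, Finsupp.linearCombination_apply,
          Finsupp.linearCombination_apply, Finsupp.smul_sum]
        refine Finsupp.sum_congr fun w _ => ?_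
        rw [act_zsmul, hε]
        rfl
  have hφ : Function.Injective φ := by
    rw [injective_iff_map_eq_zero]
    intro x hx
    refine Subtype.ext (DFunLike.coe_injective ?_)
    refine eq_zero_of_forall_sum_eq_zero (fun w v => logPlace v (ε w)) (fun w => ?_) hneg _ ?_
      fun v => ?_
    · exact Units.sum_mult_mul_log (Additive.toMul (ε w))
    · have := x.2
      rw [LinearMap.mem_ker, Finsupp.linearCombination_apply, Finsupp.sum_fintype _ _ (by simp)] at this
      simpa using this
    · have h1 : Finsupp.linearCombination ℤ ε (x : InfinitePlace F →₀ ℤ) = 0 := hx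
      have h2 := congrArg (logPlace v) h1
      rw [Finsupp.linearCombination_apply, Finsupp.sum_fintype _ _ (by simp), map_sum, map_zero] at h2
      simpa using h2
  let R := LinearMap.range φ
  have hfin : Finite (Additive (𝓞 F)ˣ ⧸ R) := by
    refine Module.finite_of_fg_torsion _ (Module.finrank_eq_zero_iff_isTorsion.1 ?_)
    let R' : Submodule ℤ (Additive (𝓞 F)ˣ) := R.toAddSubgroup.toIntSubmodule
    have h1 := Submodule.finrank_quotient_add_finrank R'
    have h2 : Module.finrank ℤ R' = Module.finrank ℤ (AugKer F) :=
      (LinearEquiv.ofInjective φ hφ).toAddEquiv.toIntLinearEquiv.finrank_eq.symm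
    have h3 := finrank_augKer F
    rw [finrank_units, h2, Units.rank] at h1
    have h4 : Module.finrank ℤ (Additive (𝓞 F)ˣ ⧸ R') = 0 := by omega
    exact h4
  refine ⟨Additive (𝓞 F)ˣ ⧸ R, inferInstance, inferInstance, hfin, ?_⟩
  have : Module.Finite ℤ[G] (Additive (𝓞 F)ˣ) := finite_groupRing
  rw [cls_eq_submodule_add_quotient R, ← cls_congr (LinearEquiv.ofInjective φ hφ)]

end HerbrandUnits

end OArakelov

namespace OArakelov

noncomputable section Duality

open scoped MonoidAlgebra

local notation:73 g:74 "⋆" m:73 => (MonoidAlgebra.single g (1 : ℤ)) • m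

variable {G : Type} [Group G]

theorem dualHom_eq_sub [Finite G] {M : Type} [AddCommGroup M] [Module ℤ[G] M]
    [Module.Finite ℤ[G] M] (N : Submodule ℤ[G] M) [Finite N] [Module.IsTorsionFree ℤ (M ⧸ N)] :
    dualHom G (G0.cls ℤ[G] M) =
      G0.cls ℤ[G] (IntDual G M) - G0.cls ℤ[G] (GHom G N (Triv G RmodZ)) := by
  rw [cls_eq_submodule_add_quotient N, map_add, dualHom_of_finite, dualHom_of_torsionFree,
    neg_add_eq_sub]
  congr 1
  have hinj : Function.Injective (GHom.precomp (A := Triv G ℤ) N.mkQ) := fun f h hfh =>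
    GHom.ext fun m => by
      obtain ⟨m, rfl⟩ := N.mkQ_surjective m
      exact DFunLike.congr_fun hfh m
  have hsurj : Function.Surjective (GHom.precomp (A := Triv G ℤ) N.mkQ) := fun f => by
    have hf : N.toAddSubgroup ≤ (GHom.untriv G M ℤ f).ker := fun n hn => by
      obtain ⟨k, hk, hkn⟩ := isOfFinAddOrder_iff_nsmul_eq_zero.1
        (isOfFinAddOrder_of_finite (⟨n, hn⟩ : N))
      have h1 : k • n = 0 := congrArg Subtype.val hkn
      have h2 := congrArg (GHom.untriv G M ℤ f) h1
      rw [map_nsmul, map_zero] at h2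
      exact (smul_eq_zero.1 h2).resolve_left hk.ne'
    refine ⟨(GHom.untriv G _ ℤ).symm (QuotientAddGroup.lift N.toAddSubgroup _ hf), ?_⟩
    exact GHom.ext fun m => rfl
  exact cls_congr (LinearEquiv.ofBijective _ ⟨hinj, hsurj⟩)

variable {F : Type} [Field F] [NumberField F]
  {K : Type} [Field K] [Algebra K F]

/-- Functions to a module with trivial action are plain functions. -/
def Fn.untriv (G S A : Type) [Group G] [AddCommGroup A] : Fn G S (Triv G A) ≃+ (S → A) :=
  AddEquiv.refl _

theorem Fn.untriv_act {S A : Type} [AddCommGroup A] [MulAction G S] (g : G)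
    (f : Fn G S (Triv G A)) (s : S) :
    Fn.untriv G S A (g ⋆ f) s = Fn.untriv G S A f (g⁻¹ • s) :=
  (Fn.act_apply g f s).trans (triv_act A g _)

theorem Fn.untriv_ext {S A : Type} [AddCommGroup A] {f h : Fn G S (Triv G A)}
    (H : ∀ s, Fn.untriv G S A f s = Fn.untriv G S A h s) : f = h := Fn.ext H

/-- The archimedean places with the action of `G`. -/
def Plc (_ : G ≃* (F ≃ₐ[K] F)) : Type := InfinitePlace F

variable (iso : G ≃* (F ≃ₐ[K] F))

instance : MulAction G (Plc iso) :=
  MulAction.compHom (InfinitePlace F) iso.toMonoidHom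

instance : Finite (Plc iso) := inferInstanceAs (Finite (InfinitePlace F))

variable {iso} in
/-- The underlying place. -/
def Plc.place (w : Plc iso) : InfinitePlace F := w

variable {iso} in
omit [NumberField F] in
theorem Plc.place_inv_smul (g : G) (w : Plc iso) : (g⁻¹ • w).place = (iso g)⁻¹ • w.place := by
  rw [← map_inv]
  rfl

theorem cls_perm_places [Finite G] [Module ℤ[G] (AugKer F)]
    (hmX : ∀ (g : G) (x : AugKer F), ((g ⋆ x : AugKer F) : InfinitePlace F →₀ ℤ) =
      Finsupp.mapDomain (fun w => iso g • w) (x : InfinitePlace F →₀ ℤ))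
    [Module ℤ[G] ℤ] (hmZ : ∀ (g : G) (n : ℤ), g ⋆ n = n) :
    G0.cls ℤ[G] (Fn G (Plc iso) (Triv G ℤ)) = G0.cls ℤ[G] (AugKer F) + G0.cls ℤ[G] ℤ := by
  let _ : Fintype (Plc iso) := inferInstanceAs (Fintype (InfinitePlace F))
  let i : AugKer F →ₗ[ℤ[G]] Fn G (Plc iso) (Triv G ℤ) :=
    linOfEquivariant
      { toFun x := (Fn.untriv G (Plc iso) ℤ).symm fun w => (x : InfinitePlace F →₀ ℤ) w.place
        map_zero' := rfl
        map_add' _ _ := rfl } fun g x => Fn.untriv_ext fun w => by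
          rw [Fn.untriv_act]
          change ((g ⋆ x : AugKer F) : InfinitePlace F →₀ ℤ) w.place =
            (x : InfinitePlace F →₀ ℤ) (g⁻¹ • w).place
          have h := Finsupp.mapDomain_apply (f := fun w : InfinitePlace F => iso g • w)
            (MulAction.injective (iso g)) (x : InfinitePlace F →₀ ℤ) ((iso g)⁻¹ • w.place)
          rw [hmX, Plc.place_inv_smul, ← h]
          exact congrArg _ (smul_inv_smul (iso g) w.place).symm
  let q : Fn G (Plc iso) (Triv G ℤ) →ₗ[ℤ[G]] ℤ :=
    linOfEquivariant
      { toFun x := ∑ w, Fn.untriv G (Plc iso) ℤ x w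
        map_zero' := Finset.sum_eq_zero fun _ _ => rfl
        map_add' _ _ := Finset.sum_add_distrib } fun g x => by
          rw [hmZ]
          refine Fintype.sum_equiv (MulAction.toPerm g⁻¹) _ _ fun w => ?_
          rw [Fn.untriv_act]
          rfl
  have hker : ∀ x : InfinitePlace F →₀ ℤ,
      Finsupp.linearCombination ℤ (fun _ : InfinitePlace F => (1 : ℤ)) x = ∑ w, x w := fun x => by
    rw [Finsupp.linearCombination_apply, Finsupp.sum_fintype _ _ (by simp)]
    simp
  refine cls_eq_add i q (fun x y hxy => ?_) (fun n => ?_) fun x => ⟨fun hx => ?_, ?_⟩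
  · exact Subtype.ext (DFunLike.coe_injective hxy)
  · classical
    obtain ⟨w⟩ := (inferInstance : Nonempty (InfinitePlace F))
    refine ⟨(Fn.untriv G (Plc iso) ℤ).symm (Pi.single (M := fun _ => ℤ) (w : Plc iso) n), ?_⟩
    exact Finset.sum_pi_single' (w : Plc iso) n Finset.univ |>.trans (if_pos (Finset.mem_univ _))
  · refine ⟨⟨Finsupp.equivFunOnFinite.symm (Fn.untriv G (Plc iso) ℤ x), ?_⟩, rfl⟩
    rw [LinearMap.mem_ker, hker]
    exact hx
  · rintro ⟨y, rfl⟩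
    have := y.2
    rw [LinearMap.mem_ker, hker] at this
    exact this

theorem dualHom_augKer [Finite G] [Module ℤ[G] (AugKer F)]
    (hmX : ∀ (g : G) (x : AugKer F), ((g ⋆ x : AugKer F) : InfinitePlace F →₀ ℤ) =
      Finsupp.mapDomain (fun w => iso g • w) (x : InfinitePlace F →₀ ℤ))
    [Module ℤ[G] ℤ] (hmZ : ∀ (g : G) (n : ℤ), g ⋆ n = n) :
    dualHom G (G0.cls ℤ[G] (AugKer F)) = G0.cls ℤ[G] (AugKer F) := by
  have h1 := cls_perm_places iso hmX hmZ
  have h2 : dualHom G (G0.cls ℤ[G] ℤ) = G0.cls ℤ[G] ℤ := by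
    have e : G0.cls ℤ[G] ℤ = G0.cls ℤ[G] (Fn G PUnit (Triv G ℤ)) :=
      cls_congr (equivOfEquivariant
        ((AddEquiv.funUnique PUnit ℤ).symm.trans (Fn.untriv G PUnit ℤ).symm) fun g n => by
          rw [hmZ]
          exact Fn.untriv_ext fun s => (Fn.untriv_act _ _ _).symm)
    rw [e, dualHom_perm]
  have h3 := congrArg (dualHom G) h1
  rw [dualHom_perm, map_add, h2, h1] at h3
  exact (add_right_cancel h3).symm

end Duality

end OArakelov

namespace OArakelov

noncomputable section Coordinates

open scoped Classical

variable {F : Type} [Field F] [NumberField F]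

/-- The coordinate of `F ⊗ ℝ` at a complex embedding. -/
def coord (σ : F →+* ℂ) : FReal F →ₐ[ℝ] ℂ :=
  Algebra.TensorProduct.lift (Algebra.ofId ℝ ℂ) σ.toRatAlgHom fun _ _ => Commute.all _ _

@[simp] theorem coord_tmul (σ : F →+* ℂ) (r : ℝ) (a : F) : coord σ (r ⊗ₜ a) = r * σ a := by
  rw [coord, Algebra.TensorProduct.lift_tmul]
  rfl

variable (F)

/-- A rational basis of `F` indexed by the complex embeddings. -/
def embBasis : Module.Basis (F →+* ℂ) ℚ F :=
  (Module.finBasis ℚ F).reindex (Fintype.equivOfCardEq (by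
    rw [Fintype.card_fin, Embeddings.card]))

/-- The matrix of the embeddings of a basis. -/
def embMatrix : Matrix (F →+* ℂ) (F →+* ℂ) ℂ := Matrix.of fun σ τ => σ (embBasis F τ)

theorem isUnit_det_embMatrix : IsUnit (embMatrix F).det := by
  have h := Algebra.discr_eq_det_embeddingsMatrixReindex_pow_two ℚ ℂ (embBasis F)
    (RingHom.equivRatAlgHom (R := F) (S := ℂ))
  have h0 := Algebra.discr_not_zero_of_basis ℚ (embBasis F)
  have h1 : Algebra.embeddingsMatrixReindex ℚ ℂ (embBasis F)
      (RingHom.equivRatAlgHom (R := F) (S := ℂ)) = (embMatrix F).transpose := by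
    ext i j
    rfl
  rw [h1, Matrix.det_transpose] at h
  rw [isUnit_iff_ne_zero]
  intro h2
  rw [h2, zero_pow two_ne_zero] at h
  exact h0 ((algebraMap ℚ ℂ).injective (h.trans (map_zero _).symm))

/-- The corresponding real basis of `F ⊗ ℝ`. -/
def realBasis : Module.Basis (F →+* ℂ) ℝ (FReal F) :=
  Algebra.TensorProduct.basis ℝ (embBasis F)

variable {F}

theorem coord_realBasis (σ τ : F →+* ℂ) : coord σ (realBasis F τ) = embMatrix F σ τ := by
  rw [realBasis, Algebra.TensorProduct.basis_apply, coord_tmul, Complex.ofReal_one, one_mul]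
  rfl

theorem coord_eq_mulVec (x : FReal F) (σ : F →+* ℂ) :
    coord σ x = (embMatrix F).mulVec (fun τ => ((realBasis F).repr x τ : ℂ)) σ := by
  conv_lhs => rw [← (realBasis F).sum_repr x]
  rw [map_sum, Matrix.mulVec, dotProduct]
  refine Finset.sum_congr rfl fun τ _ => ?_
  rw [map_smul, coord_realBasis, Complex.real_smul, mul_comm]

theorem coord_ext {x y : FReal F} (h : ∀ σ : F →+* ℂ, coord σ x = coord σ y) : x = y := by
  refine (realBasis F).repr.injective (Finsupp.ext fun τ => ?_)
  have h1 := Matrix.mulVec_injective_of_isUnit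
    ((Matrix.isUnit_iff_isUnit_det _).2 (isUnit_det_embMatrix F))
    (funext fun σ => by rw [← coord_eq_mulVec, ← coord_eq_mulVec, h] :
      (embMatrix F).mulVec (fun τ => ((realBasis F).repr x τ : ℂ)) =
        (embMatrix F).mulVec fun τ => ((realBasis F).repr y τ : ℂ))
  exact_mod_cast congrFun h1 τ

theorem norm_eq_prod_coord (x : FReal F) :
    ((Algebra.norm ℝ x : ℝ) : ℂ) = ∏ σ : F →+* ℂ, coord σ x := by
  let M := (Algebra.leftMulMatrix (realBasis F) x).map (algebraMap ℝ ℂ)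
  have h1 : embMatrix F * M = Matrix.diagonal (fun σ => coord σ x) * embMatrix F := by
    ext σ τ
    rw [Matrix.diagonal_mul, ← coord_realBasis, ← map_mul, coord_eq_mulVec, Matrix.mul_apply,
      Matrix.mulVec, dotProduct]
    refine Finset.sum_congr rfl fun ρ _ => ?_
    simp only [M, Matrix.map_apply, Algebra.leftMulMatrix_eq_repr_mul, Complex.coe_algebraMap]
  have h2 := congrArg Matrix.det h1
  rw [Matrix.det_mul, Matrix.det_mul, mul_comm, Matrix.det_diagonal] at h2
  have h3 := mul_right_cancel₀ (isUnit_det_embMatrix F).ne_zero h2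
  rw [← h3, Algebra.norm_eq_matrix_det (realBasis F)]
  exact (algebraMap ℝ ℂ).map_det _

theorem coord_conjugate (σ : F →+* ℂ) (x : FReal F) :
    coord (ComplexEmbedding.conjugate σ) x = starRingEnd ℂ (coord σ x) := by
  induction x using TensorProduct.induction_on with
  | zero => simp
  | tmul r a => simp
  | add x y hx hy => simp [hx, hy]

omit [NumberField F] in
theorem conjugate_conjugate (σ : F →+* ℂ) :
    ComplexEmbedding.conjugate (ComplexEmbedding.conjugate σ) = σ := star_star σ

theorem exists_coord_eq (z : (F →+* ℂ) → ℂ)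
    (hz : ∀ σ, z (ComplexEmbedding.conjugate σ) = starRingEnd ℂ (z σ)) :
    ∃ x : FReal F, ∀ σ, coord σ x = z σ := by
  have hu : IsUnit (embMatrix F) := (Matrix.isUnit_iff_isUnit_det _).2 (isUnit_det_embMatrix F)
  obtain ⟨v, hv⟩ := (Matrix.mulVec_surjective_iff_isUnit.2 hu) z
  have h1 : (embMatrix F).mulVec (fun τ => starRingEnd ℂ (v τ)) = z := by
    funext σ
    have h2 := hz (ComplexEmbedding.conjugate σ)
    rw [conjugate_conjugate] at h2
    rw [h2, ← hv, Matrix.mulVec, Matrix.mulVec, dotProduct, dotProduct, map_sum]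
    refine Finset.sum_congr rfl fun τ _ => ?_
    rw [map_mul]
    congr 1
    exact (Complex.conj_conj _).symm
  have h3 := Matrix.mulVec_injective_of_isUnit hu (h1.trans hv.symm)
  refine ⟨(realBasis F).repr.symm (Finsupp.equivFunOnFinite.symm fun τ => (v τ).re), fun σ => ?_⟩
  rw [coord_eq_mulVec, ← hv]
  congr 2
  funext τ
  rw [LinearEquiv.apply_symm_apply]
  exact Complex.conj_eq_iff_re.1 (congrFun h3 τ)

theorem isInducing_finBasis : Topology.IsInducing (Module.finBasis ℝ (FReal F)).equivFun := ⟨rfl⟩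

instance : IsTopologicalAddGroup (FReal F) :=
  isInducing_finBasis.topologicalAddGroup (Module.finBasis ℝ (FReal F)).equivFun

instance : ContinuousSMul ℝ (FReal F) :=
  isInducing_finBasis.continuousSMul continuous_id (map_smul _ _ _)

instance : T2Space (FReal F) :=
  T2Space.of_injective_continuous (Module.finBasis ℝ (FReal F)).equivFun.injective
    isInducing_finBasis.continuous

theorem isInducing_coord :
    Topology.IsInducing fun (x : FReal F) (σ : F →+* ℂ) => coord σ x := by
  let Φ : FReal F →ₗ[ℝ] (F →+* ℂ) → ℂ := LinearMap.pi fun σ => (coord σ).toLinearMap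
  have hΦ : LinearMap.ker Φ = ⊥ := by
    refine LinearMap.ker_eq_bot.2 fun x y h => coord_ext fun σ => congrFun h σ
  exact (LinearMap.isClosedEmbedding_of_injective hΦ).isInducing

theorem continuous_coord (σ : F →+* ℂ) : Continuous fun x : FReal F => coord σ x :=
  (continuous_apply σ).comp isInducing_coord.continuous

instance : ContinuousMul (FReal F) :=
  isInducing_coord.continuousMul (RingHom.pi fun σ => (coord σ).toRingHom)

/-- The unit with given coordinates. -/
theorem exists_unit_coord_eq (z : (F →+* ℂ) → ℂ) (h0 : ∀ σ, z σ ≠ 0)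
    (hz : ∀ σ, z (ComplexEmbedding.conjugate σ) = starRingEnd ℂ (z σ)) :
    ∃ x : (FReal F)ˣ, ∀ σ, coord σ (x : FReal F) = z σ := by
  obtain ⟨x, hx⟩ := exists_coord_eq z hz
  obtain ⟨y, hy⟩ := exists_coord_eq (fun σ => (z σ)⁻¹) fun σ => by rw [hz, map_inv₀]
  have hxy : x * y = 1 := coord_ext fun σ => by
    rw [map_mul, hx, hy, mul_inv_cancel₀ (h0 σ), map_one]
  exact ⟨⟨x, y, hxy, by rw [mul_comm, hxy]⟩, hx⟩

theorem coord_ne_zero (x : (FReal F)ˣ) (σ : F →+* ℂ) : coord σ (x : FReal F) ≠ 0 :=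
  (x.isUnit.map (coord σ)).ne_zero

theorem coord_inv (x : (FReal F)ˣ) (σ : F →+* ℂ) :
    coord σ ((x⁻¹ : (FReal F)ˣ) : FReal F) = (coord σ (x : FReal F))⁻¹ := by
  refine eq_inv_of_mul_eq_one_left ?_
  rw [← map_mul, Units.inv_mul, map_one]

theorem continuous_units {X : Type} [TopologicalSpace X] {f : X → (FReal F)ˣ}
    (h : ∀ σ : F →+* ℂ, Continuous fun x => coord σ (f x : FReal F)) : Continuous f := by
  refine Units.continuous_iff.2 ⟨isInducing_coord.continuous_iff.2 (continuous_pi h),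
    isInducing_coord.continuous_iff.2 (continuous_pi fun σ => ?_)⟩
  simp only [Function.comp_apply, coord_inv]
  exact (h σ).inv₀ fun x => coord_ne_zero _ _

theorem coe_absNormFR (x : (FReal F)ˣ) :
    ((absNormFR F x : ℝˣ) : ℝ) = ∏ σ : F →+* ℂ, ‖coord σ (x : FReal F)‖ := by
  rw [← norm_prod, ← norm_eq_prod_coord]
  exact (Complex.norm_real _).symm

end Coordinates

end OArakelov

namespace OArakelov

noncomputable section NormOne

open scoped Classical
open Units.dirichletUnitTheorem

variable (F : Type) [Field F] [NumberField F]

/-- The elements of `F ⊗ ℝ` whose norm has absolute value one. -/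
def Vone : Subgroup (FReal F)ˣ := (absNormFR F).ker

variable {F}

theorem mem_Vone {x : (FReal F)ˣ} :
    x ∈ Vone F ↔ ∏ σ : F →+* ℂ, ‖coord σ (x : FReal F)‖ = 1 := by
  rw [Vone, MonoidHom.mem_ker, ← coe_absNormFR, Units.val_eq_one]

theorem sum_embeddings (f : InfinitePlace F → ℝ) :
    ∑ σ : F →+* ℂ, f (InfinitePlace.mk σ) = ∑ w : InfinitePlace F, w.mult * f w := by
  rw [← Finset.sum_fiberwise _ (fun σ : F →+* ℂ => InfinitePlace.mk σ)]
  refine Finset.sum_congr rfl fun w _ => ?_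
  rw [Finset.sum_congr rfl (fun σ hσ => by rw [(Finset.mem_filter.1 hσ).2] :
    ∀ σ ∈ Finset.univ.filter (fun σ : F →+* ℂ => InfinitePlace.mk σ = w),
      f (InfinitePlace.mk σ) = f w), Finset.sum_const, InfinitePlace.card_filter_mk_eq,
    nsmul_eq_mul]

theorem norm_coord_embedding_mk (σ : F →+* ℂ) (x : FReal F) :
    ‖coord (InfinitePlace.mk σ).embedding x‖ = ‖coord σ x‖ := by
  rcases InfinitePlace.embedding_mk_eq σ with h | h
  · rw [h]
  · rw [h, coord_conjugate, Complex.norm_conj]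

/-- The coordinates of an element of norm one. -/
def coordV (σ : F →+* ℂ) (x : Additive (Vone F)) : ℂ :=
  coord σ (((Additive.toMul x : Vone F) : (FReal F)ˣ) : FReal F)

theorem coordV_ne_zero (σ : F →+* ℂ) (x : Additive (Vone F)) : coordV σ x ≠ 0 :=
  coord_ne_zero _ σ

@[simp] theorem coordV_zero (σ : F →+* ℂ) : coordV σ (0 : Additive (Vone F)) = 1 :=
  map_one (coord σ)

@[simp] theorem coordV_add (σ : F →+* ℂ) (x y : Additive (Vone F)) :
    coordV σ (x + y) = coordV σ x * coordV σ y :=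
  map_mul (coord σ) _ _

@[simp] theorem coordV_neg (σ : F →+* ℂ) (x : Additive (Vone F)) :
    coordV σ (-x) = (coordV σ x)⁻¹ :=
  coord_inv _ σ

theorem coordV_ext {x y : Additive (Vone F)} (h : ∀ σ : F →+* ℂ, coordV σ x = coordV σ y) :
    x = y :=
  congrArg Additive.ofMul (Subtype.ext (Units.ext (coord_ext h)) :
    (Additive.toMul x : Vone F) = Additive.toMul y)

theorem coordV_conjugate (σ : F →+* ℂ) (x : Additive (Vone F)) :
    coordV (ComplexEmbedding.conjugate σ) x = starRingEnd ℂ (coordV σ x) :=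
  coord_conjugate σ _

theorem norm_coordV_embedding_mk (σ : F →+* ℂ) (x : Additive (Vone F)) :
    ‖coordV (InfinitePlace.mk σ).embedding x‖ = ‖coordV σ x‖ :=
  norm_coord_embedding_mk σ _

theorem prod_norm_coordV (x : Additive (Vone F)) : ∏ σ : F →+* ℂ, ‖coordV σ x‖ = 1 :=
  mem_Vone.1 (Additive.toMul x : Vone F).2

theorem continuous_coordV (σ : F →+* ℂ) : Continuous (coordV σ) :=
  (continuous_coord σ).comp (Units.continuous_val.comp
    (continuous_subtype_val.comp continuous_toMul))

theorem continuous_Vone {X : Type} [TopologicalSpace X] {f : X → Additive (Vone F)}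
    (h : ∀ σ : F →+* ℂ, Continuous fun x => coordV σ (f x)) : Continuous f :=
  continuous_ofMul.comp (Continuous.subtype_mk (continuous_units h)
    fun x => (Additive.toMul (f x) : Vone F).2)

theorem exists_coordV_eq (z : (F →+* ℂ) → ℂ) (h0 : ∏ σ, ‖z σ‖ = 1)
    (hz : ∀ σ, z (ComplexEmbedding.conjugate σ) = starRingEnd ℂ (z σ)) :
    ∃ x : Additive (Vone F), ∀ σ, coordV σ x = z σ := by
  obtain ⟨x, hx⟩ := exists_unit_coord_eq z (fun σ hσ => by
    rw [Finset.prod_eq_zero (Finset.mem_univ σ) (by rw [hσ, norm_zero])] at h0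
    exact zero_ne_one h0) hz
  refine ⟨Additive.ofMul (⟨x, mem_Vone.2 ?_⟩ : Vone F), hx⟩
  simpa only [hx] using h0

variable (F) in
/-- The logarithmic embedding of the elements of norm one. -/
def logV : Additive (Vone F) →+ logSpace F where
  toFun x w := w.1.mult * Real.log ‖coordV w.1.embedding x‖
  map_zero' := by
    ext w
    simp
  map_add' x y := by
    ext w
    simp only [coordV_add, norm_mul, Pi.add_apply]
    rw [Real.log_mul (norm_ne_zero_iff.2 (coordV_ne_zero _ _))
      (norm_ne_zero_iff.2 (coordV_ne_zero _ _)), mul_add]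

/-- The values at all places of an element of the logarithmic space. -/
def logExt : logSpace F →ₗ[ℝ] InfinitePlace F → ℝ where
  toFun y w := (if h : w ≠ w₀ then y ⟨w, h⟩ else -∑ v, y v) / w.mult
  map_add' x y := by
    ext w
    simp only [Pi.add_apply, ← add_div]
    congr 1
    split_ifs
    · rfl
    · rw [Finset.sum_add_distrib, neg_add]
  map_smul' r y := by
    ext w
    simp only [Pi.smul_apply, smul_eq_mul, RingHom.id_apply, ← mul_div_assoc]
    congr 1
    split_ifs
    · rfl
    · rw [← Finset.mul_sum, mul_neg]

theorem mult_mul_logExt (y : logSpace F) (w : InfinitePlace F) :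
    w.mult * logExt y w = if h : w ≠ w₀ then y ⟨w, h⟩ else -∑ v, y v :=
  mul_div_cancel₀ _ (by exact_mod_cast InfinitePlace.mult_ne_zero)

theorem sum_mult_mul_logExt (y : logSpace F) : ∑ w, w.mult * logExt y w = 0 := by
  rw [← Finset.sum_erase_add _ _ (Finset.mem_univ (w₀ : InfinitePlace F)), mult_mul_logExt,
    dif_neg (not_not.2 rfl), add_neg_eq_zero]
  rw [Finset.sum_subtype (p := fun w => w ≠ w₀) _ (by simp)]
  refine Finset.sum_congr rfl fun w _ => ?_
  rw [mult_mul_logExt, dif_pos w.2]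

theorem logExt_unique (y : logSpace F) (f : InfinitePlace F → ℝ)
    (hf : ∑ w, w.mult * f w = 0) (hy : ∀ w : {w : InfinitePlace F // w ≠ w₀}, w.1.mult * f w = y w) :
    logExt y = f := by
  have h1 : ∀ w : InfinitePlace F, w ≠ w₀ → logExt y w = f w := fun w hw => by
    have := mult_mul_logExt y w
    rw [dif_pos hw, ← hy] at this
    exact mul_left_cancel₀ (by exact_mod_cast InfinitePlace.mult_ne_zero) this
  funext w
  by_cases hw : w = w₀
  · have h2 := (sum_mult_mul_logExt y).trans hf.symm
    rw [← Finset.sum_erase_add _ _ (Finset.mem_univ w),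
      ← Finset.sum_erase_add (a := w) _ _ (Finset.mem_univ w),
      Finset.sum_congr rfl (fun v hv => by rw [h1 v (by rw [← hw]; exact Finset.ne_of_mem_erase hv)] :
        ∀ v ∈ Finset.univ.erase w, v.mult * logExt y v = v.mult * f v), add_right_inj] at h2
    exact mul_left_cancel₀ (by exact_mod_cast InfinitePlace.mult_ne_zero) h2
  · exact h1 w hw

theorem exists_expV (y : logSpace F) : ∃ x : Additive (Vone F), ∀ σ,
    coordV σ x = (Real.exp (logExt y (InfinitePlace.mk σ)) : ℂ) := by
  refine exists_coordV_eq _ ?_ fun σ => ?_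
  · simp_rw [Complex.norm_real, Real.norm_eq_abs, Real.abs_exp]
    rw [← Real.exp_sum, sum_embeddings, sum_mult_mul_logExt, Real.exp_zero]
  · rw [InfinitePlace.mk_conjugate_eq, Complex.conj_ofReal]

variable (F) in
/-- The exponential section of the logarithmic embedding. -/
def expV : logSpace F →+ Additive (Vone F) where
  toFun y := (exists_expV y).choose
  map_zero' := coordV_ext fun σ => by
    rw [(exists_expV 0).choose_spec]
    simp
  map_add' x y := coordV_ext fun σ => by
    rw [(exists_expV (x + y)).choose_spec, coordV_add, (exists_expV x).choose_spec,
      (exists_expV y).choose_spec, map_add, Pi.add_apply, Real.exp_add, Complex.ofReal_mul]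

theorem coordV_expV (y : logSpace F) (σ : F →+* ℂ) :
    coordV σ (expV F y) = (Real.exp (logExt y (InfinitePlace.mk σ)) : ℂ) :=
  (exists_expV y).choose_spec σ

theorem continuous_logExt : Continuous (logExt : logSpace F → InfinitePlace F → ℝ) :=
  (logExt (F := F)).continuous_of_finiteDimensional

theorem continuous_expV : Continuous (expV F) := by
  refine continuous_Vone fun σ => ?_
  simp only [coordV_expV]
  exact Complex.continuous_ofReal.comp (Real.continuous_exp.comp
    ((continuous_apply _).comp continuous_logExt))

theorem continuous_logV : Continuous (logV F) :=
  continuous_pi fun _ => continuous_const.mul (Continuous.log (continuous_coordV _).norm fun _ =>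
    norm_ne_zero_iff.2 (coordV_ne_zero _ _))

theorem logExt_logV (x : Additive (Vone F)) :
    logExt (logV F x) = fun w => Real.log ‖coordV w.embedding x‖ := by
  refine logExt_unique _ _ ?_ fun w => rfl
  rw [← sum_embeddings]
  simp_rw [norm_coordV_embedding_mk]
  rw [← Real.log_prod fun σ _ => norm_ne_zero_iff.2 (coordV_ne_zero _ _), prod_norm_coordV,
    Real.log_one]

theorem logV_expV (y : logSpace F) : logV F (expV F y) = y := by
  funext w
  change w.1.mult * Real.log ‖coordV w.1.embedding _‖ = _
  rw [coordV_expV, InfinitePlace.mk_embedding, Complex.norm_real, Real.norm_eq_abs, Real.abs_exp,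
    Real.log_exp, mult_mul_logExt, dif_pos w.2]

theorem logV_eq_zero_iff {x : Additive (Vone F)} :
    logV F x = 0 ↔ ∀ σ : F →+* ℂ, ‖coordV σ x‖ = 1 := by
  refine ⟨fun hx σ => ?_, fun h => ?_⟩
  · have h := congrFun (logExt_logV x) (InfinitePlace.mk σ)
    rw [hx, map_zero, norm_coordV_embedding_mk] at h
    rw [← Real.exp_log (norm_pos_iff.2 (coordV_ne_zero σ x)), ← h]
    exact Real.exp_zero
  · funext w
    change w.1.mult * Real.log ‖coordV w.1.embedding _‖ = _
    rw [h, Real.log_one, mul_zero]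
    rfl

/-- Units as elements of norm one. -/
def unitV : Additive (𝓞 F)ˣ →+ Additive (Vone F) :=
  MonoidHom.toAdditive <| (Units.map ((Algebra.TensorProduct.includeRight :
      F →ₐ[ℚ] FReal F).toMonoidHom.comp (algebraMap (𝓞 F) F).toMonoidHom)).codRestrict (Vone F)
    fun u => by
      have h : ∀ σ : F →+* ℂ, coord σ ((Units.map ((Algebra.TensorProduct.includeRight :
          F →ₐ[ℚ] FReal F).toMonoidHom.comp (algebraMap (𝓞 F) F).toMonoidHom) u : (FReal F)ˣ) :
            FReal F) = σ ((u : 𝓞 F) : F) := fun σ => by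
        change coord σ ((1 : ℝ) ⊗ₜ _) = _
        rw [coord_tmul, Complex.ofReal_one, one_mul]
        rfl
      have h0 : ∀ σ : F →+* ℂ, 0 < ‖σ ((u : 𝓞 F) : F)‖ := fun σ => norm_pos_iff.2
        ((map_ne_zero σ).2 (Units.coe_ne_zero u))
      rw [mem_Vone]
      simp_rw [h]
      rw [← Finset.prod_congr rfl fun σ _ => Real.exp_log (h0 σ), ← Real.exp_sum]
      have h1 := sum_embeddings fun w : InfinitePlace F => Real.log (w ((u : 𝓞 F) : F))
      rw [Units.sum_mult_mul_log] at h1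
      rw [← Real.exp_zero, ← h1]
      rfl

theorem coordV_unitV (u : Additive (𝓞 F)ˣ) (σ : F →+* ℂ) :
    coordV σ (unitV u) = σ (((Additive.toMul u : (𝓞 F)ˣ) : 𝓞 F) : F) := by
  change coord σ ((1 : ℝ) ⊗ₜ _) = _
  rw [coord_tmul, Complex.ofReal_one, one_mul]
  rfl

theorem logV_unitV (u : Additive (𝓞 F)ˣ) : logV F (unitV u) = Units.logEmbedding F u := by
  funext w
  change w.1.mult * Real.log ‖coordV w.1.embedding _‖ = _
  rw [coordV_unitV, InfinitePlace.norm_embedding_eq]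
  rfl

end NormOne

end OArakelov

namespace OArakelov

noncomputable section PicTildeStructure

open scoped Classical

variable {F : Type} [Field F] [NumberField F]

theorem mem_picDom {x : IdealGroup F × (FReal F)ˣ} :
    x ∈ picDom F ↔ idealNormHom F x.1 = absNormFR F x.2 := by
  rw [picDom, MonoidHom.mem_ker, MonoidHom.div_apply, div_eq_one]
  rfl

theorem coe_idealNormHom (I : IdealGroup F) :
    ((idealNormHom F I : ℝˣ) : ℝ) =
      (FractionalIdeal.absNorm (I : FractionalIdeal (𝓞 F)⁰ F) : ℝ) := rfl

theorem coord_principal (α : Fˣ) (σ : F →+* ℂ) :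
    coord σ ((principalHom F α).2 : FReal F) = σ α := by
  change coord σ ((1 : ℝ) ⊗ₜ _) = _
  rw [coord_tmul, Complex.ofReal_one, one_mul]

theorem principalHom_mem (α : Fˣ) : principalHom F α ∈ picDom F := by
  rw [mem_picDom, ← Units.val_inj, coe_idealNormHom, coe_absNormFR]
  simp_rw [coord_principal]
  have h1 : ((principalHom F α).1 : FractionalIdeal (𝓞 F)⁰ F) =
    FractionalIdeal.spanSingleton (𝓞 F)⁰ (α : F) := coe_toPrincipalIdeal α
  rw [h1, FractionalIdeal.absNorm_span_singleton, ← norm_prod]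
  have h2 := Algebra.norm_eq_prod_embeddings ℚ ℂ (α : F)
  rw [← Fintype.prod_equiv (RingHom.equivRatAlgHom (R := F) (S := ℂ)) (fun σ => σ (α : F)) _
    (fun σ => rfl)] at h2
  rw [← h2, Rat.cast_abs]
  exact (Complex.norm_real _).symm.trans (by simp)

theorem idealGroup_discrete : DiscreteTopology (IdealGroup F) := ⟨rfl⟩

/-- Elements of norm one as Arakelov divisors. -/
def toDom : Vone F →* picDom F :=
  ((MonoidHom.inr (IdealGroup F) (FReal F)ˣ).comp (Vone F).subtype).codRestrict (picDom F)
    fun x => mem_picDom.2 ((map_one _).trans x.2.symm)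

theorem isOpenEmbedding_toDom : Topology.IsOpenEmbedding (toDom (F := F)) := by
  have := idealGroup_discrete (F := F)
  have h1 : Topology.IsEmbedding (fun x : Vone F => ((1 : IdealGroup F), (x : (FReal F)ˣ))) :=
    (isEmbedding_prodMkRight (1 : IdealGroup F)).comp Topology.IsEmbedding.subtypeVal
  refine ⟨h1.of_comp ?_ continuous_subtype_val, ?_⟩
  · exact Continuous.subtype_mk h1.continuous _
  · have h2 : Set.range (toDom (F := F)) =
        (fun x : picDom F => (x : IdealGroup F × (FReal F)ˣ).1) ⁻¹' {1} := by
      ext x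
      constructor
      · rintro ⟨y, rfl⟩
        rfl
      · intro hx
        have hx' : (x : IdealGroup F × (FReal F)ˣ).1 = 1 := hx
        have hx2 := mem_picDom.1 x.2
        rw [hx', map_one] at hx2
        exact ⟨⟨_, hx2.symm⟩, Subtype.ext (Prod.ext hx'.symm rfl)⟩
    rw [h2]
    exact (isOpen_discrete _).preimage (continuous_fst.comp continuous_subtype_val)

variable (F) in
/-- The map from elements of norm one to the oriented Arakelov class group. -/
def iotaV : Additive (Vone F) →+ Additive (PicTilde F) :=
  MonoidHom.toAdditive ((QuotientGroup.mk' (principalSub F)).comp toDom)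

theorem continuous_iotaV : Continuous (iotaV F) :=
  continuous_ofMul.comp ((QuotientGroup.continuous_mk.comp
    isOpenEmbedding_toDom.continuous).comp continuous_toMul)

theorem iotaV_eq_zero_iff {x : Additive (Vone F)} :
    iotaV F x = 0 ↔ ∃ u : Additive (𝓞 F)ˣ, x = unitV u := by
  have h0 : iotaV F x = 0 ↔ toDom (Additive.toMul x : Vone F) ∈ principalSub F :=
    QuotientGroup.eq_one_iff (N := principalSub F) (toDom (Additive.toMul x : Vone F))
  rw [h0]
  constructor
  · rintro ⟨α, hα⟩
    have h1 : toPrincipalIdeal (𝓞 F) F α = 1 := congrArg Prod.fst hα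
    have h2 : ∀ σ, coordV σ x = σ α := fun σ => by
      rw [← coord_principal, hα]
      rfl
    rw [toPrincipalIdeal_eq_iff, Units.val_one, ← FractionalIdeal.spanSingleton_one] at h1
    have h3 : (α : F) ∈ (1 : FractionalIdeal (𝓞 F)⁰ F) := by
      rw [← FractionalIdeal.spanSingleton_one, ← h1]
      exact FractionalIdeal.mem_spanSingleton_self _ _
    have h4 : ((1 : F)) ∈ FractionalIdeal.spanSingleton (𝓞 F)⁰ (α : F) := by
      rw [h1]
      exact FractionalIdeal.mem_spanSingleton_self _ _
    obtain ⟨a, ha⟩ := (FractionalIdeal.mem_one_iff _).1 h3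
    obtain ⟨b, hb⟩ := (FractionalIdeal.mem_spanSingleton _).1 h4
    have hab : a * b = 1 := by
      apply FaithfulSMul.algebraMap_injective (𝓞 F) F
      rw [map_mul, map_one, ha, ← hb, Algebra.smul_def, mul_comm]
    refine ⟨Additive.ofMul ⟨a, b, hab, by rw [mul_comm, hab]⟩, coordV_ext fun σ => ?_⟩
    rw [h2, coordV_unitV, ← ha]
    rfl
  · rintro ⟨u, rfl⟩
    refine ⟨Units.map (algebraMap (𝓞 F) F).toMonoidHom (Additive.toMul u : (𝓞 F)ˣ), ?_⟩
    refine Prod.ext ?_ (Units.ext rfl)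
    change toPrincipalIdeal (𝓞 F) F _ = 1
    rw [toPrincipalIdeal_eq_iff, Units.val_one]
    set v : (𝓞 F)ˣ := Additive.toMul u
    refine le_antisymm ?_ ?_
    · rw [FractionalIdeal.spanSingleton_le_iff_mem, FractionalIdeal.mem_one_iff]
      exact ⟨v, rfl⟩
    · rw [← FractionalIdeal.spanSingleton_one, FractionalIdeal.spanSingleton_le_iff_mem,
        FractionalIdeal.mem_spanSingleton]
      refine ⟨((v⁻¹ : (𝓞 F)ˣ) : 𝓞 F), ?_⟩
      rw [Algebra.smul_def]
      change algebraMap (𝓞 F) F _ * algebraMap (𝓞 F) F (v : 𝓞 F) = 1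
      rw [← map_mul, Units.inv_mul, map_one]

theorem iotaV_unitV (u : Additive (𝓞 F)ˣ) : iotaV F (unitV u) = 0 := iotaV_eq_zero_iff.2 ⟨u, rfl⟩

/-- A homomorphism on the oriented Arakelov class group is continuous as soon as it is so on the
elements of norm one. -/
theorem continuous_of_comp_iotaV (Φ : Additive (PicTilde F) →+ RmodZ)
    (h : Continuous fun x => Φ (iotaV F x)) : Continuous Φ := by
  have := idealGroup_discrete (F := F)
  let q : picDom F → Additive (PicTilde F) := fun x => Additive.ofMul (PicTilde.mk F x)
  have hq : Topology.IsQuotientMap q :=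
    (Homeomorph.isQuotientMap (Homeomorph.refl _)).comp
      (QuotientGroup.isQuotientMap_mk (N := principalSub F))
  rw [hq.continuous_iff]
  let Ψ : picDom F →* Multiplicative RmodZ :=
    (AddMonoidHom.toMultiplicativeRight Φ).comp (QuotientGroup.mk' (principalSub F))
  suffices hΨ : Continuous Ψ from continuous_toAdd.comp hΨ
  refine continuous_of_continuousAt_one Ψ ?_
  rw [← map_one (toDom (F := F)), ← isOpenEmbedding_toDom.continuousAt_iff]
  exact (continuous_ofAdd.comp (h.comp continuous_ofMul)).continuousAt

/-- The homomorphism underlying a character. -/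
def arHom : ArTilde F →+ (Additive (PicTilde F) →+ RmodZ) where
  toFun φ := ContinuousAddMonoidHom.toAddMonoidHom φ
  map_zero' := rfl
  map_add' _ _ := rfl

/-- A character from a homomorphism continuous on elements of norm one. -/
def arOfHom (Φ : Additive (PicTilde F) →+ RmodZ) (h : Continuous fun x => Φ (iotaV F x)) :
    ArTilde F :=
  (⟨Φ, continuous_of_comp_iotaV Φ h⟩ : ContinuousAddMonoidHom (Additive (PicTilde F)) RmodZ)

@[simp] theorem arHom_arOfHom (Φ : Additive (PicTilde F) →+ RmodZ) (h) :
    arHom (arOfHom Φ h) = Φ := rfl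

theorem arHom_injective : Function.Injective (arHom (F := F)) := fun _ _ h =>
  ContinuousAddMonoidHom.ext fun z => DFunLike.congr_fun h z

theorem continuous_arHom (φ : ArTilde F) : Continuous fun x => arHom φ (iotaV F x) :=
  (ContinuousAddMonoidHom.continuous_toFun φ).comp continuous_iotaV

theorem exists_extension_of_divisible {A B D : Type} [AddCommGroup A] [AddCommGroup B]
    [AddCommGroup D] [DivisibleBy D ℤ] (f : A →+ B) (hf : Function.Injective f) (g : A →+ D) :
    ∃ h : B →+ D, ∀ a, h (f a) = g a := by
  obtain ⟨h, hh⟩ := (Module.Baer.of_divisible D).extension_property_addMonoidHom f hf g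
  exact ⟨h, fun a => DFunLike.congr_fun hh a⟩

/-- Characters of the elements of norm one trivial on units extend. -/
theorem exists_arTilde (ψ : Additive (Vone F) →+ RmodZ) (hc : Continuous ψ)
    (hu : ∀ u, ψ (unitV u) = 0) : ∃ φ : ArTilde F, ∀ x, arHom φ (iotaV F x) = ψ x := by
  have hker : (iotaV F).ker ≤ ψ.ker := fun x hx => by
    obtain ⟨u, rfl⟩ := iotaV_eq_zero_iff.1 hx
    exact hu u
  let f : (Additive (Vone F) ⧸ (iotaV F).ker) →+ Additive (PicTilde F) :=
    QuotientAddGroup.kerLift (iotaV F)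
  let χ : (Additive (Vone F) ⧸ (iotaV F).ker) →+ RmodZ := QuotientAddGroup.lift _ ψ hker
  have hf : Function.Injective f := QuotientAddGroup.kerLift_injective _
  obtain ⟨Φ, hΦ⟩ := exists_extension_of_divisible (A := Additive (Vone F) ⧸ (iotaV F).ker) (D := RmodZ) f hf χ
  have h1 : ∀ x, Φ (iotaV F x) = ψ x := fun x =>
    hΦ (QuotientAddGroup.mk x)
  exact ⟨arOfHom Φ (by simpa only [h1] using hc), h1⟩

variable (F) in
/-- The map from the oriented Arakelov class group to the class group. -/
def clsMap : Additive (PicTilde F) →+ Additive (ClassGroup (𝓞 F)) :=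
  MonoidHom.toAdditive (QuotientGroup.lift (principalSub F)
    (((ClassGroup.mk F).comp (MonoidHom.fst _ _)).comp (picDom F).subtype) (by
      rintro x ⟨α, hα⟩
      have h1 : toPrincipalIdeal (𝓞 F) F α = (x : IdealGroup F × (FReal F)ˣ).1 :=
        congrArg Prod.fst hα
      change ClassGroup.mk F (x : IdealGroup F × (FReal F)ˣ).1 = 1
      apply (ClassGroup.equiv F).injective
      rw [map_one, ClassGroup.equiv_mk, ← h1, QuotientGroup.mk'_apply, QuotientGroup.eq_one_iff]
      exact ⟨α, Units.ext (by simp)⟩))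

theorem clsMap_mk (x : picDom F) : clsMap F (Additive.ofMul (PicTilde.mk F x)) =
    Additive.ofMul (ClassGroup.mk F (x : IdealGroup F × (FReal F)ˣ).1) := rfl

theorem clsMap_iotaV (x : Additive (Vone F)) : clsMap F (iotaV F x) = 0 :=
  map_one (ClassGroup.mk F)

theorem exists_iotaV_eq {z : Additive (PicTilde F)} (hz : clsMap F z = 0) :
    ∃ x, iotaV F x = z := by
  obtain ⟨y, rfl⟩ : ∃ y : picDom F, Additive.ofMul (PicTilde.mk F y) = z :=
    QuotientGroup.mk_surjective (s := principalSub F) (Additive.toMul z)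
  have h1 : ClassGroup.mk F (y : IdealGroup F × (FReal F)ˣ).1 = 1 := hz
  have h2 := congrArg (ClassGroup.equiv F) h1
  rw [map_one, ClassGroup.equiv_mk, QuotientGroup.mk'_apply, QuotientGroup.eq_one_iff] at h2
  obtain ⟨α, hα⟩ := h2
  have hα' : toPrincipalIdeal (𝓞 F) F α = (y : IdealGroup F × (FReal F)ˣ).1 := by
    rw [hα]
    exact Units.ext (by simp)
  let p : picDom F := ⟨principalHom F α, principalHom_mem α⟩
  have hy := mem_picDom.1 (p⁻¹ * y).2
  have h3 : ((p⁻¹ * y : picDom F) : IdealGroup F × (FReal F)ˣ).1 = 1 := by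
    change (toPrincipalIdeal (𝓞 F) F α)⁻¹ * _ = 1
    rw [hα', inv_mul_cancel]
  rw [h3, map_one] at hy
  refine ⟨Additive.ofMul (⟨_, hy.symm⟩ : Vone F), ?_⟩
  refine congrArg Additive.ofMul (QuotientGroup.eq (s := principalSub F).2 ?_)
  refine ⟨α, ?_⟩
  have h4 : toDom (⟨_, hy.symm⟩ : Vone F) = p⁻¹ * y := Subtype.ext (Prod.ext h3.symm rfl)
  refine (congrArg Subtype.val (?_ : p = (toDom (⟨_, hy.symm⟩ : Vone F))⁻¹ * y))
  rw [h4]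
  rw [mul_inv_rev, inv_inv, mul_comm y⁻¹, inv_mul_cancel_right]

theorem clsMap_surjective : Function.Surjective (clsMap F) := by
  intro c
  have : ∀ c : ClassGroup (𝓞 F), ∃ z, clsMap F z = Additive.ofMul c := by
    refine ClassGroup.induction F fun I => ?_
    set N : ℝ := (FractionalIdeal.absNorm (I : FractionalIdeal (𝓞 F)⁰ F) : ℝ) with hN
    have hN0 : 0 < N := by
      rw [hN]
      refine Rat.cast_pos.2 (lt_of_le_of_ne (FractionalIdeal.absNorm_nonneg _) (Ne.symm ?_))
      rw [Ne, FractionalIdeal.absNorm_eq_zero_iff]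
      exact I.ne_zero
    have hn : (Module.finrank ℚ F : ℝ) ≠ 0 := by
      exact_mod_cast Module.finrank_pos.ne'
    set r : ℝ := N ^ ((Module.finrank ℚ F : ℝ)⁻¹) with hr
    have hr0 : 0 < r := Real.rpow_pos_of_pos hN0 _
    obtain ⟨b, hb⟩ := exists_unit_coord_eq (F := F) (fun _ => (r : ℂ))
      (fun _ => by exact_mod_cast hr0.ne') (fun _ => (Complex.conj_ofReal r).symm)
    refine ⟨Additive.ofMul (PicTilde.mk F ⟨(I, b), mem_picDom.2 (Units.ext ?_)⟩), rfl⟩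
    rw [coe_absNormFR, coe_idealNormHom]
    simp_rw [hb]
    rw [Finset.prod_const, Finset.card_univ, Embeddings.card, Complex.norm_real,
      Real.norm_of_nonneg hr0.le, hr, ← Real.rpow_natCast, ← Real.rpow_mul hN0.le,
      inv_mul_cancel₀ hn, Real.rpow_one]
  exact this (Additive.toMul c)

end PicTildeStructure

end OArakelov

namespace OArakelov

noncomputable section Equivariance

open scoped Classical MonoidAlgebra

local notation:73 g:74 "⋆" m:73 => (MonoidAlgebra.single g (1 : ℤ)) • m

variable {K F : Type} [Field K] [CharZero K] [Field F] [NumberField F] [Algebra K F]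

omit [CharZero K] in
theorem exists_galV (τ : F ≃ₐ[K] F) (x : Additive (Vone F)) : ∃ y : Additive (Vone F),
    ∀ σ, coordV σ y = coordV (σ.comp (τ : F →+* F)) x := by
  refine exists_coordV_eq _ ?_ fun σ => ?_
  · rw [← prod_norm_coordV x]
    refine Fintype.prod_bijective (fun σ : F →+* ℂ => σ.comp (τ : F →+* F)) ?_ _ _ fun σ => rfl
    refine (Finite.injective_iff_bijective).1 fun σ σ' h => ?_
    ext a
    simpa using DFunLike.congr_fun h (τ.symm a)
  · rw [← coordV_conjugate]
    rfl

/-- The Galois action on elements of norm one. -/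
def galV (τ : F ≃ₐ[K] F) (x : Additive (Vone F)) : Additive (Vone F) := (exists_galV τ x).choose

omit [CharZero K] in
theorem coordV_galV (τ : F ≃ₐ[K] F) (x : Additive (Vone F)) (σ : F →+* ℂ) :
    coordV σ (galV τ x) = coordV (σ.comp (τ : F →+* F)) x := (exists_galV τ x).choose_spec σ

theorem coord_galFReal (τ : F ≃ₐ[K] F) (b : FReal F) (σ : F →+* ℂ) :
    coord σ (galFReal K τ b) = coord (σ.comp (τ : F →+* F)) b := by
  refine TensorProduct.induction_on b ?_ (fun r a => ?_) fun a b ha hb => ?_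
  · rw [map_zero, map_zero, map_zero]
  · rw [coord_tmul]
    exact coord_tmul σ r (τ a)
  · rw [map_add, map_add, map_add, ha, hb]

theorem classGroup_mk_principal (α : Fˣ) :
    ClassGroup.mk F (toPrincipalIdeal (𝓞 F) F α) = 1 := by
  apply (ClassGroup.equiv F).injective
  rw [map_one, ClassGroup.equiv_mk, QuotientGroup.mk'_apply, QuotientGroup.eq_one_iff]
  exact ⟨α, Units.ext (by simp)⟩

/-- The action of Galois on the ring of integers. -/
def galInt (τ : F ≃ₐ[K] F) : 𝓞 F ≃+* 𝓞 F := RingOfIntegers.mapRingEquiv (τ : F ≃+* F)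

omit [CharZero K] [NumberField F] in
theorem coe_galInt (τ : F ≃ₐ[K] F) (a : 𝓞 F) :
    algebraMap (𝓞 F) F (galInt τ a) = τ (algebraMap (𝓞 F) F a) := rfl

omit [CharZero K] [NumberField F] in
theorem image_comap_galInt (τ : F ≃ₐ[K] F) (J : Ideal (𝓞 F)) :
    algebraMap (𝓞 F) F '' (J.comap ((galInt τ).symm : 𝓞 F →+* 𝓞 F) : Set (𝓞 F)) =
      τ '' (algebraMap (𝓞 F) F '' (J : Set (𝓞 F))) := by
  ext x
  constructor
  · rintro ⟨a, ha, rfl⟩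
    refine ⟨_, ⟨_, ha, rfl⟩, ?_⟩
    rw [← coe_galInt]
    exact congrArg _ ((galInt τ).apply_symm_apply a)
  · rintro ⟨_, ⟨a, ha, rfl⟩, rfl⟩
    refine ⟨galInt τ a, ?_, coe_galInt τ a⟩
    change (galInt τ).symm (galInt τ a) ∈ J
    rwa [RingEquiv.symm_apply_apply]

variable {G : Type} [Group G] {iso : G ≃* (F ≃ₐ[K] F)}
  {ρT : G → PicTilde F → PicTilde F}
  (hρT : ∀ (g : G) (x : picDom F), ∃ y : picDom F,
      ((((((y : IdealGroup F × (FReal F)ˣ).1 : FractionalIdeal (𝓞 F)⁰ F) :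
          Submodule (𝓞 F) F) : Set F)) =
        (iso g) '' (((((x : IdealGroup F × (FReal F)ˣ).1 : FractionalIdeal (𝓞 F)⁰ F) :
          Submodule (𝓞 F) F) : Set F))) ∧
      (((y : IdealGroup F × (FReal F)ˣ).2 : FReal F) =
        galFReal K (iso g) ((x : IdealGroup F × (FReal F)ˣ).2 : FReal F)) ∧
      ρT g (PicTilde.mk F x) = PicTilde.mk F y)

include hρT in
theorem act_iotaV (g : G) (x : Additive (Vone F)) :
    Additive.ofMul (ρT g (Additive.toMul (iotaV F x))) = iotaV F (galV (iso g) x) := by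
  obtain ⟨y, hy1, hy2, hy3⟩ := hρT g (toDom (Additive.toMul x : Vone F))
  have h1 : (y : IdealGroup F × (FReal F)ˣ).1 = 1 := by
    refine Units.ext (FractionalIdeal.coeToSubmodule_injective (SetLike.coe_injective ?_))
    rw [hy1]
    change (iso g) '' ((((1 : IdealGroup F) : FractionalIdeal (𝓞 F)⁰ F) : Submodule (𝓞 F) F) :
      Set F) = _
    have h0 : ((((1 : IdealGroup F) : FractionalIdeal (𝓞 F)⁰ F) : Submodule (𝓞 F) F) : Set F) =
        algebraMap (𝓞 F) F '' ((⊤ : Ideal (𝓞 F)) : Set (𝓞 F)) := by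
      ext a
      rw [Units.val_one]
      refine (FractionalIdeal.mem_one_iff _).trans ⟨?_, ?_⟩
      · rintro ⟨b, rfl⟩
        exact ⟨b, trivial, rfl⟩
      · rintro ⟨b, -, rfl⟩
        exact ⟨b, rfl⟩
    rw [h0, ← image_comap_galInt, Ideal.comap_top]
  have h2 : y = toDom (Additive.toMul (galV (iso g) x) : Vone F) := by
    refine Subtype.ext (Prod.ext h1 (Units.ext (coord_ext fun σ => ?_)))
    rw [hy2, coord_galFReal]
    exact (coordV_galV (iso g) x σ).symm
  exact congrArg Additive.ofMul (hy3.trans (by rw [h2]; rfl))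

include hρT in
theorem clsMap_act [Module ℤ[G] (Additive (ClassGroup (𝓞 F)))]
    (hmCl : ∀ (g : G) (I J : (Ideal (𝓞 F))⁰),
      (algebraMap (𝓞 F) F '' ((J : Ideal (𝓞 F)) : Set (𝓞 F)) =
        iso g '' (algebraMap (𝓞 F) F '' ((I : Ideal (𝓞 F)) : Set (𝓞 F)))) →
      g ⋆ Additive.ofMul (ClassGroup.mk0 I) = Additive.ofMul (ClassGroup.mk0 J))
    (g : G) (z : PicTilde F) :
    clsMap F (Additive.ofMul (ρT g z)) = g ⋆ clsMap F (Additive.ofMul z) := by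
  obtain ⟨x, rfl⟩ : ∃ x : picDom F, PicTilde.mk F x = z :=
    QuotientGroup.mk_surjective (s := principalSub F) z
  obtain ⟨y, hy1, -, hy3⟩ := hρT g x
  rw [hy3, clsMap_mk, clsMap_mk]
  obtain ⟨a, J, ha, hJ⟩ := FractionalIdeal.exists_eq_spanSingleton_mul
    ((x : IdealGroup F × (FReal F)ˣ).1 : FractionalIdeal (𝓞 F)⁰ F)
  have haF : algebraMap (𝓞 F) F a ≠ 0 := by
    simpa using ha
  have hJ0 : J ≠ ⊥ := by
    rintro rfl
    rw [FractionalIdeal.coeIdeal_bot, mul_zero] at hJ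
    exact (x : IdealGroup F × (FReal F)ˣ).1.ne_zero hJ
  have hJ' : J.comap ((galInt (iso g)).symm : 𝓞 F →+* 𝓞 F) ≠ ⊥ := by
    obtain ⟨b, hb, hb0⟩ := Submodule.exists_mem_ne_zero_of_ne_bot hJ0
    intro h
    have : galInt (iso g) b ∈ J.comap ((galInt (iso g)).symm : 𝓞 F →+* 𝓞 F) := by
      change (galInt (iso g)).symm (galInt (iso g) b) ∈ J
      rwa [RingEquiv.symm_apply_apply]
    rw [h, Ideal.mem_bot] at this
    exact hb0 ((map_eq_zero_iff _ (galInt (iso g)).injective).1 this)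
  let I0 : (Ideal (𝓞 F))⁰ := ⟨J, mem_nonZeroDivisors_iff_ne_zero.2 hJ0⟩
  let I1 : (Ideal (𝓞 F))⁰ := ⟨_, mem_nonZeroDivisors_iff_ne_zero.2 hJ'⟩
  have hx : (x : IdealGroup F × (FReal F)ˣ).1 =
      toPrincipalIdeal (𝓞 F) F (Units.mk0 _ haF)⁻¹ * FractionalIdeal.mk0 F I0 := by
    refine Units.ext ?_
    rw [hJ, Units.val_mul, coe_toPrincipalIdeal]
    rfl
  have hy : (y : IdealGroup F × (FReal F)ˣ).1 =
      toPrincipalIdeal (𝓞 F) F (Units.mk0 (iso g (algebraMap (𝓞 F) F a))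
        ((map_ne_zero _).2 haF))⁻¹ * FractionalIdeal.mk0 F I1 := by
    refine Units.ext (FractionalIdeal.coeToSubmodule_injective (SetLike.coe_injective ?_))
    rw [hy1, hJ, Units.val_mul, coe_toPrincipalIdeal]
    have h2 := image_comap_galInt (iso g) J
    ext c
    constructor
    · rintro ⟨b, hb, rfl⟩
      obtain ⟨e, he, rfl⟩ := FractionalIdeal.mem_singleton_mul.1 hb
      refine FractionalIdeal.mem_singleton_mul.2 ⟨iso g e, ?_, ?_⟩
      · obtain ⟨f, hf, rfl⟩ := (FractionalIdeal.mem_coeIdeal _).1 he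
        refine (FractionalIdeal.mem_coeIdeal _).2 ?_
        exact h2.symm.le ⟨_, ⟨f, hf, rfl⟩, rfl⟩
      · rw [map_mul, map_inv₀]
        rfl
    · intro hc
      obtain ⟨e, he, rfl⟩ := FractionalIdeal.mem_singleton_mul.1 hc
      obtain ⟨_, ⟨f, hf, rfl⟩, rfl⟩ := h2.le ((FractionalIdeal.mem_coeIdeal _).1 he)
      refine ⟨(algebraMap (𝓞 F) F a)⁻¹ * algebraMap (𝓞 F) F f,
        FractionalIdeal.mem_singleton_mul.2 ⟨_, FractionalIdeal.mem_coeIdeal_of_mem _ hf, rfl⟩, ?_⟩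
      rw [map_mul, map_inv₀]
      rfl
  have h (α : Fˣ) (I : (Ideal (𝓞 F))⁰) : ClassGroup.mk F (toPrincipalIdeal (𝓞 F) F α *
      FractionalIdeal.mk0 F I) = ClassGroup.mk0 I := by
    rw [map_mul, classGroup_mk_principal, one_mul, ClassGroup.mk_mk0]
  rw [hx, hy, h, h]
  exact (hmCl g I0 I1 (image_comap_galInt (iso g) J)).symm

end Equivariance

end OArakelov

namespace OArakelov

noncomputable section CircleCharacters

theorem exists_int_of_coe_eq_zero {x : ℝ} (h : (x : RmodZ) = 0) : ∃ n : ℤ, (n : ℝ) = x := by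
  obtain ⟨n, hn⟩ := (AddCircle.coe_eq_zero_iff (1 : ℝ)).1 h
  exact ⟨n, by simpa using hn⟩

theorem coe_intCast (n : ℤ) : (((n : ℝ)) : RmodZ) = 0 :=
  (AddCircle.coe_eq_zero_iff (1 : ℝ)).2 ⟨n, by simp⟩

/-- A continuous integer-valued real function on a connected space is constant. -/
theorem eq_zero_of_continuous_int {X : Type} [TopologicalSpace X] [PreconnectedSpace X]
    {f : X → ℝ} (hf : Continuous f) (hi : ∀ x, ∃ n : ℤ, (n : ℝ) = f x) {x₀ : X} (h0 : f x₀ = 0)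
    (x : X) : f x = 0 := by
  choose n hn using hi
  have h1 : Continuous n := by
    rw [Int.isClosedEmbedding_coe_real.isInducing.continuous_iff]
    exact hf.congr fun x => (hn x).symm
  have h2 := PreconnectedSpace.constant ‹_› h1 (x := x) (y := x₀)
  rw [← hn, h2, hn, h0]

/-- Characters of the real line lift. -/
theorem exists_lift_real (γ : ℝ →+ RmodZ) (hγ : Continuous γ) :
    ∃ c : ℝ, ∀ t : ℝ, γ t = ((t * c : ℝ) : RmodZ) := by
  obtain ⟨F, ⟨hF0, hF⟩, -⟩ :=
    (AddCircle.isCoveringMap_coe (1 : ℝ)).existsUnique_continuousMap_lifts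
      (⟨γ, hγ⟩ : C(ℝ, RmodZ)) 0 0 (by simp)
  have hF' : ∀ t, ((F t : ℝ) : RmodZ) = γ t := fun t => congrFun hF t
  have hadd : ∀ s t, F (s + t) = F s + F t := fun s t => by
    have h1 : Continuous fun p : ℝ × ℝ => F (p.1 + p.2) - F p.1 - F p.2 := by fun_prop
    have h2 := eq_zero_of_continuous_int h1 (fun p => exists_int_of_coe_eq_zero (by
      rw [AddCircle.coe_sub, AddCircle.coe_sub, hF', hF', hF', map_add, add_sub_cancel_left,
        sub_self])) (x₀ := (0, 0)) (by simp [hF0]) (s, t)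
    simp only at h2
    linarith
  let f : ℝ →+ ℝ := ⟨⟨F, hF0⟩, hadd⟩
  refine ⟨F 1, fun t => ?_⟩
  have h3 := (f.toRealLinearMap F.continuous).map_smul t 1
  rw [smul_eq_mul, mul_one, smul_eq_mul] at h3
  rw [← hF']
  exact congrArg _ h3

theorem eq_zero_of_forall_mul {c : ℝ} (h : ∀ t : ℝ, ((t * c : ℝ) : RmodZ) = 0) : c = 0 := by
  have h1 := eq_zero_of_continuous_int (f := fun t : ℝ => t * c) (by fun_prop)
    (fun t => exists_int_of_coe_eq_zero (h t)) (x₀ := 0) (zero_mul c) 1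
  simpa using h1

/-- The argument of a nonzero complex number in `ℝ/ℤ`. -/
def ang (z : ℂ) : RmodZ :=
  AddCircle.equivAddCircle (2 * Real.pi) 1 Real.two_pi_pos.ne' one_ne_zero
    ((Complex.arg z : ℝ) : AddCircle (2 * Real.pi))

theorem ang_mul {x y : ℂ} (hx : x ≠ 0) (hy : y ≠ 0) : ang (x * y) = ang x + ang y := by
  rw [ang, ang, ang, ← map_add]
  exact congrArg _ (Complex.arg_mul_coe_angle hx hy)

@[simp] theorem ang_one : ang 1 = 0 := by
  rw [ang, Complex.arg_one, AddCircle.coe_zero, map_zero]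

theorem ang_neg_one : ang (-1) = ((1 / 2 : ℝ) : RmodZ) := by
  rw [ang, Complex.arg_neg_one, AddCircle.equivAddCircle_apply_mk]
  congr 1
  field_simp

theorem ang_exp (t : ℝ) : ang (Complex.exp ((2 * Real.pi * t : ℝ) * Complex.I)) = (t : RmodZ) := by
  have h : ((Complex.arg (Complex.exp ((2 * Real.pi * t : ℝ) * Complex.I)) : ℝ) : Real.Angle) =
      ((2 * Real.pi * t : ℝ) : Real.Angle) := by
    rw [Complex.arg_exp_mul_I, Real.Angle.coe_toIocMod]
  rw [ang]
  refine (congrArg _ h).trans ?_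
  refine (AddCircle.equivAddCircle_apply_mk (2 * Real.pi) 1 _ _ _).trans ?_
  congr 1
  field_simp

theorem eq_of_ang_eq_zero {z : ℂ} (hz : ‖z‖ = 1) (h : ang z = 0) : z = 1 := by
  rw [ang, map_eq_zero_iff _ (AddEquiv.injective _)] at h
  obtain ⟨n, hn⟩ := (AddCircle.coe_eq_zero_iff _).1 h
  rw [← Complex.norm_mul_exp_arg_mul_I z, hz, ← hn, Complex.ofReal_one, one_mul,
    Complex.exp_eq_one_iff]
  exact ⟨n, by push_cast; ring⟩

theorem continuous_ang {X : Type} [TopologicalSpace X] {f : X → ℂ} (hf : Continuous f)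
    (h0 : ∀ x, f x ≠ 0) : Continuous fun x => ang (f x) := by
  refine (AddCircle.homeomorphAddCircle (2 * Real.pi) 1 Real.two_pi_pos.ne'
    one_ne_zero).continuous.comp (continuous_iff_continuousAt.2 fun x => ?_)
  exact (Complex.continuousAt_arg_coe_angle (h0 x)).comp hf.continuousAt

/-- Continuous characters of the circle. -/
theorem exists_eq_zsmul_ang (γ : ℝ →+ RmodZ) (hγ : Continuous γ) (h1 : γ 1 = 0) :
    ∃ k : ℤ, ∀ t : ℝ, γ t = k • (t : RmodZ) := by
  obtain ⟨c, hc⟩ := exists_lift_real γ hγ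
  obtain ⟨k, hk⟩ := exists_int_of_coe_eq_zero (x := c) (by rw [← h1, hc, one_mul])
  refine ⟨k, fun t => ?_⟩
  rw [hc, ← hk, ← AddCircle.coe_zsmul, zsmul_eq_mul, mul_comm]

theorem exists_exp_eq {z : ℂ} (hz : ‖z‖ = 1) :
    ∃ t : ℝ, Complex.exp ((2 * Real.pi * t : ℝ) * Complex.I) = z := by
  refine ⟨Complex.arg z / (2 * Real.pi), ?_⟩
  rw [mul_div_cancel₀ _ Real.two_pi_pos.ne']
  conv_rhs => rw [← Complex.norm_mul_exp_arg_mul_I z, hz, Complex.ofReal_one, one_mul]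

theorem eq_zero_or_of_two_nsmul {a : RmodZ} (h : a + a = 0) :
    a = 0 ∨ a = ((1 / 2 : ℝ) : RmodZ) := by
  obtain ⟨x, rfl⟩ := QuotientAddGroup.mk_surjective a
  obtain ⟨n, hn⟩ := exists_int_of_coe_eq_zero (x := x + x) h
  obtain ⟨m, hm | hm⟩ := n.even_or_odd'
  · left
    rw [hm] at hn
    push_cast at hn
    have : x = m := by linarith
    rw [this]
    exact coe_intCast m
  · right
    rw [hm] at hn
    push_cast at hn
    have : x = m + 1 / 2 := by linarith
    rw [this]
    change (((m : ℝ) + 1 / 2 : ℝ) : RmodZ) = _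
    rw [AddCircle.coe_add, coe_intCast, zero_add]

end CircleCharacters

end OArakelov

namespace OArakelov

noncomputable section NormOneCharacters

open scoped Classical
open Units.dirichletUnitTheorem

variable {F : Type} [Field F] [NumberField F]

theorem ang_conj (z : ℂ) : ang (starRingEnd ℂ z) = - ang z := by
  rw [ang, ang, ← map_neg]
  exact congrArg _ (Complex.arg_conj_coe_angle z)

/-- The character of the elements of norm one attached to integers at the complex embeddings. -/
def chi (n : (F →+* ℂ) → ℤ) : Additive (Vone F) →+ RmodZ where
  toFun x := ∑ σ, n σ • ang (coordV σ x)
  map_zero' := by simp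
  map_add' x y := by
    rw [← Finset.sum_add_distrib]
    refine Finset.sum_congr rfl fun σ _ => ?_
    rw [coordV_add, ang_mul (coordV_ne_zero _ _) (coordV_ne_zero _ _), zsmul_add]

theorem chi_apply (n : (F →+* ℂ) → ℤ) (x : Additive (Vone F)) :
    chi n x = ∑ σ, n σ • ang (coordV σ x) := rfl

theorem chi_add (n m : (F →+* ℂ) → ℤ) (x : Additive (Vone F)) :
    chi (n + m) x = chi n x + chi m x := by
  rw [chi_apply, chi_apply, chi_apply, ← Finset.sum_add_distrib]
  exact Finset.sum_congr rfl fun σ _ => add_zsmul _ _ _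

theorem chi_zero (x : Additive (Vone F)) : chi (0 : (F →+* ℂ) → ℤ) x = 0 := by
  rw [chi_apply]
  exact Finset.sum_eq_zero fun σ _ => zero_zsmul _

theorem continuous_chi (n : (F →+* ℂ) → ℤ) : Continuous (chi n) :=
  continuous_finsetSum _ fun σ _ =>
    (continuous_ang (continuous_coordV σ) (coordV_ne_zero σ)).zsmul _

/-- The coordinates supported at one place. -/
def placeCoord (w : InfinitePlace F) (z : ℂ) (σ : F →+* ℂ) : ℂ :=
  if InfinitePlace.mk σ = w then (if σ = w.embedding then z else starRingEnd ℂ z) else 1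

omit [NumberField F] in
theorem embedding_mk_eq_of_ne {σ : F →+* ℂ} (h : σ ≠ (InfinitePlace.mk σ).embedding) :
    (InfinitePlace.mk σ).embedding = ComplexEmbedding.conjugate σ :=
  (InfinitePlace.embedding_mk_eq σ).resolve_left fun h' => h h'.symm

omit [NumberField F] in
theorem placeCoord_self (w : InfinitePlace F) (z : ℂ) : placeCoord w z w.embedding = z := by
  rw [placeCoord, if_pos (InfinitePlace.mk_embedding w), if_pos rfl]

omit [NumberField F] in
theorem conjugate_embedding_of_isReal {w : InfinitePlace F} (hw : w.IsReal) :
    ComplexEmbedding.conjugate w.embedding = w.embedding :=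
  ComplexEmbedding.isReal_iff.1 (InfinitePlace.isReal_iff.1 hw)

omit [NumberField F] in
theorem conjugate_embedding_ne {w : InfinitePlace F} (hw : ¬ w.IsReal) :
    ComplexEmbedding.conjugate w.embedding ≠ w.embedding := fun h =>
  hw (InfinitePlace.isReal_iff.2 (ComplexEmbedding.isReal_iff.2 h))

theorem exists_placeElt (w : InfinitePlace F) (z : ℂ) (hz : ‖z‖ = 1)
    (hr : w.IsReal → starRingEnd ℂ z = z) :
    ∃ x : Additive (Vone F), ∀ σ, coordV σ x = placeCoord w z σ := by
  refine exists_coordV_eq _ (Finset.prod_eq_one fun σ _ => ?_) fun σ => ?_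
  · rw [placeCoord]
    split_ifs
    · exact hz
    · rw [Complex.norm_conj, hz]
    · exact norm_one
  · rw [placeCoord, placeCoord, InfinitePlace.mk_conjugate_eq]
    by_cases h : InfinitePlace.mk σ = w
    · rw [if_pos h, if_pos h]
      subst h
      by_cases hw : (InfinitePlace.mk σ).IsReal
      · simp only [hr hw, ite_self]
      · by_cases h1 : σ = (InfinitePlace.mk σ).embedding
        · rw [if_pos h1, if_neg]
          intro h2
          refine conjugate_embedding_ne hw ?_
          rw [← h1]
          exact h2.trans h1.symm
        · rw [if_neg h1, if_pos (embedding_mk_eq_of_ne h1).symm, Complex.conj_conj]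
    · rw [if_neg h, if_neg h, map_one]

/-- The element of norm one supported at a complex place. -/
theorem exists_circle {w : InfinitePlace F} (hw : ¬ w.IsReal) : ∃ γ : ℝ →+ Additive (Vone F),
    Continuous γ ∧ ∀ t σ, coordV σ (γ t) =
      placeCoord w (Complex.exp ((2 * Real.pi * t : ℝ) * Complex.I)) σ := by
  choose e he using fun t : ℝ => exists_placeElt w
    (Complex.exp ((2 * Real.pi * t : ℝ) * Complex.I)) (Complex.norm_exp_ofReal_mul_I _)
    fun h => absurd h hw
  refine ⟨⟨⟨e, coordV_ext fun σ => ?_⟩, fun s t => coordV_ext fun σ => ?_⟩,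
    continuous_Vone fun σ => ?_, he⟩
  · rw [he, coordV_zero, placeCoord]
    simp
  · change coordV σ (e (s + t)) = coordV σ (e s + e t)
    rw [coordV_add, he, he, he]
    simp only [placeCoord]
    have : Complex.exp ((2 * Real.pi * (s + t) : ℝ) * Complex.I) =
        Complex.exp ((2 * Real.pi * s : ℝ) * Complex.I) *
          Complex.exp ((2 * Real.pi * t : ℝ) * Complex.I) := by
      rw [← Complex.exp_add]
      congr 1
      push_cast
      ring
    rw [this]
    split_ifs
    · rfl
    · rw [map_mul]
    · rw [one_mul]
  · change Continuous fun t => coordV σ (e t)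
    simp only [he, placeCoord]
    split_ifs
    · fun_prop
    · exact Complex.continuous_conj.comp (by fun_prop)
    · exact continuous_const

theorem eq_sum_placeElt {x : Additive (Vone F)} {e : InfinitePlace F → Additive (Vone F)}
    (he : ∀ w σ, coordV σ (e w) = placeCoord w (coordV w.embedding x) σ) : x = ∑ w, e w := by
  refine coordV_ext fun σ => ?_
  have h1 : ∀ s : Finset (InfinitePlace F), coordV σ (∑ w ∈ s, e w) = ∏ w ∈ s, coordV σ (e w) := by
    intro s
    induction s using Finset.induction_on with
    | empty => simp
    | insert a s ha ih => rw [Finset.sum_insert ha, Finset.prod_insert ha, coordV_add, ih]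
  rw [h1, Finset.prod_eq_single (InfinitePlace.mk σ)]
  · rw [he, placeCoord, if_pos rfl]
    split_ifs with h
    · rw [← h]
    · rw [embedding_mk_eq_of_ne h, coordV_conjugate, Complex.conj_conj]
  · intro w _ hw
    rw [he, placeCoord, if_neg hw.symm]
  · exact fun h => absurd (Finset.mem_univ _) h

theorem norm_real_cases {z : ℂ} (hz : ‖z‖ = 1) (hr : starRingEnd ℂ z = z) : z = 1 ∨ z = -1 := by
  obtain ⟨r, rfl⟩ := Complex.conj_eq_iff_real.1 hr
  rw [Complex.norm_real, Real.norm_eq_abs, abs_eq zero_le_one] at hz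
  rcases hz with h | h
  · left
    rw [h, Complex.ofReal_one]
  · right
    rw [h, Complex.ofReal_neg, Complex.ofReal_one]

/-- Characters of the maximal compact part at one place. -/
theorem exists_int_place (ψ : Additive (Vone F) →+ RmodZ) (hψ : Continuous ψ)
    (w : InfinitePlace F) : ∃ k : ℤ, ∀ (z : ℂ) (e : Additive (Vone F)), ‖z‖ = 1 →
      (w.IsReal → starRingEnd ℂ z = z) → (∀ σ, coordV σ e = placeCoord w z σ) →
      ψ e = k • ang z := by
  by_cases hw : w.IsReal
  · obtain ⟨e₀, he₀⟩ := exists_placeElt w (-1) (by simp) (by simp)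
    have h2 : e₀ + e₀ = 0 := coordV_ext fun σ => by
      rw [coordV_add, coordV_zero, he₀, placeCoord]
      split_ifs <;> simp
    have h3 : ψ e₀ + ψ e₀ = 0 := by rw [← map_add, h2, map_zero]
    have h4 : ∃ k : ℤ, ψ e₀ = k • ang (-1) := by
      rcases eq_zero_or_of_two_nsmul h3 with h | h
      · exact ⟨0, by rw [h, zero_zsmul]⟩
      · exact ⟨1, by rw [h, one_zsmul, ang_neg_one]⟩
    obtain ⟨k, hk⟩ := h4
    refine ⟨k, fun z e hz hr he => ?_⟩
    rcases norm_real_cases hz (hr hw) with rfl | rfl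
    · have : e = 0 := coordV_ext fun σ => by
        rw [he, coordV_zero, placeCoord]
        simp
      rw [this, map_zero, ang_one, smul_zero]
    · rw [← hk]
      congr 1
      exact coordV_ext fun σ => by rw [he, he₀]
  · obtain ⟨γ, hγ, hγ'⟩ := exists_circle hw
    obtain ⟨k, hk⟩ := exists_eq_zsmul_ang (ψ.comp γ) (hψ.comp hγ) (by
      have : γ 1 = 0 := coordV_ext fun σ => by
        rw [hγ', coordV_zero, placeCoord]
        simp [Complex.exp_two_pi_mul_I]
      rw [AddMonoidHom.comp_apply, this, map_zero])
    refine ⟨k, fun z e hz _ he => ?_⟩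
    obtain ⟨t, rfl⟩ := exists_exp_eq hz
    rw [ang_exp, ← hk, AddMonoidHom.comp_apply]
    congr 1
    exact coordV_ext fun σ => by rw [he, hγ']

theorem exists_chi_eq (ψ : Additive (Vone F) →+ RmodZ) (hψ : Continuous ψ) :
    ∃ n : (F →+* ℂ) → ℤ, ∀ x, logV F x = 0 → chi n x = ψ x := by
  choose k hk using exists_int_place ψ hψ
  refine ⟨fun σ => if σ = (InfinitePlace.mk σ).embedding then k (InfinitePlace.mk σ) else 0,
    fun x hx => ?_⟩
  rw [logV_eq_zero_iff] at hx
  have hr : ∀ w : InfinitePlace F, w.IsReal →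
      starRingEnd ℂ (coordV w.embedding x) = coordV w.embedding x := fun w hw => by
    rw [← coordV_conjugate, conjugate_embedding_of_isReal hw]
  choose e he using fun w : InfinitePlace F => exists_placeElt w (coordV w.embedding x)
    (hx _) (hr w)
  conv_rhs => rw [eq_sum_placeElt he, map_sum]
  rw [Finset.sum_congr rfl fun w _ => hk w _ (e w) (hx _) (hr w) (he w), chi_apply]
  symm
  refine Finset.sum_of_injOn (fun w => w.embedding)
    (fun w _ v _ h => by rw [← InfinitePlace.mk_embedding w, ← InfinitePlace.mk_embedding v]
                         exact congrArg _ h) (fun _ _ => Finset.mem_coe.2 (Finset.mem_univ _))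
    (fun σ _ hσ => ?_) fun w _ => ?_
  · rw [if_neg, zero_zsmul]
    intro h
    exact hσ ⟨InfinitePlace.mk σ, Finset.mem_coe.2 (Finset.mem_univ _), h.symm⟩
  · rw [InfinitePlace.mk_embedding, if_pos rfl]

theorem chi_eq_zero_iff (n : (F →+* ℂ) → ℤ) : (∀ x, logV F x = 0 → chi n x = 0) ↔
    ∃ m : InfinitePlace F → ℤ, ∀ σ, n σ = (if (InfinitePlace.mk σ).IsReal then 2 else 1) *
      m (InfinitePlace.mk σ) := by
  constructor
  · intro h
    have hnorm : ∀ (w : InfinitePlace F) (z : ℂ) (e : Additive (Vone F)), ‖z‖ = 1 →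
        (∀ σ, coordV σ e = placeCoord w z σ) → logV F e = 0 := fun w z e hz he => by
      rw [logV_eq_zero_iff]
      intro σ
      rw [he, placeCoord]
      split_ifs
      · exact hz
      · rw [Complex.norm_conj, hz]
      · exact norm_one
    suffices h' : ∀ w : InfinitePlace F, ∃ m : ℤ, ∀ σ, InfinitePlace.mk σ = w →
        n σ = (if w.IsReal then 2 else 1) * m by
      choose m hm using h'
      exact ⟨m, fun σ => hm _ σ rfl⟩
    intro w
    by_cases hw : w.IsReal
    · obtain ⟨e, he⟩ := exists_placeElt w (-1) (by simp) (by simp)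
      have h1 := h e (hnorm w _ e (by simp) he)
      rw [chi_apply, Finset.sum_eq_single w.embedding, he, placeCoord_self, ang_neg_one,
        ← AddCircle.coe_zsmul] at h1
      · obtain ⟨m, hm⟩ := exists_int_of_coe_eq_zero h1
        refine ⟨m, fun σ hσ => ?_⟩
        have h2 : σ = w.embedding := by
          subst hσ
          rcases InfinitePlace.embedding_mk_eq σ with h3 | h3
          · exact h3.symm
          · calc σ = ComplexEmbedding.conjugate (ComplexEmbedding.conjugate σ) :=
                  (conjugate_conjugate σ).symm
              _ = (InfinitePlace.mk σ).embedding := by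
                  rw [← h3, conjugate_embedding_of_isReal hw]
        rw [if_pos hw, h2]
        rw [zsmul_eq_mul] at hm
        have : (n w.embedding : ℝ) = 2 * m := by linarith
        exact_mod_cast this
      · intro σ _ hσ
        rw [he, placeCoord, if_neg, ang_one, smul_zero]
        rintro rfl
        refine hσ ?_
        by_contra hne
        have := embedding_mk_eq_of_ne hne
        rw [← conjugate_embedding_of_isReal hw, this, conjugate_conjugate] at hne
        exact hne rfl
      · exact fun h => absurd (Finset.mem_univ _) h
    · obtain ⟨γ, hγ, hγ'⟩ := exists_circle hw
      refine ⟨n w.embedding, fun σ hσ => ?_⟩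
      rw [if_neg hw, one_mul]
      have hne := conjugate_embedding_ne hw
      have h1 : n w.embedding - n (ComplexEmbedding.conjugate w.embedding) = 0 := by
        have h2 : ∀ t : ℝ, ((t * ((n w.embedding -
            n (ComplexEmbedding.conjugate w.embedding) : ℤ) : ℝ) : ℝ) : RmodZ) = 0 := fun t => by
          have h3 := h (γ t) (hnorm w _ _ (Complex.norm_exp_ofReal_mul_I _) (hγ' t))
          rw [chi_apply, ← Finset.sum_subset (Finset.subset_univ
            {w.embedding, ComplexEmbedding.conjugate w.embedding}),
            Finset.sum_pair hne.symm, coordV_conjugate, hγ', placeCoord_self, ang_exp] at h3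
          · rw [ang_conj, ang_exp, smul_neg, ← sub_zsmul,
              ← AddCircle.coe_zsmul, zsmul_eq_mul, mul_comm] at h3
            exact h3
          · intro σ _ hσ
            rw [hγ', placeCoord, if_neg, ang_one, smul_zero]
            rintro rfl
            refine hσ ?_
            rw [Finset.mem_insert, Finset.mem_singleton]
            rcases InfinitePlace.embedding_mk_eq σ with h3 | h3
            · exact Or.inl h3.symm
            · exact Or.inr (by rw [h3, conjugate_conjugate])
        exact_mod_cast eq_zero_of_forall_mul h2
      subst hσ
      rcases InfinitePlace.embedding_mk_eq σ with h3 | h3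
      · rw [h3]
      · rw [sub_eq_zero.1 h1, h3, conjugate_conjugate]
  · rintro ⟨m, hm⟩ x hx
    rw [logV_eq_zero_iff] at hx
    have h1 : ∀ σ : F →+* ℂ, ang (coordV (ComplexEmbedding.conjugate σ) x) = - ang (coordV σ x) :=
      fun σ => by rw [coordV_conjugate, ang_conj]
    have h2 : ∀ σ : F →+* ℂ, (InfinitePlace.mk σ).IsReal → n σ • ang (coordV σ x) = 0 :=
      fun σ hσ => by
        have h3 : ComplexEmbedding.conjugate σ = σ :=
          ComplexEmbedding.isReal_iff.1 (InfinitePlace.isReal_mk_iff.1 hσ)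
        have h4 : ang (coordV σ x) = - ang (coordV σ x) := by rw [← h1, h3]
        rw [hm, if_pos hσ, mul_comm, mul_zsmul, two_zsmul]
        nth_rewrite 1 [h4]
        rw [neg_add_cancel, smul_zero]
    rw [chi_apply]
    refine Finset.sum_involution (fun σ _ => ComplexEmbedding.conjugate σ) (fun σ _ => ?_)
      (fun σ _ h h3 => h (h2 σ ?_)) (fun _ _ => Finset.mem_univ _)
      fun σ _ => conjugate_conjugate σ
    · rw [h1, hm, hm (ComplexEmbedding.conjugate σ), InfinitePlace.mk_conjugate_eq, smul_neg,
        add_neg_cancel]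
    · exact InfinitePlace.isReal_mk_iff.2 (ComplexEmbedding.isReal_iff.2 h3)

end NormOneCharacters

end OArakelov

namespace OArakelov

noncomputable section UnitLattice

open scoped Classical
open Units.dirichletUnitTheorem

variable {F : Type} [Field F] [NumberField F]

theorem hom_units_ext {A : Type} [AddCommGroup A] {f g : Additive (𝓞 F)ˣ →+ A}
    (h1 : ∀ u ∈ Units.torsion F, f (Additive.ofMul u) = g (Additive.ofMul u))
    (h2 : ∀ i, f (Additive.ofMul (Units.fundSystem F i)) = g (Additive.ofMul (Units.fundSystem F i))) :
    f = g := by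
  refine AddMonoidHom.ext fun u => ?_
  obtain ⟨⟨ζ, e⟩, h, -⟩ := Units.exist_unique_eq_mul_prod F (Additive.toMul u)
  have hu : u = Additive.ofMul (ζ : (𝓞 F)ˣ) +
      ∑ i, e i • Additive.ofMul (Units.fundSystem F i) := by
    apply Additive.toMul.injective
    rw [h, toMul_add, toMul_sum]
    rfl
  rw [hu, map_add, map_add, map_sum, map_sum, h1 _ ζ.2]
  congr 1
  exact Finset.sum_congr rfl fun i _ => by rw [map_zsmul, map_zsmul, h2]

theorem exists_linear_fundSystem (c : Fin (Units.rank F) → ℝ) : ∃ L : logSpace F →ₗ[ℝ] ℝ,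
    ∀ i, L (Units.logEmbedding F (Additive.ofMul (Units.fundSystem F i))) = c i := by
  refine ⟨((Units.basisUnitLattice F).ofZLatticeBasis ℝ (Units.unitLattice F)).constr ℝ c,
    fun i => ?_⟩
  rw [Units.logEmbedding_fundSystem, ← Module.Basis.ofZLatticeBasis_apply ℝ (Units.unitLattice F)
    (Units.basisUnitLattice F) i, Module.Basis.constr_basis]

theorem logEmbedding_torsion {u : (𝓞 F)ˣ} (hu : u ∈ Units.torsion F) :
    Units.logEmbedding F (Additive.ofMul u) = 0 :=
  logEmbedding_eq_zero_iff.2 hu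

omit [NumberField F] in
theorem real_hom_torsion (f : Additive (𝓞 F)ˣ →+ ℝ) {u : (𝓞 F)ˣ} (hu : u ∈ Units.torsion F) :
    f (Additive.ofMul u) = 0 := by
  obtain ⟨n, hn, h⟩ := isOfFinOrder_iff_pow_eq_one.1 ((CommGroup.mem_torsion _).1 hu)
  have : n • f (Additive.ofMul u) = 0 := by
    rw [← map_nsmul, ← ofMul_pow, h, ofMul_one, map_zero]
  rwa [smul_eq_zero_iff_right hn.ne'] at this

theorem exists_linear_real (f : Additive (𝓞 F)ˣ →+ ℝ) : ∃ L : logSpace F →ₗ[ℝ] ℝ,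
    ∀ u, L (Units.logEmbedding F u) = f u := by
  obtain ⟨L, hL⟩ := exists_linear_fundSystem fun i => f (Additive.ofMul (Units.fundSystem F i))
  refine ⟨L, fun u => DFunLike.congr_fun (?_ :
    (L.toAddMonoidHom.comp (Units.logEmbedding F) : Additive (𝓞 F)ˣ →+ ℝ) = f) u⟩
  refine hom_units_ext (fun u hu => ?_) hL
  rw [real_hom_torsion f hu, AddMonoidHom.comp_apply, logEmbedding_torsion hu, map_zero]

theorem exists_linear_circle (ψ : Additive (𝓞 F)ˣ →+ RmodZ)
    (hψ : ∀ u ∈ Units.torsion F, ψ (Additive.ofMul u) = 0) : ∃ L : logSpace F →ₗ[ℝ] ℝ,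
    ∀ u, ((L (Units.logEmbedding F u) : ℝ) : RmodZ) = ψ u := by
  choose c hc using fun i => QuotientAddGroup.mk_surjective (ψ (Additive.ofMul (Units.fundSystem F i)))
  obtain ⟨L, hL⟩ := exists_linear_fundSystem c
  refine ⟨L, fun u => DFunLike.congr_fun (?_ : (QuotientAddGroup.mk' _).comp
    (L.toAddMonoidHom.comp (Units.logEmbedding F)) = ψ) u⟩
  refine hom_units_ext (fun u hu => ?_) fun i => ?_
  · rw [hψ u hu, AddMonoidHom.comp_apply, AddMonoidHom.comp_apply, logEmbedding_torsion hu,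
      map_zero, map_zero]
  · rw [← hc]
    exact congrArg _ (hL i)

theorem logSpace_induction {p : logSpace F → Prop} (h0 : p 0) (ha : ∀ x y, p x → p y → p (x + y))
    (hs : ∀ (t : ℝ) u, p (t • Units.logEmbedding F u)) (y : logSpace F) : p y := by
  have hy : y ∈ Submodule.span ℝ (Units.unitLattice F : Set (logSpace F)) := by
    rw [unitLattice_span_eq_top]
    exact Submodule.mem_top
  refine Submodule.closure_induction (p := fun y _ => p y) h0 (fun x y _ _ => ha x y) ?_ hy
  rintro r _ ⟨u, -, rfl⟩
  exact hs r u

theorem exists_zsmul_eq_of_addOrderOf {a b : RmodZ} {w : ℕ} (hw : 0 < w) (ha : addOrderOf a = w)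
    (hb : w • b = 0) : ∃ n : ℤ, n • a = b := by
  obtain ⟨x, hx, hx'⟩ := (AddCircle.addOrderOf_eq_pos_iff hw).1 ha
  obtain ⟨hg, hx'⟩ := hx'
  obtain ⟨y, rfl⟩ := QuotientAddGroup.mk_surjective b
  obtain ⟨k, hk⟩ := exists_int_of_coe_eq_zero (x := w • y) (by rw [AddCircle.coe_nsmul]; exact hb)
  have hw' : (w : ℝ) ≠ 0 := by exact_mod_cast hw.ne'
  have hbez := Nat.gcd_eq_gcd_ab x w
  rw [hg] at hbez
  refine ⟨k * Nat.gcdA x w, ?_⟩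
  rw [← hx', ← AddCircle.coe_zsmul]
  have : (k * Nat.gcdA x w) • ((x : ℝ) / w * 1) = y + ((-(k * Nat.gcdB x w) : ℤ) : ℝ) := by
    have hbez' : (1 : ℝ) = x * Nat.gcdA x w + w * Nat.gcdB x w := by exact_mod_cast hbez
    rw [nsmul_eq_mul] at hk
    have hy : y = k / w := by rw [hk]; field_simp
    rw [hy, zsmul_eq_mul]
    push_cast
    field_simp
    linear_combination (-k : ℝ) * hbez'
  rw [this, AddCircle.coe_add, coe_intCast, add_zero]

theorem exists_zsmul_ang_torsion (σ : F →+* ℂ) (ψ : Additive (𝓞 F)ˣ → RmodZ)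
    (hadd : ∀ u ∈ Units.torsion F, ∀ n : ℕ, ψ (n • Additive.ofMul u) = n • ψ (Additive.ofMul u))
    (h0 : ψ 0 = 0) :
    ∃ n : ℤ, ∀ u ∈ Units.torsion F,
      n • ang (coordV σ (unitV (Additive.ofMul u))) = ψ (Additive.ofMul u) := by
  obtain ⟨ζ, hζ⟩ := IsCyclic.exists_monoid_generator (α := Units.torsion F)
  let ι : Additive (𝓞 F)ˣ →+ RmodZ :=
    ⟨⟨fun u => ang (coordV σ (unitV u)), by rw [map_zero, coordV_zero, ang_one]⟩, fun u v => by
      change ang _ = ang _ + ang _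
      rw [map_add, coordV_add, ang_mul (coordV_ne_zero _ _) (coordV_ne_zero _ _)]⟩
  have hι : ∀ u ∈ Units.torsion F, ι (Additive.ofMul u) = 0 → u = 1 := fun u hu h => by
    have h1 : coordV σ (unitV (Additive.ofMul u)) = 1 := by
      refine eq_of_ang_eq_zero ?_ h
      exact logV_eq_zero_iff.1 (by rw [logV_unitV, logEmbedding_torsion hu]) σ
    rw [coordV_unitV] at h1
    have h2 : ((u : 𝓞 F) : F) = 1 := σ.injective (by rw [map_one]; exact h1)
    exact Units.ext (RingOfIntegers.ext h2)
  have hζ1 : 0 < orderOf ζ := orderOf_pos ζ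
  have ho : addOrderOf (ι (Additive.ofMul (ζ : (𝓞 F)ˣ))) = orderOf ζ := by
    refine Nat.dvd_antisymm ?_ ?_
    · rw [addOrderOf_dvd_iff_nsmul_eq_zero, ← map_nsmul, ← ofMul_pow, ← Subgroup.coe_pow,
        pow_orderOf_eq_one, Subgroup.coe_one, ofMul_one, map_zero]
    · rw [orderOf_dvd_iff_pow_eq_one]
      refine Subtype.ext (hι _ (ζ ^ _).2 ?_)
      rw [Subgroup.coe_pow, ofMul_pow, map_nsmul, addOrderOf_nsmul_eq_zero]
  obtain ⟨n, hn⟩ := exists_zsmul_eq_of_addOrderOf hζ1 ho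
    (b := ψ (Additive.ofMul (ζ : (𝓞 F)ˣ))) (by
      rw [← hadd _ ζ.2, ← ofMul_pow, ← Subgroup.coe_pow,
        pow_orderOf_eq_one, Subgroup.coe_one, ofMul_one, h0])
  refine ⟨n, fun u hu => ?_⟩
  obtain ⟨k, hk⟩ := Submonoid.mem_powers_iff _ _ |>.1 (hζ ⟨u, hu⟩)
  have hk' : u = (ζ : (𝓞 F)ˣ) ^ k := by rw [← Subgroup.coe_pow, hk]
  change n • ι (Additive.ofMul u) = _
  rw [hk', ofMul_pow, map_nsmul, hadd _ ζ.2, ← hn, smul_comm]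

end UnitLattice

end OArakelov

namespace OArakelov

noncomputable section GaloisAction

open scoped Classical
open scoped MonoidAlgebra
open Units.dirichletUnitTheorem

variable {G : Type} [Group G]

local notation:73 g:74 "⋆" m:73 => (MonoidAlgebra.single g (1 : ℤ)) • m

theorem finite_of_exact [Finite G] {L M N : Type} [AddCommGroup L] [AddCommGroup M] [AddCommGroup N]
    [Module ℤ[G] L] [Module ℤ[G] M] [Module ℤ[G] N] [Module.Finite ℤ[G] L] [Module.Finite ℤ[G] N]
    (f : L →ₗ[ℤ[G]] M) (g : M →ₗ[ℤ[G]] N) (h : Function.Exact f g) : Module.Finite ℤ[G] M := by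
  have := isNoetherian_of_range_eq_ker f g h.linearMap_ker_eq.symm
  infer_instance

omit [Group G] in
theorem finite_pontryagin (T : Type) [AddCommGroup T] [Finite T] :
    Finite (GHom G T (Triv G RmodZ)) := by
  have h : Finite {x : RmodZ | Nat.card T • x = 0} :=
    AddCircle.finite_torsion (1 : ℝ) Nat.card_pos
  refine Finite.of_injective (β := T → {x : RmodZ | Nat.card T • x = 0})
    (fun f t => ⟨GHom.untriv G T RmodZ f t, ?_⟩)
    fun f f' hf => GHom.untriv_ext fun t => congrArg Subtype.val (congrFun hf t)
  change Nat.card T • GHom.untriv G T RmodZ f t = 0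
  rw [← map_nsmul, card_nsmul_eq_zero', map_zero]

variable {F : Type} [Field F] [NumberField F]
  {K : Type} [Field K] [Algebra K F]

/-- The complex embeddings with the action of `G`. -/
def Emb (_ : G ≃* (F ≃ₐ[K] F)) : Type := F →+* ℂ

section Embeddings

variable (iso : G ≃* (F ≃ₐ[K] F))

instance : Finite (Emb iso) := inferInstanceAs (Finite (F →+* ℂ))

variable {iso} in
/-- The underlying embedding. -/
def Emb.hom (s : Emb iso) : F →+* ℂ := s

instance : MulAction G (Emb iso) where
  smul g s := s.hom.comp (iso g⁻¹ : F →+* F)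
  one_smul s := RingHom.ext fun x => by
    change s.hom (iso 1⁻¹ x) = s.hom x
    rw [inv_one, map_one, AlgEquiv.one_apply]
  mul_smul g h s := RingHom.ext fun x => by
    change s.hom (iso (g * h)⁻¹ x) = s.hom (iso h⁻¹ (iso g⁻¹ x))
    rw [mul_inv_rev, map_mul, AlgEquiv.mul_apply]

variable {iso}

omit [NumberField F] in
theorem Emb.hom_smul (g : G) (s : Emb iso) : (g • s).hom = s.hom.comp (iso g⁻¹ : F →+* F) := rfl

omit [NumberField F] in
theorem Emb.eq_one_of_smul_eq {g : G} {s : Emb iso} (h : g • s = s) : g = 1 := by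
  have h1 : iso g⁻¹ = 1 := AlgEquiv.ext fun x => s.hom.injective (RingHom.congr_fun h x)
  rwa [map_eq_one_iff _ iso.injective, inv_eq_one] at h1

variable (iso) in
theorem Emb.card [NumberField K] [IsGalois K F] :
    Nat.card (Emb iso) = Module.finrank ℚ K * Nat.card G := by
  rw [Nat.card_congr iso.toEquiv, IsGalois.card_aut_eq_finrank, Module.finrank_mul_finrank]
  change Nat.card (F →+* ℂ) = _
  rw [Nat.card_eq_fintype_card, Embeddings.card]

/-- The character attached to an integral function on the embeddings. -/
def chiE (n : Fn G (Emb iso) (Triv G ℤ)) : Additive (Vone F) →+ RmodZ :=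
  chi (F := F) (Fn.untriv G (Emb iso) ℤ n)

theorem chiE_add (n m : Fn G (Emb iso) (Triv G ℤ)) (x : Additive (Vone F)) :
    chiE (n + m) x = chiE n x + chiE m x := by
  rw [chiE, map_add]
  exact chi_add _ _ x

theorem chiE_zero (x : Additive (Vone F)) : chiE (0 : Fn G (Emb iso) (Triv G ℤ)) x = 0 := by
  rw [chiE, map_zero]
  exact chi_zero x

theorem chiE_act (g : G) (n : Fn G (Emb iso) (Triv G ℤ)) (x : Additive (Vone F)) :
    chiE (g ⋆ n) x = chiE n (galV (iso g⁻¹) x) := by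
  let e : (F →+* ℂ) ≃ (F →+* ℂ) := MulAction.toPerm (α := G) (β := Emb iso) g
  refine (chi_apply _ x).trans (Eq.trans ?_ (chi_apply _ _).symm)
  refine (Fintype.sum_equiv e _ _ fun σ => ?_).symm
  rw [coordV_galV]
  congr 1
  refine Eq.trans ?_ (Fn.untriv_act g n (e σ)).symm
  exact congrArg (Fn.untriv G (Emb iso) ℤ n) (inv_smul_smul (α := Emb iso) g σ).symm

theorem logV_galV {x : Additive (Vone F)} (hx : logV F x = 0) (τ : F ≃ₐ[K] F) :
    logV F (galV τ x) = 0 := by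
  rw [logV_eq_zero_iff] at hx ⊢
  exact fun σ => by rw [coordV_galV, hx]

theorem coordV_expV_smul (t : ℝ) (u : Additive (𝓞 F)ˣ) (σ : F →+* ℂ) :
    coordV σ (expV F (t • Units.logEmbedding F u)) =
      (Real.exp (t * Real.log ‖σ (((Additive.toMul u : (𝓞 F)ˣ) : 𝓞 F) : F)‖) : ℂ) := by
  rw [coordV_expV, map_smul, ← logV_unitV, logExt_logV, Pi.smul_apply, smul_eq_mul,
    norm_coordV_embedding_mk, coordV_unitV]

end Embeddings

section UnitAction

variable {iso : G ≃* (F ≃ₐ[K] F)} [Module ℤ[G] (Additive (𝓞 F)ˣ)]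
  (hmU : ∀ (g : G) (u v : (𝓞 F)ˣ), ((v : 𝓞 F) : F) = iso g ((u : 𝓞 F) : F) →
    g ⋆ Additive.ofMul u = Additive.ofMul v)

include hmU

omit [NumberField F] in
theorem coe_act_unit (g : G) (u : Additive (𝓞 F)ˣ) :
    (((Additive.toMul (g ⋆ u) : (𝓞 F)ˣ) : 𝓞 F) : F) =
      iso g (((Additive.toMul u : (𝓞 F)ˣ) : 𝓞 F) : F) := by
  have h := hmU g (Additive.toMul u) (galUnit (iso g) (Additive.toMul u)) (coe_galUnit _ _)
  rw [ofMul_toMul] at h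
  rw [h, toMul_ofMul, coe_galUnit]

theorem galV_unitV (g : G) (u : Additive (𝓞 F)ˣ) : galV (iso g) (unitV u) = unitV (g ⋆ u) :=
  coordV_ext fun σ => by
    rw [coordV_galV, coordV_unitV, coordV_unitV, coe_act_unit hmU]
    rfl

theorem galV_expV (g : G) (t : ℝ) (u : Additive (𝓞 F)ˣ) :
    galV (iso g) (expV F (t • Units.logEmbedding F u)) =
      expV F (t • Units.logEmbedding F (g ⋆ u)) :=
  coordV_ext fun σ => by
    rw [coordV_galV, coordV_expV_smul, coordV_expV_smul, coe_act_unit hmU]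
    rfl

omit hmU in
omit [NumberField F] in
theorem act_mem_torsion (g : G) {u : Additive (𝓞 F)ˣ}
    (hu : u ∈ Subgroup.toAddSubgroup (Units.torsion F)) :
    g ⋆ u ∈ Subgroup.toAddSubgroup (Units.torsion F) := by
  have hu' : (Additive.toMul u : (𝓞 F)ˣ) ∈ Units.torsion F := hu
  obtain ⟨n, hn, h⟩ := isOfFinOrder_iff_pow_eq_one.1 ((CommGroup.mem_torsion _).1 hu')
  have h1 : n • u = 0 := congrArg Additive.ofMul h
  have h2 : n • (g ⋆ u) = 0 := by rw [smul_comm, h1, smul_zero]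
  have h3 : (Additive.toMul (g ⋆ u) : (𝓞 F)ˣ) ∈ Units.torsion F :=
    (CommGroup.mem_torsion _).2 (isOfFinOrder_iff_pow_eq_one.2
      ⟨n, hn, congrArg Additive.toMul h2⟩)
  exact h3

omit hmU in
variable (G F) in
/-- The roots of unity. -/
def rootsU : Submodule ℤ[G] (Additive (𝓞 F)ˣ) :=
  submoduleOfStable (Subgroup.toAddSubgroup (Units.torsion F)) fun g _ => act_mem_torsion g

omit hmU in
instance : Finite (rootsU G F) := inferInstanceAs (Finite (Units.torsion F))

omit hmU in
instance : Module.IsTorsionFree ℤ (Additive (𝓞 F)ˣ ⧸ rootsU G F) where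
  isSMulRegular n hn := by
    refine (injective_iff_map_eq_zero
      (DistribSMul.toAddMonoidHom (Additive (𝓞 F)ˣ ⧸ rootsU G F) n)).2 fun x hx => ?_
    obtain ⟨u, rfl⟩ := Submodule.Quotient.mk_surjective _ x
    have hn0 : n ≠ 0 := hn.ne_zero
    have hx' : n • u ∈ rootsU G F := (Submodule.Quotient.mk_eq_zero _).1 hx
    rw [Submodule.Quotient.mk_eq_zero]
    obtain ⟨k, hk, h⟩ := isOfFinOrder_iff_pow_eq_one.1
      ((CommGroup.mem_torsion (Additive.toMul (n • u) : (𝓞 F)ˣ)).1 hx')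
    have h3 : (Additive.toMul u : (𝓞 F)ˣ) ∈ Units.torsion F :=
      (CommGroup.mem_torsion _).2 (isOfFinOrder_iff_zpow_eq_one.2
        ⟨n * k, mul_ne_zero hn0 (by exact_mod_cast hk.ne'), by
          rw [zpow_mul, zpow_natCast]; exact h⟩)
    exact h3

end UnitAction

end GaloisAction

end OArakelov

namespace OArakelov

noncomputable section CharacterModules

open scoped Classical
open scoped MonoidAlgebra

local notation:73 g:74 "⋆" m:73 => (MonoidAlgebra.single g (1 : ℤ)) • m

variable {G : Type} [Group G] {F : Type} [Field F] [NumberField F]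
  {K : Type} [Field K] [Algebra K F] (iso : G ≃* (F ≃ₐ[K] F))

/-- The integral functions on embeddings defining trivial characters, parametrized by integral
functions on the places. -/
def placeToEmb : Fn G (Plc iso) (Triv G ℤ) →ₗ[ℤ[G]] Fn G (Emb iso) (Triv G ℤ) :=
  linOfEquivariant
    { toFun m := (Fn.untriv G (Emb iso) ℤ).symm fun σ =>
        (if (InfinitePlace.mk σ.hom).IsReal then 2 else 1) *
          Fn.untriv G (Plc iso) ℤ m (InfinitePlace.mk σ.hom)
      map_zero' := Fn.untriv_ext fun σ => mul_zero _
      map_add' m m' := Fn.untriv_ext fun σ => mul_add _ _ _ }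
    fun g m => Fn.untriv_ext fun σ => by
      have h : InfinitePlace.mk (g⁻¹ • σ).hom = (iso g)⁻¹ • InfinitePlace.mk σ.hom := by
        rw [InfinitePlace.smul_mk, Emb.hom_smul, inv_inv]
        rfl
      refine Eq.trans ?_ (Fn.untriv_act g _ σ).symm
      change (if (InfinitePlace.mk σ.hom).IsReal then 2 else 1) *
          Fn.untriv G (Plc iso) ℤ (g ⋆ m) (InfinitePlace.mk σ.hom) =
        (if (InfinitePlace.mk (g⁻¹ • σ).hom).IsReal then 2 else 1) *
          Fn.untriv G (Plc iso) ℤ m (InfinitePlace.mk (g⁻¹ • σ).hom)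
      rw [h, InfinitePlace.isReal_smul_iff]
      refine congrArg _ ((Fn.untriv_act g m _).trans
        (congrArg (Fn.untriv G (Plc iso) ℤ m) ?_))
      exact Plc.place_inv_smul g (InfinitePlace.mk σ.hom : InfinitePlace F)

omit [NumberField F] in
theorem placeToEmb_injective : Function.Injective (placeToEmb iso (F := F)) := by
  refine (injective_iff_map_eq_zero _).2 fun m hm => Fn.untriv_ext fun w => ?_
  have h : (if (InfinitePlace.mk w.place.embedding).IsReal then 2 else 1) *
      Fn.untriv G (Plc iso) ℤ m (InfinitePlace.mk w.place.embedding) = 0 :=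
    congrArg (fun n => Fn.untriv G (Emb iso) ℤ n w.place.embedding) hm
  rw [InfinitePlace.mk_embedding] at h
  exact (mul_eq_zero.1 h).resolve_left (by split_ifs <;> norm_num)

theorem chiE_eq_zero_iff (n : Fn G (Emb iso) (Triv G ℤ)) :
    (∀ x : Additive (Vone F), logV F x = 0 → chiE n x = 0) ↔ ∃ m, placeToEmb iso m = n := by
  refine (chi_eq_zero_iff (F := F) (Fn.untriv G (Emb iso) ℤ n)).trans ⟨fun ⟨m, hm⟩ => ?_, ?_⟩
  · exact ⟨(Fn.untriv G (Plc iso) ℤ).symm m, Fn.untriv_ext fun σ => (hm σ).symm⟩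
  · rintro ⟨m, rfl⟩
    exact ⟨Fn.untriv G (Plc iso) ℤ m, fun σ => rfl⟩

section Pairs

variable [Module ℤ[G] (ArTilde F)]
  (hA : ∀ (g : G) (φ : ArTilde F) (x : Additive (Vone F)),
    arHom (g ⋆ φ) (iotaV F x) = arHom φ (iotaV F (galV (iso g⁻¹) x)))

/-- Characters together with an integral description of their restriction to the maximal
compact subgroup. -/
def charPairs : Submodule ℤ[G] (Fn G (Emb iso) (Triv G ℤ) × ArTilde F) :=
  submoduleOfStable
    { carrier := {p | ∀ x, logV F x = 0 → arHom p.2 (iotaV F x) = chiE p.1 x}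
      zero_mem' := fun x _ => by
        rw [Prod.fst_zero, Prod.snd_zero, chiE_zero, map_zero, AddMonoidHom.zero_apply]
      add_mem' := fun {p q} hp hq x hx => by
        rw [Prod.fst_add, Prod.snd_add, chiE_add, map_add, AddMonoidHom.add_apply, hp x hx,
          hq x hx]
      neg_mem' := fun {p} hp x hx => by
        have h : chiE (-p.1) x + chiE p.1 x = 0 := by
          rw [← chiE_add, neg_add_cancel, chiE_zero]
        rw [Prod.fst_neg, Prod.snd_neg, map_neg, AddMonoidHom.neg_apply, hp x hx]
        exact (eq_neg_of_add_eq_zero_left h).symm }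
    fun g p hp x hx => by
      rw [Prod.smul_fst, Prod.smul_snd, chiE_act, hA]
      exact hp _ (logV_galV hx _)

theorem charPairs_snd_surjective (φ : ArTilde F) :
    ∃ n, (n, φ) ∈ charPairs iso hA := by
  obtain ⟨n, hn⟩ := exists_chi_eq ((arHom φ).comp (iotaV F)) (continuous_arHom φ)
  exact ⟨(Fn.untriv G (Emb iso) ℤ).symm n, fun x hx => (hn x hx).symm⟩

/-- The second projection from the pairs. -/
def charPairsSnd : charPairs iso hA →ₗ[ℤ[G]] ArTilde F :=
  (LinearMap.snd _ _ _).comp (charPairs iso hA).subtype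

theorem charPairsSnd_surjective : Function.Surjective (charPairsSnd iso hA) := fun φ =>
  let ⟨n, hn⟩ := charPairs_snd_surjective iso hA φ
  ⟨⟨(n, φ), hn⟩, rfl⟩

theorem cls_charPairs [Module.Finite ℤ[G] (charPairs iso hA)] [Finite G] :
    G0.cls ℤ[G] (charPairs iso hA) =
      G0.cls ℤ[G] (Fn G (Plc iso) (Triv G ℤ)) + G0.cls ℤ[G] (ArTilde F) := by
  refine cls_eq_add (LinearMap.codRestrict (charPairs iso hA)
    ((LinearMap.inl _ _ _).comp (placeToEmb iso)) fun m x hx => ?_) (charPairsSnd iso hA) ?_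
    (charPairsSnd_surjective iso hA) ?_
  · refine Eq.trans ?_ ((chiE_eq_zero_iff iso _).2 ⟨m, rfl⟩ x hx).symm
    exact DFunLike.congr_fun (map_zero arHom) _
  · refine fun m m' h => placeToEmb_injective iso ?_
    exact congrArg (fun p : charPairs iso hA => p.1.1) h
  · rintro ⟨⟨n, φ⟩, hp⟩
    constructor
    · intro h
      have h1 : φ = 0 := h
      subst h1
      obtain ⟨m, hm⟩ := (chiE_eq_zero_iff iso n).1 fun x hx => by
        rw [← hp x hx, map_zero, AddMonoidHom.zero_apply]
      exact ⟨m, Subtype.ext (Prod.ext hm rfl)⟩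
    · rintro ⟨m, hm⟩
      exact (congrArg (fun p : charPairs iso hA => p.1.2) hm).symm

end Pairs

end CharacterModules

end OArakelov

namespace OArakelov

noncomputable section UnitCharacters

open scoped Classical
open scoped MonoidAlgebra

local notation:73 g:74 "⋆" m:73 => (MonoidAlgebra.single g (1 : ℤ)) • m

variable {G : Type} [Group G] {F : Type} [Field F] [NumberField F]
  {K : Type} [Field K] [Algebra K F] {iso : G ≃* (F ≃ₐ[K] F)}
  [Module ℤ[G] (Additive (𝓞 F)ˣ)]
  (hmU : ∀ (g : G) (u v : (𝓞 F)ˣ), ((v : 𝓞 F) : F) = iso g ((u : 𝓞 F) : F) →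
    g ⋆ Additive.ofMul u = Additive.ofMul v)

/-- Restriction of characters to the roots of unity. -/
def resRoots : Fn G (Emb iso) (Triv G ℤ) →ₗ[ℤ[G]] GHom G (rootsU G F) (Triv G RmodZ) :=
  linOfEquivariant
    { toFun n := (GHom.untriv G (rootsU G F) RmodZ).symm
        (((chiE n).comp unitV).comp (rootsU G F).toAddSubgroup.subtype)
      map_zero' := GHom.untriv_ext fun _ => chiE_zero _
      map_add' n n' := GHom.untriv_ext fun _ => chiE_add n n' _ }
    fun g n => GHom.untriv_ext fun u => by
      refine Eq.trans ?_ (GHom.untriv_act RmodZ g _ u).symm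
      refine (chiE_act g n _).trans ?_
      exact congrArg _ (galV_unitV hmU g⁻¹ u.1)

theorem resRoots_apply (n : Fn G (Emb iso) (Triv G ℤ)) (u : rootsU G F) :
    GHom.untriv G (rootsU G F) RmodZ (resRoots hmU n) u = chiE n (unitV (u : Additive (𝓞 F)ˣ)) :=
  rfl

theorem mem_ker_resRoots (n : Fn G (Emb iso) (Triv G ℤ)) :
    n ∈ LinearMap.ker (resRoots hmU) ↔ ∀ u ∈ Units.torsion F, chiE n (unitV (.ofMul u)) = 0 := by
  rw [LinearMap.mem_ker]
  constructor
  · intro h u hu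
    rw [← resRoots_apply hmU n ⟨Additive.ofMul u, hu⟩, h]
    rfl
  · exact fun h => GHom.untriv_ext fun u => h _ u.2

theorem resRoots_surjective : Function.Surjective (resRoots hmU) := by
  intro f
  let σ : F →+* ℂ := Classical.arbitrary _
  let f' := GHom.untriv G (rootsU G F) RmodZ f
  let ψ : Additive (𝓞 F)ˣ → RmodZ := fun u => if hu : u ∈ rootsU G F then f' ⟨u, hu⟩ else 0
  have hψ : ∀ u (hu : u ∈ rootsU G F), ψ u = f' ⟨u, hu⟩ := fun u hu => dif_pos hu
  obtain ⟨n, hn⟩ := exists_zsmul_ang_torsion σ ψ (fun u hu n => by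
    have hu' : Additive.ofMul u ∈ rootsU G F := hu
    rw [hψ _ hu', hψ _ (nsmul_mem hu' n)]
    exact map_nsmul f' n ⟨Additive.ofMul u, hu'⟩) (by
    rw [hψ _ (zero_mem _)]
    exact map_zero f')
  refine ⟨(Fn.untriv G (Emb iso) ℤ).symm (Pi.single (M := fun _ => ℤ) (σ : Emb iso) n),
    GHom.untriv_ext fun u => ?_⟩
  refine Eq.trans ?_ ((hn u.1 u.2).trans (hψ _ u.2))
  refine (chi_apply (Pi.single (M := fun _ => ℤ) σ n) _).trans ?_
  rw [Finset.sum_eq_single σ]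
  · rw [Pi.single_eq_same]
    rfl
  · intro τ _ hτ
    rw [Pi.single_eq_of_ne hτ, zero_smul]
  · exact fun h => absurd (Finset.mem_univ _) h

theorem cls_emb_eq [Finite G] :
    G0.cls ℤ[G] (Fn G (Emb iso) (Triv G ℤ)) = G0.cls ℤ[G] (LinearMap.ker (resRoots hmU)) +
      G0.cls ℤ[G] (GHom G (rootsU G F) (Triv G RmodZ)) :=
  cls_eq_add (LinearMap.ker (resRoots hmU)).subtype (resRoots hmU)
    (Submodule.subtype_injective _) (resRoots_surjective hmU) (LinearMap.exact_subtype_ker_map _)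

section Pairs

variable [Module ℤ[G] (ArTilde F)]
  (hA : ∀ (g : G) (φ : ArTilde F) (x : Additive (Vone F)),
    arHom (g ⋆ φ) (iotaV F x) = arHom φ (iotaV F (galV (iso g⁻¹) x)))

/-- Characters trivial on the maximal compact subgroup, together with the homomorphism on
units describing them. -/
def unitPairs : Submodule ℤ[G] (IntDual G (Additive (𝓞 F)ˣ) × ArTilde F) :=
  submoduleOfStable
    { carrier := {p | (∀ x, logV F x = 0 → arHom p.2 (iotaV F x) = 0) ∧
        ∀ (t : ℝ) (u : Additive (𝓞 F)ˣ),
          arHom p.2 (iotaV F (expV F (t • Units.logEmbedding F u))) =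
            ((t * (GHom.untriv G _ ℤ p.1 u : ℤ) : ℝ) : RmodZ)}
      zero_mem' := ⟨fun x _ => by rw [Prod.snd_zero, map_zero, AddMonoidHom.zero_apply],
        fun t u => by
          rw [Prod.snd_zero, map_zero, AddMonoidHom.zero_apply, Prod.fst_zero, map_zero,
            AddMonoidHom.zero_apply, Int.cast_zero, mul_zero, AddCircle.coe_zero]⟩
      add_mem' := fun {p q} hp hq => ⟨fun x hx => by
          rw [Prod.snd_add, map_add, AddMonoidHom.add_apply, hp.1 x hx, hq.1 x hx, add_zero],
        fun t u => by
          rw [Prod.snd_add, map_add, AddMonoidHom.add_apply, hp.2, hq.2, Prod.fst_add, map_add,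
            AddMonoidHom.add_apply, Int.cast_add, mul_add, AddCircle.coe_add]⟩
      neg_mem' := fun {p} hp => ⟨fun x hx => by
          rw [Prod.snd_neg, map_neg, AddMonoidHom.neg_apply, hp.1 x hx, neg_zero],
        fun t u => by
          rw [Prod.snd_neg, map_neg, AddMonoidHom.neg_apply, hp.2, Prod.fst_neg, map_neg,
            AddMonoidHom.neg_apply, Int.cast_neg, mul_neg, AddCircle.coe_neg]⟩ }
    fun g p hp => ⟨fun x hx => by
        rw [Prod.smul_snd, hA]
        exact hp.1 _ (logV_galV hx _),
      fun t u => by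
        rw [Prod.smul_snd, hA, galV_expV hmU, hp.2, Prod.smul_fst, GHom.untriv_act]⟩

/-- The inclusion of `unitPairs` in `charPairs`. -/
def unitPairsToCharPairs : unitPairs hmU hA →ₗ[ℤ[G]] charPairs iso hA :=
  LinearMap.codRestrict (charPairs iso hA)
    ((LinearMap.inr _ _ _).comp ((LinearMap.snd _ _ _).comp (unitPairs hmU hA).subtype))
    fun p x hx => (p.2.1 x hx).trans (chiE_zero x).symm

theorem unitPairsToCharPairs_injective : Function.Injective (unitPairsToCharPairs hmU hA) := by
  refine (injective_iff_map_eq_zero _).2 ?_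
  rintro ⟨⟨f, φ⟩, hp⟩ h
  have h1 : φ = 0 := congrArg (fun p : charPairs iso hA => p.1.2) h
  subst h1
  have h2 : f = 0 := GHom.untriv_ext fun u => by
    have h3 : ((GHom.untriv G _ ℤ f u : ℤ) : ℝ) = 0 := eq_zero_of_forall_mul fun t => by
      rw [← hp.2, map_zero, AddMonoidHom.zero_apply]
    rw [map_zero, AddMonoidHom.zero_apply]
    exact_mod_cast h3
  subst h2
  rfl

theorem exists_mem_unitPairs {φ : ArTilde F} (h : ∀ x, logV F x = 0 → arHom φ (iotaV F x) = 0) :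
    ∃ f, (f, φ) ∈ unitPairs hmU hA := by
  have h1 (u : Additive (𝓞 F)ˣ) : ∃ n : ℤ, ∀ t : ℝ,
      arHom φ (iotaV F (expV F (t • Units.logEmbedding F u))) = ((t * n : ℝ) : RmodZ) := by
    obtain ⟨c, hc⟩ := exists_lift_real
      (((arHom φ).comp ((iotaV F).comp (expV F))).comp
        (LinearMap.toSpanSingleton ℝ _ (Units.logEmbedding F u)).toAddMonoidHom)
      ((continuous_arHom φ).comp (continuous_expV.comp (continuous_id.smul continuous_const)))
    have hc' : ∀ t : ℝ, arHom φ (iotaV F (expV F (t • Units.logEmbedding F u))) =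
      ((t * c : ℝ) : RmodZ) := hc
    obtain ⟨n, rfl⟩ := exists_int_of_coe_eq_zero (x := c) <| by
      rw [← one_mul c, ← hc', one_smul,
        ← sub_add_cancel (expV F (Units.logEmbedding F u)) (unitV u), map_add, map_add,
        iotaV_unitV, map_zero, add_zero]
      refine h _ ?_
      rw [map_sub, logV_expV, logV_unitV, sub_self]
    exact ⟨n, hc'⟩
  choose f hf using h1
  have hadd (u v) : f (u + v) = f u + f v := by
    have h2 : ((f (u + v) - (f u + f v) : ℤ) : ℝ) = 0 := eq_zero_of_forall_mul fun t => by
      rw [Int.cast_sub, Int.cast_add, mul_sub, mul_add, AddCircle.coe_sub, AddCircle.coe_add,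
        ← hf, ← hf, ← hf, map_add, smul_add, map_add, map_add, map_add, sub_self]
    exact sub_eq_zero.1 (by exact_mod_cast h2)
  exact ⟨(GHom.untriv G _ ℤ).symm (AddMonoidHom.mk' f hadd), h, fun t u => hf u t⟩

/-- The first projection from `charPairs`. -/
def charPairsFst : charPairs iso hA →ₗ[ℤ[G]] LinearMap.ker (resRoots hmU) :=
  LinearMap.codRestrict _ ((LinearMap.fst _ _ _).comp (charPairs iso hA).subtype) fun p => by
    rw [mem_ker_resRoots]
    intro u hu
    refine (p.2 (unitV (.ofMul u)) ?_).symm.trans ?_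
    · rw [logV_unitV]
      exact Units.dirichletUnitTheorem.logEmbedding_eq_zero_iff.2 hu
    · rw [iotaV_unitV, map_zero]

theorem charPairsFst_surjective : Function.Surjective (charPairsFst hmU hA) := by
  rintro ⟨n, hn⟩
  rw [mem_ker_resRoots] at hn
  obtain ⟨L, hL⟩ := exists_linear_circle (-((chiE n).comp unitV)) fun u hu =>
    neg_eq_zero.2 (hn u hu)
  obtain ⟨φ, hφ⟩ := exists_arTilde
    (chiE n + (QuotientAddGroup.mk' _).comp (L.toAddMonoidHom.comp (logV F)))
    ((continuous_chi _).add ((AddCircle.continuous_mk' 1).comp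
      (L.continuous_of_finiteDimensional.comp continuous_logV)))
    fun u => by
      refine Eq.trans (congrArg (chiE n (unitV u) + ·) ?_) (add_neg_cancel (chiE n (unitV u)))
      refine Eq.trans ?_ (hL u)
      rw [← logV_unitV]
      rfl
  refine ⟨⟨(n, φ), fun x hx => (hφ x).trans ?_⟩, rfl⟩
  refine Eq.trans (congrArg (chiE n x + ·) ?_) (add_zero _)
  change ((L (logV F x) : ℝ) : RmodZ) = 0
  rw [hx, map_zero, AddCircle.coe_zero]

theorem exact_unitPairs :
    Function.Exact (unitPairsToCharPairs hmU hA) (charPairsFst hmU hA) := by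
  rintro ⟨⟨n, φ⟩, hp⟩
  constructor
  · intro h
    have h1 : n = 0 := congrArg Subtype.val h
    subst h1
    obtain ⟨f, hf⟩ := exists_mem_unitPairs hmU hA fun x hx => (hp x hx).trans (chiE_zero x)
    exact ⟨⟨(f, φ), hf⟩, rfl⟩
  · rintro ⟨p, hp'⟩
    refine Subtype.ext ?_
    exact (congrArg (fun p : charPairs iso hA => p.1.1) hp').symm

theorem cls_charPairs_eq [Finite G] [Module.Finite ℤ[G] (charPairs iso hA)] :
    G0.cls ℤ[G] (charPairs iso hA) = G0.cls ℤ[G] (unitPairs hmU hA) +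
      G0.cls ℤ[G] (LinearMap.ker (resRoots hmU)) :=
  cls_eq_add _ _ (unitPairsToCharPairs_injective hmU hA) (charPairsFst_surjective hmU hA)
    (exact_unitPairs hmU hA)

end Pairs

end UnitCharacters

end OArakelov

namespace OArakelov

noncomputable section ClassCharacters

open scoped Classical
open scoped MonoidAlgebra

local notation:73 g:74 "⋆" m:73 => (MonoidAlgebra.single g (1 : ℤ)) • m

variable {G : Type} [Group G] {F : Type} [Field F] [NumberField F]
  {K : Type} [Field K] [Algebra K F] {iso : G ≃* (F ≃ₐ[K] F)}
  [Module ℤ[G] (Additive (𝓞 F)ˣ)] [Module ℤ[G] (Additive (ClassGroup (𝓞 F)))]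
  [Module ℤ[G] (ArTilde F)]
  (hmU : ∀ (g : G) (u v : (𝓞 F)ˣ), ((v : 𝓞 F) : F) = iso g ((u : 𝓞 F) : F) →
    g ⋆ Additive.ofMul u = Additive.ofMul v)
  (hA : ∀ (g : G) (φ : ArTilde F) (x : Additive (Vone F)),
    arHom (g ⋆ φ) (iotaV F x) = arHom φ (iotaV F (galV (iso g⁻¹) x)))
  (hC : ∀ (g : G) (z : Additive (PicTilde F)), ∃ z', (∀ φ, arHom (g ⋆ φ) z = arHom φ z') ∧
    clsMap F z' = g⁻¹ ⋆ clsMap F z)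

theorem arHom_eq_zero_of_expV {φ : ArTilde F} (h : ∀ x, logV F x = 0 → arHom φ (iotaV F x) = 0)
    (h' : ∀ (t : ℝ) u, arHom φ (iotaV F (expV F (t • Units.logEmbedding F u))) = 0)
    (x : Additive (Vone F)) : arHom φ (iotaV F x) = 0 := by
  have h1 (y) : arHom φ (iotaV F (expV F y)) = 0 := by
    refine logSpace_induction (p := fun y => arHom φ (iotaV F (expV F y)) = 0) ?_ ?_ h' y
    · rw [map_zero, map_zero, map_zero]
    · intro y z hy hz
      rw [map_add, map_add, map_add, hy, hz, add_zero]
  rw [← sub_add_cancel x (expV F (logV F x)), map_add, map_add, h1, add_zero]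
  refine h _ ?_
  rw [map_sub, logV_expV, sub_self]

theorem exists_clsMap_eq {φ : ArTilde F} (h : ∀ x, arHom φ (iotaV F x) = 0) :
    ∃ f : Additive (ClassGroup (𝓞 F)) →+ RmodZ, ∀ z, f (clsMap F z) = arHom φ z := by
  refine ⟨(clsMap F).liftOfRightInverse _ (Function.rightInverse_surjInv clsMap_surjective)
    ⟨arHom φ, fun z hz => ?_⟩, fun z => ?_⟩
  · obtain ⟨x, rfl⟩ := exists_iotaV_eq hz
    exact h x
  · exact AddMonoidHom.liftOfRightInverse_comp_apply _ _ _ _ z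

/-- Inflation of characters of the class group. -/
def classChar (f : GHom G (Additive (ClassGroup (𝓞 F))) (Triv G RmodZ)) : ArTilde F :=
  arOfHom ((GHom.untriv G _ RmodZ f).comp (clsMap F)) (by
    simp only [AddMonoidHom.comp_apply, clsMap_iotaV, map_zero]
    exact continuous_const)

omit [Group G] [Module ℤ[G] (Additive (𝓞 F)ˣ)] [Module ℤ[G] (Additive (ClassGroup (𝓞 F)))]
  [Module ℤ[G] (ArTilde F)] in
theorem arHom_classChar (f : GHom G (Additive (ClassGroup (𝓞 F))) (Triv G RmodZ)) (z) :
    arHom (classChar f) z = GHom.untriv G _ RmodZ f (clsMap F z) := rfl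

omit [Module ℤ[G] (Additive (𝓞 F)ˣ)] in
include hC in
theorem classChar_act (g : G) (f : GHom G (Additive (ClassGroup (𝓞 F))) (Triv G RmodZ)) :
    classChar (g ⋆ f) = g ⋆ classChar f := arHom_injective <| AddMonoidHom.ext fun z => by
  obtain ⟨z', h, hz⟩ := hC g z
  rw [h, arHom_classChar, arHom_classChar, GHom.untriv_act, hz]

/-- Inflation of characters of the class group as a map to `unitPairs`. -/
def classPairs : GHom G (Additive (ClassGroup (𝓞 F))) (Triv G RmodZ) →ₗ[ℤ[G]]
    unitPairs hmU hA :=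
  LinearMap.codRestrict (unitPairs hmU hA)
    ((LinearMap.inr _ _ _).comp (linOfEquivariant
      { toFun := classChar
        map_zero' := arHom_injective <| AddMonoidHom.ext fun z => by
          rw [arHom_classChar, map_zero, map_zero]
          rfl
        map_add' f f' := arHom_injective <| AddMonoidHom.ext fun z => by
          rw [arHom_classChar, map_add, map_add]
          rfl } (classChar_act hC)))
    fun f => ⟨fun x _ => by
        refine (arHom_classChar f _).trans ?_
        rw [clsMap_iotaV, map_zero],
      fun t u => by
        refine (arHom_classChar f _).trans ?_
        rw [clsMap_iotaV, map_zero]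
        change _ = ((t * ((0 : ℤ) : ℝ) : ℝ) : RmodZ)
        rw [Int.cast_zero, mul_zero, AddCircle.coe_zero]⟩

/-- The homomorphism on units of an element of `unitPairs`. -/
def unitPairsFst : unitPairs hmU hA →ₗ[ℤ[G]] IntDual G (Additive (𝓞 F)ˣ) :=
  (LinearMap.fst _ _ _).comp (unitPairs hmU hA).subtype

theorem classPairs_injective : Function.Injective (classPairs hmU hA hC) := fun f f' h => by
  refine GHom.untriv_ext fun c => ?_
  obtain ⟨z, rfl⟩ := clsMap_surjective c
  rw [← arHom_classChar, ← arHom_classChar]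
  exact congrArg (fun p : unitPairs hmU hA => arHom p.1.2 z) h

omit [Module ℤ[G] (Additive (ClassGroup (𝓞 F)))] in
theorem unitPairsFst_surjective : Function.Surjective (unitPairsFst hmU hA) := fun f => by
  obtain ⟨L, hL⟩ := exists_linear_real ((Int.castAddHom ℝ).comp (GHom.untriv G _ ℤ f))
  obtain ⟨φ, hφ⟩ := exists_arTilde
    ((QuotientAddGroup.mk' _).comp (L.toAddMonoidHom.comp (logV F)))
    ((AddCircle.continuous_mk' 1).comp (L.continuous_of_finiteDimensional.comp continuous_logV))
    fun u => by
      change ((L (logV F (unitV u)) : ℝ) : RmodZ) = 0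
      rw [logV_unitV, hL]
      exact coe_intCast _
  refine ⟨⟨(f, φ), fun x hx => (hφ x).trans ?_, fun t u => (hφ _).trans ?_⟩, rfl⟩
  · change ((L (logV F x) : ℝ) : RmodZ) = 0
    rw [hx, map_zero, AddCircle.coe_zero]
  · change ((L (logV F (expV F _)) : ℝ) : RmodZ) = _
    rw [logV_expV, map_smul, hL]
    rfl

theorem exact_classPairs : Function.Exact (classPairs hmU hA hC) (unitPairsFst hmU hA) := by
  rintro ⟨⟨f, φ⟩, hp⟩
  constructor
  · intro h
    have h1 : f = 0 := h
    subst h1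
    obtain ⟨c, hc⟩ := exists_clsMap_eq (arHom_eq_zero_of_expV hp.1 fun t u => by
      rw [hp.2, map_zero, AddMonoidHom.zero_apply, Int.cast_zero, mul_zero, AddCircle.coe_zero])
    exact ⟨(GHom.untriv G _ RmodZ).symm c, Subtype.ext (Prod.ext rfl
      (arHom_injective (AddMonoidHom.ext hc)))⟩
  · rintro ⟨c, hc⟩
    exact (congrArg (fun p : unitPairs hmU hA => p.1.1) hc).symm

variable [Finite G]

include hC in
theorem finite_unitPairs : Module.Finite ℤ[G] (unitPairs hmU hA) := by
  have := finite_pontryagin (G := G) (Additive (ClassGroup (𝓞 F)))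
  have : Module.Finite ℤ[G] (Additive (𝓞 F)ˣ) := finite_groupRing
  exact finite_of_exact _ _ (exact_classPairs hmU hA hC)

include hmU hC in
theorem finite_charPairs : Module.Finite ℤ[G] (charPairs iso hA) := by
  have := finite_unitPairs hmU hA hC
  exact finite_of_exact _ _ (exact_unitPairs hmU hA)

include hmU hA hC in
theorem cls_arTilde :
    G0.cls ℤ[G] (ArTilde F) + G0.cls ℤ[G] (Fn G (Plc iso) (Triv G ℤ)) +
        G0.cls ℤ[G] (GHom G (rootsU G F) (Triv G RmodZ)) =
      G0.cls ℤ[G] (GHom G (Additive (ClassGroup (𝓞 F))) (Triv G RmodZ)) +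
        G0.cls ℤ[G] (IntDual G (Additive (𝓞 F)ˣ)) +
        G0.cls ℤ[G] (Fn G (Emb iso) (Triv G ℤ)) := by
  have := finite_unitPairs hmU hA hC
  have := finite_charPairs hmU hA hC
  have h1 := cls_charPairs iso hA
  have h2 := cls_charPairs_eq hmU hA
  have h3 := cls_eq_add _ _ (classPairs_injective hmU hA hC) (unitPairsFst_surjective hmU hA)
    (exact_classPairs hmU hA hC)
  rw [cls_emb_eq hmU, ← h3, add_comm (G0.cls ℤ[G] (ArTilde F)), ← h1, h2, add_assoc]

end ClassCharacters

end OArakelov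

namespace OArakelov

noncomputable section Psi

open scoped MonoidAlgebra

local notation:73 g:74 "⋆" m:73 => (MonoidAlgebra.single g (1 : ℤ)) • m

variable {G : Type} [Group G] [Finite G] {F : Type} [Field F] [NumberField F]
  {K : Type} [Field K] [NumberField K] [Algebra K F] {iso : G ≃* (F ≃ₐ[K] F)}
  [Module ℤ[G] (Additive (𝓞 F)ˣ)]
  (hmU : ∀ (g : G) (u v : (𝓞 F)ˣ), ((v : 𝓞 F) : F) = iso g ((u : 𝓞 F) : F) →
    g ⋆ Additive.ofMul u = Additive.ofMul v)
  [Module ℤ[G] (AugKer F)]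
  (hmX : ∀ (g : G) (x : AugKer F), ((g ⋆ x : AugKer F) : InfinitePlace F →₀ ℤ) =
    Finsupp.mapDomain (fun w => iso g • w) (x : InfinitePlace F →₀ ℤ))
  [Module ℤ[G] (Additive (ClassGroup (𝓞 F)))]

omit [NumberField K] in
include hmU hmX in
theorem torsion_psi : ∃ n : ℕ, 0 < n ∧ n • (G0.cls ℤ[G] (Additive (𝓞 F)ˣ) -
    G0.cls ℤ[G] (AugKer F) - G0.cls ℤ[G] (Additive (ClassGroup (𝓞 F)))) = 0 := by
  obtain ⟨T, _, _, _, hT⟩ := cls_units_eq iso hmU hmX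
  obtain ⟨m, hm, h1⟩ := torsion_cls_of_finite (G := G) T
  obtain ⟨n, hn, h2⟩ := torsion_cls_of_finite (G := G) (Additive (ClassGroup (𝓞 F)))
  refine ⟨m * n, Nat.mul_pos hm hn, ?_⟩
  rw [hT, add_sub_cancel_left, nsmul_sub, mul_nsmul, h1, nsmul_zero, mul_nsmul', h2, nsmul_zero,
    sub_zero]

variable [Module ℤ[G] (ArTilde F)] [Module ℤ[G] ℤ]
  (hmZ : ∀ (g : G) (n : ℤ), g ⋆ n = n)
  (hA : ∀ (g : G) (φ : ArTilde F) (x : Additive (Vone F)),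
    arHom (g ⋆ φ) (iotaV F x) = arHom φ (iotaV F (galV (iso g⁻¹) x)))
  (hC : ∀ (g : G) (z : Additive (PicTilde F)), ∃ z', (∀ φ, arHom (g ⋆ φ) z = arHom φ z') ∧
    clsMap F z' = g⁻¹ ⋆ clsMap F z)

include hmU hmX hmZ hA hC in
theorem cls_arTilde_eq [IsGalois K F] :
    G0.cls ℤ[G] (ArTilde F) = Module.finrank ℚ K • G0.cls ℤ[G] ℤ[G] - G0.cls ℤ[G] ℤ +
      dualHom G (G0.cls ℤ[G] (Additive (𝓞 F)ˣ) - G0.cls ℤ[G] (AugKer F) -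
        G0.cls ℤ[G] (Additive (ClassGroup (𝓞 F)))) := by
  have : Module.Finite ℤ[G] (Additive (𝓞 F)ˣ) := finite_groupRing
  have h := cls_arTilde hmU hA hC
  rw [cls_perm_of_free (fun g s => Emb.eq_one_of_smul_eq) _ (Emb.card iso),
    cls_perm_places iso hmX hmZ] at h
  rw [map_sub, map_sub, dualHom_eq_sub (rootsU G F), dualHom_augKer iso hmX hmZ, dualHom_of_finite,
    eq_sub_of_add_eq (eq_sub_of_add_eq h)]
  abel

include hmU hmX hmZ hA hC in
theorem cls_arTilde_eq_iff [IsGalois K F] :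
    G0.cls ℤ[G] (ArTilde F) = Module.finrank ℚ K • G0.cls ℤ[G] ℤ[G] - G0.cls ℤ[G] ℤ ↔
      G0.cls ℤ[G] (Additive (𝓞 F)ˣ) - G0.cls ℤ[G] (AugKer F) -
        G0.cls ℤ[G] (Additive (ClassGroup (𝓞 F))) = 0 := by
  rw [cls_arTilde_eq hmU hmX hmZ hA hC, add_eq_left]
  refine ⟨fun h => ?_, fun h => by rw [h, map_zero]⟩
  rw [← dualHom_dualHom (G := G) (_ - _), h, map_zero]

end Psi

end OArakelov

/-!
STATEMENT 17: Let F/K be a finite Galois extension of number fields with Galois group G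
and let d be the degree of K over ℚ.  Define
Ψ(F/K) = [O_F^×] − [X_{S∞}] − [Cl_F] ∈ G₀(ℤ[G]), where S∞ is the set of archimedean
places of F, X_{S∞} = ker(ℤ[S∞] → ℤ) is the augmentation kernel, and Cl_F is the ideal
class group of F.  Then:
(i) the equality [Ãr_F] = d·[ℤ[G]] − [ℤ] holds in G₀(ℤ[G]) if and only if Ψ(F/K) = 0;
(ii) Ψ(F/K) always lies in the torsion subgroup of G₀(ℤ[G]).
-/
theorem stmt17
    (K F : Type) [Field K] [NumberField K] [Field F] [NumberField F] [Algebra K F]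
    [IsGalois K F] (G : Type) [Group G] (iso : G ≃* (F ≃ₐ[K] F))
    -- the Galois action of G on the oriented Arakelov class group, characterized on classes
    -- of oriented Arakelov divisors (I, b) via the action on the underlying ideals and on F_ℝ
    (ρT : G → PicTilde F → PicTilde F)
    (hρT : ∀ (g : G) (x : picDom F), ∃ y : picDom F,
      ((((((y : IdealGroup F × (FReal F)ˣ).1 : FractionalIdeal (𝓞 F)⁰ F) :
          Submodule (𝓞 F) F) : Set F)) =
        (iso g) '' (((((x : IdealGroup F × (FReal F)ˣ).1 : FractionalIdeal (𝓞 F)⁰ F) :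
          Submodule (𝓞 F) F) : Set F))) ∧
      (((y : IdealGroup F × (FReal F)ˣ).2 : FReal F) =
        galFReal K (iso g) ((x : IdealGroup F × (FReal F)ˣ).2 : FReal F)) ∧
      ρT g (PicTilde.mk F x) = PicTilde.mk F y)
    -- the ℤ[G]-module structure on the Pontryagin dual (G acting via g ↦ g⁻¹)
    [mAT : Module (MonoidAlgebra ℤ G) (ArTilde F)]
    (hmAT : ∀ (g : G) (φ : ArTilde F) (z : PicTilde F),
      ((MonoidAlgebra.single g (1 : ℤ) : MonoidAlgebra ℤ G) • φ) (Additive.ofMul z) =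
        φ (Additive.ofMul (ρT g⁻¹ z)))
    -- the ℤ[G]-module O_F^×
    [mU : Module (MonoidAlgebra ℤ G) (Additive (𝓞 F)ˣ)]
    (hmU : ∀ (g : G) (u v : (𝓞 F)ˣ), ((v : 𝓞 F) : F) = iso g ((u : 𝓞 F) : F) →
      (MonoidAlgebra.single g (1 : ℤ) : MonoidAlgebra ℤ G) • Additive.ofMul u =
        Additive.ofMul v)
    -- the ℤ[G]-module X_{S∞}, the kernel of the augmentation map ℤ[S∞] → ℤ
    [mX : Module (MonoidAlgebra ℤ G)
      (LinearMap.ker (Finsupp.linearCombination ℤ (fun _ : NumberField.InfinitePlace F => (1 : ℤ))))]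
    (hmX : ∀ (g : G)
        (x : LinearMap.ker (Finsupp.linearCombination ℤ (fun _ : NumberField.InfinitePlace F => (1 : ℤ)))),
      (((MonoidAlgebra.single g (1 : ℤ) : MonoidAlgebra ℤ G) • x :
          LinearMap.ker (Finsupp.linearCombination ℤ (fun _ : NumberField.InfinitePlace F => (1 : ℤ)))) :
            NumberField.InfinitePlace F →₀ ℤ) =
        Finsupp.mapDomain (fun w => iso g • w) (x : NumberField.InfinitePlace F →₀ ℤ))
    -- the ℤ[G]-module Cl_F, characterized on classes of nonzero ideals of O_F
    [mCl : Module (MonoidAlgebra ℤ G) (Additive (ClassGroup (𝓞 F)))]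
    (hmCl : ∀ (g : G) (I J : (Ideal (𝓞 F))⁰),
      (algebraMap (𝓞 F) F '' ((J : Ideal (𝓞 F)) : Set (𝓞 F)) =
        iso g '' (algebraMap (𝓞 F) F '' ((I : Ideal (𝓞 F)) : Set (𝓞 F)))) →
      (MonoidAlgebra.single g (1 : ℤ) : MonoidAlgebra ℤ G) •
          Additive.ofMul (ClassGroup.mk0 I) = Additive.ofMul (ClassGroup.mk0 J))
    -- the trivial ℤ[G]-module ℤ
    [mZ : Module (MonoidAlgebra ℤ G) ℤ]
    (hmZ : ∀ (g : G) (n : ℤ),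
      (MonoidAlgebra.single g (1 : ℤ) : MonoidAlgebra ℤ G) • n = n)
 :
    ((G0.cls (MonoidAlgebra ℤ G) (ArTilde F) =
      (Module.finrank ℚ K) • G0.cls (MonoidAlgebra ℤ G) (MonoidAlgebra ℤ G) -
        G0.cls (MonoidAlgebra ℤ G) ℤ) ↔
      (G0.cls (MonoidAlgebra ℤ G) (Additive (𝓞 F)ˣ) -
        G0.cls (MonoidAlgebra ℤ G)
          (LinearMap.ker (Finsupp.linearCombination ℤ (fun _ : NumberField.InfinitePlace F => (1 : ℤ)))) -
        G0.cls (MonoidAlgebra ℤ G) (Additive (ClassGroup (𝓞 F)))) = 0) ∧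
    (∃ n : ℕ, 0 < n ∧ n • (G0.cls (MonoidAlgebra ℤ G) (Additive (𝓞 F)ˣ) -
        G0.cls (MonoidAlgebra ℤ G)
          (LinearMap.ker (Finsupp.linearCombination ℤ (fun _ : NumberField.InfinitePlace F => (1 : ℤ)))) -
        G0.cls (MonoidAlgebra ℤ G) (Additive (ClassGroup (𝓞 F)))) = 0) := by
  have : Finite G := Finite.of_equiv _ iso.symm.toEquiv
  refine ⟨OArakelov.cls_arTilde_eq_iff hmU hmX hmZ (fun g φ x => ?_) fun g z => ?_,
    OArakelov.torsion_psi hmU hmX⟩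
  · exact (hmAT g φ (Additive.toMul (OArakelov.iotaV F x))).trans
      (congrArg φ (OArakelov.act_iotaV hρT g⁻¹ x))
  · exact ⟨Additive.ofMul (ρT g⁻¹ (Additive.toMul z)), fun φ => hmAT g φ (Additive.toMul z),
      OArakelov.clsMap_act hρT hmCl g⁻¹ (Additive.toMul z)⟩
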